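/- Assume conditions (A1)–(A4). Then σ_g² := 2∫_X g χ_g dμ_* is finite, and whenever σ_g² > 0 the additive functional I_t(g) = ∫_0^t g(Φ_s) ds satisfies the law of the iterated logarithm under ℙ_μ: liminf_{t→∞} I_t(g)/√(2σ_g² t ln ln t) = −1 and limsup_{t→∞} I_t(g)/√(2σ_g² t ln ln t) = 1, ℙ_μ-almost surely. -/

import Mathlib

open MeasureTheory Filter Set
open scoped ENNReal Topology NNReal

noncomputable section

variable {X : Type*} [MetricSpace X] [CompleteSpace X] [SecondCountableTopology X]
  [MeasurableSpace X] [BorelSpace X]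

/-- Action of a transition kernel family on measures: `ν ↦ ν P_t`. -/
def measAct (P : ℝ → X → Measure X) (t : ℝ) (ν : Measure X) : Measure X :=
  ν.bind (P t)

/-- Dual action of the semigroup on functions: `f ↦ P_t f`. -/
def funAct (P : ℝ → X → Measure X) (t : ℝ) (f : X → ℝ) (x : X) : ℝ :=
  ∫ y, f y ∂(P t x)

/-- A Borel (probability) measure has a finite first moment. -/
def FiniteFirstMoment (ν : Measure X) : Prop :=
  ∀ x₀ : X, Integrable (fun x => dist x₀ x) ν

/-- The Wasserstein (Kantorovich–Rubinstein) distance `d_W`. -/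
def wassDist (μ ν : Measure X) : ℝ :=
  sSup {r | ∃ f : X → ℝ, LipschitzWith 1 f ∧ r = |(∫ x, f x ∂μ) - ∫ x, f x ∂ν|}

/-- A Markov semigroup `{P_t}_{t ≥ 0}` of probability kernels on `X`. -/
structure IsMarkovSemigroup (P : ℝ → X → Measure X) : Prop where
  prob : ∀ t, 0 ≤ t → ∀ x, IsProbabilityMeasure (P t x)
  jointMeas : ∀ A : Set X, MeasurableSet A → Measurable fun p : ℝ × X => P p.1 p.2 A
  init : ∀ x, P 0 x = Measure.dirac x
  chapman : ∀ s t, 0 ≤ s → 0 ≤ t → ∀ x, P (s + t) x = (P s x).bind (P t)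

/-- Condition (A1): stochastic continuity of the semigroup. -/
def CondA1 (P : ℝ → X → Measure X) : Prop :=
  ∀ f : X → ℝ, Continuous f → (∃ C, ∀ x, |f x| ≤ C) →
    ∀ x : X, Tendsto (fun t => funAct P t f x) (𝓝[>] (0 : ℝ)) (𝓝 (f x))

/-- Condition (A2): the Feller property. -/
def CondA2 (P : ℝ → X → Measure X) : Prop :=
  ∀ f : X → ℝ, Continuous f → (∃ C, ∀ x, |f x| ≤ C) → ∀ t, 0 ≤ t →
    Continuous (funAct P t f) ∧ ∃ C, ∀ x, |funAct P t f x| ≤ C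

/-- Condition (A3): preservation of finite first moments and exponential
contractivity in the Wasserstein distance, with rate `γ`. -/
def CondA3 (P : ℝ → X → Measure X) (γ : ℝ) : Prop :=
  (∀ ν : Measure X, IsProbabilityMeasure ν → FiniteFirstMoment ν →
    ∀ t, 0 < t → FiniteFirstMoment (measAct P t ν)) ∧
  0 < γ ∧
  ∀ t, 0 ≤ t → ∀ x y : X,
    wassDist (P t x) (P t y) ≤ Real.exp (-γ * t) * dist x y

/-- Condition (A4): a uniform-in-time moment bound of order `ζ > 2` for the initial
distribution `μ`, along the semigroup. -/
def CondA4 (P : ℝ → X → Measure X) (μ : Measure X) (x₀ : X) (ζ : ℝ) : Prop :=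
  2 < ζ ∧ ∃ M : ℝ, ∀ t, 0 ≤ t →
    (∫⁻ x, ENNReal.ofReal (dist x₀ x ^ ζ) ∂(measAct P t μ)) ≤ ENNReal.ofReal M

variable {Ω : Type*} [MeasurableSpace Ω]

/-- The natural filtration of the process `Φ`. -/
def natFiltration (Φ : ℝ → Ω → X) (s : ℝ) : MeasurableSpace Ω :=
  ⨆ u ∈ Set.Icc (0 : ℝ) s, MeasurableSpace.comap (Φ u) inferInstance

/-- A (progressively measurable) time-homogeneous Markov process with state space `X`,
transition semigroup `P` and initial distribution `μ`, realized on `(Ω, ℙ)`. -/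
structure IsMarkovProcess (P : ℝ → X → Measure X) (Φ : ℝ → Ω → X)
    (ℙ : Measure Ω) (μ : Measure X) : Prop where
  jointMeas : Measurable fun p : ℝ × Ω => Φ p.1 p.2
  init : ℙ.map (Φ 0) = μ
  law : ∀ t, 0 ≤ t → ℙ.map (Φ t) = measAct P t μ
  markov : ∀ f : X → ℝ, Measurable f → (∃ C, ∀ x, |f x| ≤ C) →
    ∀ s t : ℝ, 0 ≤ s → 0 ≤ t →
      (fun ω => funAct P t f (Φ s ω)) =ᵐ[ℙ]
        ℙ[(fun ω => f (Φ (s + t) ω)) | natFiltration Φ s]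

/-- A Markov process together with a measurable family of laws `{ℙ_x}_{x ∈ X}`,
with `ℙ_x(Φ_0 = x) = 1`. -/
structure IsMarkovFamily (P : ℝ → X → Measure X) (Φ : ℝ → Ω → X)
    (ℙ : X → Measure Ω) : Prop where
  prob : ∀ x, IsProbabilityMeasure (ℙ x)
  jointMeas : Measurable fun p : ℝ × Ω => Φ p.1 p.2
  measFam : ∀ s : Set Ω, MeasurableSet s → Measurable fun x => ℙ x s
  start : ∀ x, (ℙ x) {ω | Φ 0 ω = x} = 1
  law : ∀ x, ∀ t, 0 ≤ t → (ℙ x).map (Φ t) = P t x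
  markov : ∀ x : X, ∀ f : X → ℝ, Measurable f → (∃ C, ∀ z, |f z| ≤ C) →
    ∀ s t : ℝ, 0 ≤ s → 0 ≤ t →
      (fun ω => funAct P t f (Φ s ω)) =ᵐ[ℙ x]
        (ℙ x)[(fun ω => f (Φ (s + t) ω)) | natFiltration Φ s]

/-- The corrector function `χ_g(x) = ∫_0^∞ (P_t g)(x) dt`. -/
def corrector (P : ℝ → X → Measure X) (g : X → ℝ) (x : X) : ℝ :=
  ∫ t in Set.Ioi (0 : ℝ), funAct P t g x

/-- The additive functional `I_t(g) = ∫_0^t g(Φ_s) ds`. -/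
def addFun (g : X → ℝ) (Φ : ℝ → Ω → X) (t : ℝ) (ω : Ω) : ℝ :=
  ∫ s in (0 : ℝ)..t, g (Φ s ω)

/-- The martingale part `M_t(g) = χ_g(Φ_t) - χ_g(Φ_0) + I_t(g)`. -/
def mart (P : ℝ → X → Measure X) (g : X → ℝ) (Φ : ℝ → Ω → X) (t : ℝ) (ω : Ω) : ℝ :=
  corrector P g (Φ t ω) - corrector P g (Φ 0 ω) + addFun g Φ t ω

/-- The martingale increments `Z_n(g) = M_n(g) - M_{n-1}(g)`. -/
def incr (P : ℝ → X → Measure X) (g : X → ℝ) (Φ : ℝ → Ω → X) (n : ℕ) (ω : Ω) : ℝ :=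
  mart P g Φ (n : ℝ) ω - mart P g Φ ((n : ℝ) - 1) ω

/-- Truncation `a ∧ p` for `p ∈ ℕ ∪ {∞}`, with the convention `a ∧ ∞ = a`. -/
def truncMin (a : ℝ) (p : ℕ∞) : ℝ :=
  if p = ⊤ then a else min a (p.toNat : ℝ)

set_option linter.unusedSectionVars false

/-- Bounded martingale differences `Z j` (measurable at time `j+1`) with conditional variances
`v j`, formulated through integration against bounded test functions. -/
structure BMD {α : Type*} {m0 : MeasurableSpace α} (ℙ : Measure α) (ℱ : Filtration ℕ m0)
    (Z v : ℕ → α → ℝ) (c : ℝ) : Prop where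
  mZ : ∀ j, Measurable[ℱ (j+1)] (Z j)
  mv : ∀ j, Measurable[ℱ j] (v j)
  bZ : ∀ j x, |Z j x| ≤ c
  v0 : ∀ j x, 0 ≤ v j x
  bv : ∀ j x, v j x ≤ c ^ 2
  cZ : ∀ j (Y : α → ℝ), Measurable[ℱ j] Y → (∃ C, ∀ x, |Y x| ≤ C) → ∫ x, Y x * Z j x ∂ℙ = 0
  cv : ∀ j (Y : α → ℝ), Measurable[ℱ j] Y → (∃ C, ∀ x, |Y x| ≤ C) →
    ∫ x, Y x * Z j x ^ 2 ∂ℙ = ∫ x, Y x * v j x ∂ℙ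

/-- Partial sums. -/
def psum {α : Type*} (Z : ℕ → α → ℝ) (n : ℕ) (x : α) : ℝ := ∑ j ∈ Finset.range n, Z j x

lemma psum_zero {α : Type*} (Z : ℕ → α → ℝ) (x : α) : psum Z 0 x = 0 := by simp [psum]

lemma psum_succ {α : Type*} (Z : ℕ → α → ℝ) (n : ℕ) (x : α) :
    psum Z (n+1) x = psum Z n x + Z n x := by simp [psum, Finset.sum_range_succ]

lemma exp_quad_bounds {x : ℝ} (hx : |x| ≤ 1) :
    Real.exp x ≤ 1 + x + x^2/2 * (1 + |x|) ∧ 1 + x + x^2/2 * (1 - |x|) ≤ Real.exp x := by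
  have h := Real.exp_bound hx (n := 3) (by norm_num)
  simp [Finset.sum_range_succ, Nat.factorial] at h
  norm_num at h
  have h3 : |x|^3 = x^2 * |x| := by rw [pow_succ, sq_abs]
  rw [h3, abs_le] at h
  have : 0 ≤ x^2 * |x| := by positivity
  constructor <;> nlinarith

lemma exp_lo_aux {s w : ℝ} (hs : 0 ≤ s) (hs2 : s ≤ 1/2) (hw : 0 ≤ w) (hw2 : w ≤ s^2/2) :
    Real.exp ((1 - 2*s) * w) ≤ 1 + (1 - s) * w := by
  have ht0 : 0 ≤ (1 - 2*s) * w := mul_nonneg (by linarith) hw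
  have hw1 : w ≤ s/4 := by nlinarith
  have ht : |(1-2*s)*w| ≤ 1 := by
    rw [abs_of_nonneg ht0]; nlinarith
  have h := (exp_quad_bounds ht).1
  rw [abs_of_nonneg ht0] at h ht
  have h2 : ((1-2*s)*w)^2/2 * (1 + (1-2*s)*w) ≤ ((1-2*s)*w)^2 := by nlinarith [sq_nonneg ((1-2*s)*w)]
  have h3 : (1-2*s)*w + ((1-2*s)*w)^2 ≤ (1-s)*w := by
    have h5 : (1-2*s)*(1-2*s) ≤ 1 := by nlinarith
    have : (1-2*s) + (1-2*s)^2*w ≤ 1 - s := by nlinarith [mul_le_mul h5 hw1 hw (by norm_num)]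
    nlinarith [mul_le_mul_of_nonneg_right this hw]
  linarith

section
variable {α : Type*} {m0 : MeasurableSpace α} {ℙ : Measure α} [IsProbabilityMeasure ℙ]
  {ℱ : Filtration ℕ m0} {Z v : ℕ → α → ℝ} {c : ℝ}

lemma integrable_of_bdd {f : α → ℝ} (hf : Measurable f) (hb : ∃ C, ∀ x, |f x| ≤ C) :
    Integrable f ℙ := by
  obtain ⟨C, hC⟩ := hb
  exact Integrable.of_bound hf.aestronglyMeasurable C (Eventually.of_forall hC)

lemma bdd_mul {f g : α → ℝ} (hf : ∃ C, ∀ x, |f x| ≤ C) (hg : ∃ C, ∀ x, |g x| ≤ C) :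
    ∃ C, ∀ x, |f x * g x| ≤ C := by
  obtain ⟨C, hC⟩ := hf
  obtain ⟨D, hD⟩ := hg
  refine ⟨C * D, fun x => ?_⟩
  rw [abs_mul]
  exact mul_le_mul (hC x) (hD x) (abs_nonneg _) ((abs_nonneg _).trans (hC x))

lemma bdd_add {f g : α → ℝ} (hf : ∃ C, ∀ x, |f x| ≤ C) (hg : ∃ C, ∀ x, |g x| ≤ C) :
    ∃ C, ∀ x, |f x + g x| ≤ C := by
  obtain ⟨C, hC⟩ := hf
  obtain ⟨D, hD⟩ := hg
  exact ⟨C + D, fun x => (abs_add_le _ _).trans (add_le_add (hC x) (hD x))⟩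

lemma bdd_const (a : ℝ) : ∃ C, ∀ x : α, |(fun _ : α => a) x| ≤ C := ⟨|a|, fun _ => le_rfl⟩

lemma bdd_exp {f : α → ℝ} (hf : ∃ C, ∀ x, |f x| ≤ C) : ∃ C, ∀ x, |Real.exp (f x)| ≤ C := by
  obtain ⟨C, hC⟩ := hf
  exact ⟨Real.exp C, fun x => by
    rw [abs_of_pos (Real.exp_pos _)]; exact Real.exp_le_exp.2 ((le_abs_self _).trans (hC x))⟩

lemma bdd_sum {f : ℕ → α → ℝ} (hf : ∀ j, ∃ C, ∀ x, |f j x| ≤ C) (n : ℕ) :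
    ∃ C, ∀ x, |psum f n x| ≤ C := by
  induction n with
  | zero => exact ⟨0, fun x => by simp [psum]⟩
  | succ n ih => simp only [psum_succ]; exact bdd_add ih (hf n)

lemma bdd_indicator {f : α → ℝ} (B : Set α) (hf : ∃ C, ∀ x, |f x| ≤ C) :
    ∃ C, ∀ x, |B.indicator f x| ≤ C := by
  obtain ⟨C, hC⟩ := hf
  refine ⟨C, fun x => ?_⟩
  by_cases h : x ∈ B
  · simpa [h] using hC x
  · simpa [h] using (abs_nonneg _).trans (hC x)

namespace BMD

lemma bddZ (h : BMD ℙ ℱ Z v c) (j : ℕ) : ∃ C, ∀ x, |Z j x| ≤ C := ⟨c, h.bZ j⟩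

lemma bddv (h : BMD ℙ ℱ Z v c) (j : ℕ) : ∃ C, ∀ x, |v j x| ≤ C :=
  ⟨c^2, fun x => by rw [abs_of_nonneg (h.v0 j x)]; exact h.bv j x⟩

lemma mZ0 (h : BMD ℙ ℱ Z v c) (j : ℕ) : Measurable (Z j) := (h.mZ j).mono (ℱ.le _) le_rfl

lemma mv0 (h : BMD ℙ ℱ Z v c) (j : ℕ) : Measurable (v j) := (h.mv j).mono (ℱ.le _) le_rfl

lemma mS (h : BMD ℙ ℱ Z v c) (n : ℕ) : Measurable[ℱ n] (psum Z n) := by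
  unfold psum
  exact Finset.measurable_sum _ (fun j hj =>
    (h.mZ j).mono (ℱ.mono (Finset.mem_range.1 hj)) le_rfl)

lemma mV (h : BMD ℙ ℱ Z v c) (n : ℕ) : Measurable[ℱ n] (psum v (n+1)) := by
  unfold psum
  exact Finset.measurable_sum _ (fun j hj =>
    (h.mv j).mono (ℱ.mono (Nat.lt_succ_iff.1 (Finset.mem_range.1 hj))) le_rfl)

lemma mV' (h : BMD ℙ ℱ Z v c) (n : ℕ) : Measurable[ℱ n] (psum v n) := by
  unfold psum
  exact Finset.measurable_sum _ (fun j hj =>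
    (h.mv j).mono (ℱ.mono (Finset.mem_range.1 hj).le) le_rfl)

lemma step_up (h : BMD ℙ ℱ Z v c) (j : ℕ) {l : ℝ} (hl : 0 ≤ l) (hlc : l * c ≤ 1/2)
    {Y : α → ℝ} (hY : Measurable[ℱ j] Y) (hYb : ∃ C, ∀ x, |Y x| ≤ C) (hY0 : ∀ x, 0 ≤ Y x) :
    ∫ x, Y x * Real.exp (l * Z j x) ∂ℙ
      ≤ ∫ x, Y x * Real.exp (l^2/2 * (1 + 2*l*c) * v j x) ∂ℙ := by
  have hY' : Measurable Y := hY.mono (ℱ.le _) le_rfl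
  have mz := h.mZ0 j
  have mv := h.mv0 j
  have e1 : Integrable (fun x => Y x) ℙ := integrable_of_bdd hY' hYb
  have e2 : Integrable (fun x => Y x * Z j x) ℙ :=
    integrable_of_bdd (hY'.mul mz) (bdd_mul hYb (h.bddZ j))
  have e12 : Integrable (fun x => Y x + l * (Y x * Z j x)) ℙ := e1.add (e2.const_mul l)
  have e3 : Integrable (fun x => Y x * Z j x ^ 2) ℙ := by
    refine integrable_of_bdd (hY'.mul (mz.pow_const 2)) (bdd_mul hYb ?_)
    simp only [pow_two]; exact bdd_mul (h.bddZ j) (h.bddZ j)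
  have e4 : Integrable (fun x => Y x * v j x) ℙ :=
    integrable_of_bdd (hY'.mul mv) (bdd_mul hYb (h.bddv j))
  calc ∫ x, Y x * Real.exp (l * Z j x) ∂ℙ
      ≤ ∫ x, (Y x + l * (Y x * Z j x)) + l^2/2 * (1 + l*c) * (Y x * Z j x ^ 2) ∂ℙ := by
        refine integral_mono ?_ ?_ ?_
        · exact integrable_of_bdd (hY'.mul (mz.const_mul l).exp)
            (bdd_mul hYb (bdd_exp (bdd_mul (bdd_const l) (h.bddZ j))))
        · exact (e1.add (e2.const_mul l)).add (e3.const_mul _)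
        · intro x
          have hz := h.bZ j x
          have hab : |l * Z j x| ≤ l * c := by
            rw [abs_mul, abs_of_nonneg hl]; exact mul_le_mul_of_nonneg_left hz hl
          have hb := (exp_quad_bounds (hab.trans (by linarith))).1
          have h2 : (l * Z j x)^2/2 * (1 + |l * Z j x|) ≤ (l * Z j x)^2/2 * (1 + l*c) := by
            gcongr
          have := mul_le_mul_of_nonneg_left (hb.trans (add_le_add_right h2 _)) (hY0 x)
          refine this.trans (le_of_eq ?_)
          ring
    _ = ∫ x, (Y x + l^2/2 * (1 + l*c) * (Y x * v j x)) ∂ℙ := by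
        rw [integral_add e12 (e3.const_mul _),
          integral_add e1 (e2.const_mul l), integral_const_mul, integral_const_mul,
          h.cZ j Y hY hYb, h.cv j Y hY hYb, integral_add e1 (e4.const_mul _), integral_const_mul]
        ring
    _ ≤ _ := by
        refine integral_mono (e1.add (e4.const_mul _)) ?_ ?_
        · exact integrable_of_bdd (hY'.mul (mv.const_mul _).exp)
            (bdd_mul hYb (bdd_exp (bdd_mul (bdd_const _) (h.bddv j))))
        · intro x
          have hc : 0 ≤ c := (abs_nonneg _).trans (h.bZ j x)
          have hlc0 : 0 ≤ l * c := mul_nonneg hl hc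
          have h1 := Real.add_one_le_exp (l^2/2 * (1 + 2*l*c) * v j x)
          have h2 : l^2/2 * (1 + l*c) * v j x ≤ l^2/2 * (1 + 2*l*c) * v j x := by
            have := h.v0 j x
            gcongr; nlinarith
          have := mul_le_mul_of_nonneg_left ((add_le_add_left h2 1).trans h1) (hY0 x)
          refine le_trans (le_of_eq ?_) this
          ring

lemma step_lo (h : BMD ℙ ℱ Z v c) (j : ℕ) {l : ℝ} (hl : 0 ≤ l) (hlc : l * c ≤ 1/2)
    {Y : α → ℝ} (hY : Measurable[ℱ j] Y) (hYb : ∃ C, ∀ x, |Y x| ≤ C) (hY0 : ∀ x, 0 ≤ Y x) :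
    ∫ x, Y x * Real.exp (l^2/2 * (1 - 2*l*c) * v j x) ∂ℙ
      ≤ ∫ x, Y x * Real.exp (l * Z j x) ∂ℙ := by
  have hY' : Measurable Y := hY.mono (ℱ.le _) le_rfl
  have mz := h.mZ0 j
  have mv := h.mv0 j
  have e1 : Integrable (fun x => Y x) ℙ := integrable_of_bdd hY' hYb
  have e2 : Integrable (fun x => Y x * Z j x) ℙ :=
    integrable_of_bdd (hY'.mul mz) (bdd_mul hYb (h.bddZ j))
  have e12 : Integrable (fun x => Y x + l * (Y x * Z j x)) ℙ := e1.add (e2.const_mul l)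
  have e3 : Integrable (fun x => Y x * Z j x ^ 2) ℙ := by
    refine integrable_of_bdd (hY'.mul (mz.pow_const 2)) (bdd_mul hYb ?_)
    simp only [pow_two]; exact bdd_mul (h.bddZ j) (h.bddZ j)
  have e4 : Integrable (fun x => Y x * v j x) ℙ :=
    integrable_of_bdd (hY'.mul mv) (bdd_mul hYb (h.bddv j))
  calc ∫ x, Y x * Real.exp (l^2/2 * (1 - 2*l*c) * v j x) ∂ℙ
      ≤ ∫ x, (Y x + l^2/2 * (1 - l*c) * (Y x * v j x)) ∂ℙ := by
        refine integral_mono ?_ (e1.add (e4.const_mul _)) ?_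
        · exact integrable_of_bdd (hY'.mul (mv.const_mul _).exp)
            (bdd_mul hYb (bdd_exp (bdd_mul (bdd_const _) (h.bddv j))))
        · intro x
          have hc : 0 ≤ c := (abs_nonneg _).trans (h.bZ j x)
          have hlc0 : 0 ≤ l * c := mul_nonneg hl hc
          have h0 := h.v0 j x
          have h1 := exp_lo_aux (s := l*c) (w := l^2/2 * v j x) hlc0 hlc (by positivity)
            (by have := mul_le_mul_of_nonneg_left (h.bv j x) (sq_nonneg l); nlinarith)
          have := mul_le_mul_of_nonneg_left h1 (hY0 x)
          refine le_trans (le_of_eq ?_) (this.trans (le_of_eq ?_))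
          · simp only; ring_nf
          · ring
    _ = ∫ x, (Y x + l * (Y x * Z j x)) + l^2/2 * (1 - l*c) * (Y x * Z j x ^ 2) ∂ℙ := by
        rw [integral_add e12 (e3.const_mul _),
          integral_add e1 (e2.const_mul l), integral_const_mul, integral_const_mul,
          h.cZ j Y hY hYb, h.cv j Y hY hYb, integral_add e1 (e4.const_mul _), integral_const_mul]
        ring
    _ ≤ _ := by
        refine integral_mono ?_ ?_ ?_
        · exact (e1.add (e2.const_mul l)).add (e3.const_mul _)
        · exact integrable_of_bdd (hY'.mul (mz.const_mul l).exp)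
            (bdd_mul hYb (bdd_exp (bdd_mul (bdd_const l) (h.bddZ j))))
        · intro x
          have hz := h.bZ j x
          have hab : |l * Z j x| ≤ l * c := by
            rw [abs_mul, abs_of_nonneg hl]; exact mul_le_mul_of_nonneg_left hz hl
          have hb := (exp_quad_bounds (hab.trans (by linarith))).2
          have h2 : (l * Z j x)^2/2 * (1 - l*c) ≤ (l * Z j x)^2/2 * (1 - |l * Z j x|) := by
            gcongr
          have := mul_le_mul_of_nonneg_left ((add_le_add_right h2 _).trans hb) (hY0 x)
          refine le_trans (le_of_eq ?_) this
          ring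

/-- Exponential process. -/
lemma mExp (h : BMD ℙ ℱ Z v c) (l a : ℝ) (n : ℕ) :
    Measurable[ℱ n] (fun x => Real.exp (l * psum Z n x - a * psum v n x)) := by
  have h1 := h.mS n
  have h2 := h.mV' n
  exact ((h1.const_mul l).sub (h2.const_mul a)).exp

lemma bExp (h : BMD ℙ ℱ Z v c) (l a : ℝ) (n : ℕ) :
    ∃ C, ∀ x, |Real.exp (l * psum Z n x - a * psum v n x)| ≤ C := by
  have h1 := bdd_exp (bdd_add (bdd_mul (bdd_const l) (bdd_sum h.bddZ n))
    (bdd_mul (bdd_const (-a)) (bdd_sum h.bddv n)))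
  simpa [sub_eq_add_neg] using h1

lemma iExp (h : BMD ℙ ℱ Z v c) (l a : ℝ) (n : ℕ) :
    Integrable (fun x => Real.exp (l * psum Z n x - a * psum v n x)) ℙ :=
  integrable_of_bdd ((h.mExp l a n).mono (ℱ.le _) le_rfl) (h.bExp l a n)

lemma exp_step (h : BMD ℙ ℱ Z v c) (n : ℕ) (l a : ℝ) {B : Set α} (hB : MeasurableSet[ℱ n] B) :
    ∃ Y : α → ℝ, Measurable[ℱ n] Y ∧ (∃ C, ∀ x, |Y x| ≤ C) ∧ (∀ x, 0 ≤ Y x) ∧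
      (∫ x in B, Real.exp (l * psum Z (n+1) x - a * psum v (n+1) x) ∂ℙ
        = ∫ x, Y x * Real.exp (l * Z n x) ∂ℙ) ∧
      (∫ x in B, Real.exp (l * psum Z n x - a * psum v n x) ∂ℙ
        = ∫ x, Y x * Real.exp (a * v n x) ∂ℙ) := by
  have hB' : MeasurableSet B := ℱ.le _ _ hB
  refine ⟨B.indicator fun x => Real.exp (l * psum Z n x - a * psum v (n+1) x), ?_, ?_, ?_, ?_, ?_⟩
  · have h1 := h.mS n
    have h2 := h.mV n
    exact Measurable.indicator ((h1.const_mul l).sub (h2.const_mul a)).exp hB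
  · apply bdd_indicator
    have h1 := bdd_exp (bdd_add (bdd_mul (bdd_const l) (bdd_sum h.bddZ n))
      (bdd_mul (bdd_const (-a)) (bdd_sum h.bddv (n+1))))
    simpa [sub_eq_add_neg] using h1
  · intro x; exact Set.indicator_nonneg (fun _ _ => (Real.exp_pos _).le) x
  · rw [← integral_indicator hB']
    congr 1; ext x
    by_cases hx : x ∈ B
    · simp only [hx, indicator_of_mem, ← Real.exp_add, psum_succ]; congr 1; ring
    · simp [hx]
  · rw [← integral_indicator hB']
    congr 1; ext x
    by_cases hx : x ∈ B
    · simp only [hx, indicator_of_mem, ← Real.exp_add, psum_succ]; congr 1; ring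
    · simp [hx]

lemma super (h : BMD ℙ ℱ Z v c) (n : ℕ) {l : ℝ} (hl : 0 ≤ l) (hlc : l * c ≤ 1/2)
    {B : Set α} (hB : MeasurableSet[ℱ n] B) :
    ∫ x in B, Real.exp (l * psum Z (n+1) x - (l^2/2 * (1 + 2*l*c)) * psum v (n+1) x) ∂ℙ
      ≤ ∫ x in B, Real.exp (l * psum Z n x - (l^2/2 * (1 + 2*l*c)) * psum v n x) ∂ℙ := by
  obtain ⟨Y, h1, h2, h3, h4, h5⟩ := h.exp_step n l (l^2/2 * (1 + 2*l*c)) hB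
  rw [h4, h5]
  exact h.step_up n hl hlc h1 h2 h3

lemma sub (h : BMD ℙ ℱ Z v c) (n : ℕ) {l : ℝ} (hl : 0 ≤ l) (hlc : l * c ≤ 1/2)
    {B : Set α} (hB : MeasurableSet[ℱ n] B) :
    ∫ x in B, Real.exp (l * psum Z n x - (l^2/2 * (1 - 2*l*c)) * psum v n x) ∂ℙ
      ≤ ∫ x in B, Real.exp (l * psum Z (n+1) x - (l^2/2 * (1 - 2*l*c)) * psum v (n+1) x) ∂ℙ := by
  obtain ⟨Y, h1, h2, h3, h4, h5⟩ := h.exp_step n l (l^2/2 * (1 - 2*l*c)) hB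
  rw [h4, h5]
  exact h.step_lo n hl hlc h1 h2 h3

lemma super0 (h : BMD ℙ ℱ Z v c) (n : ℕ) {l : ℝ} (hl : 0 ≤ l) (hlc : l * c ≤ 1/2)
    {B : Set α} (hB : MeasurableSet[ℱ 0] B) :
    ∫ x in B, Real.exp (l * psum Z n x - (l^2/2 * (1 + 2*l*c)) * psum v n x) ∂ℙ ≤ ℙ.real B := by
  induction n with
  | zero => simp [psum_zero]
  | succ n ih => exact (h.super n hl hlc (ℱ.mono (Nat.zero_le n) _ hB)).trans ih

lemma sub0 (h : BMD ℙ ℱ Z v c) (n : ℕ) {l : ℝ} (hl : 0 ≤ l) (hlc : l * c ≤ 1/2)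
    {B : Set α} (hB : MeasurableSet[ℱ 0] B) :
    ℙ.real B ≤ ∫ x in B, Real.exp (l * psum Z n x - (l^2/2 * (1 - 2*l*c)) * psum v n x) ∂ℙ := by
  induction n with
  | zero => simp [psum_zero]
  | succ n ih => exact ih.trans (h.sub n hl hlc (ℱ.mono (Nat.zero_le n) _ hB))

end BMD

/-- Maximal inequality for nonnegative supermartingales (integrated form). -/
lemma super_maximal {X : ℕ → α → ℝ} (hm : ∀ n, Measurable[ℱ n] (X n))
    (hi : ∀ n, Integrable (X n) ℙ) (h0 : ∀ n x, 0 ≤ X n x)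
    (hs : ∀ n B, MeasurableSet[ℱ n] B → ∫ x in B, X (n+1) x ∂ℙ ≤ ∫ x in B, X n x ∂ℙ)
    {a : ℝ} (ha : 0 < a) (k : ℕ) : ∀ n B, MeasurableSet[ℱ n] B →
      a * ℙ.real (B ∩ {x | ∃ j, n ≤ j ∧ j ≤ n + k ∧ a ≤ X j x}) ≤ ∫ x in B, X n x ∂ℙ := by
  induction k with
  | zero =>
    intro n B hB
    have hB' : MeasurableSet B := ℱ.le _ _ hB
    have hmn : Measurable (X n) := (hm n).mono (ℱ.le _) le_rfl
    have : B ∩ {x | ∃ j, n ≤ j ∧ j ≤ n + 0 ∧ a ≤ X j x} = {x | a ≤ X n x} ∩ B := by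
      ext x; simp only [mem_inter_iff, mem_ofPred_eq, add_zero]
      constructor
      · rintro ⟨h1, j, h2, h3, h4⟩
        obtain rfl := le_antisymm h2 h3
        exact ⟨h4, h1⟩
      · rintro ⟨h1, h2⟩; exact ⟨h2, n, le_rfl, le_rfl, h1⟩
    rw [this]
    have := mul_meas_ge_le_integral_of_nonneg (μ := ℙ.restrict B) (f := X n)
      (Eventually.of_forall (h0 n)) (hi n).integrableOn a
    rwa [measureReal_restrict_apply (measurableSet_le measurable_const hmn)] at this
  | succ k ih =>
    intro n B hB
    have hB' : MeasurableSet B := ℱ.le _ _ hB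
    have hmn : Measurable (X n) := (hm n).mono (ℱ.le _) le_rfl
    have hG : MeasurableSet[ℱ n] {x | a ≤ X n x} :=
      hm n measurableSet_Ici
    have hG' := ℱ.le _ _ hG
    have hsub : B ∩ {x | ∃ j, n ≤ j ∧ j ≤ n + (k+1) ∧ a ≤ X j x} ⊆
        ({x | a ≤ X n x} ∩ B) ∪
          ((B \ {x | a ≤ X n x}) ∩ {x | ∃ j, n+1 ≤ j ∧ j ≤ n + 1 + k ∧ a ≤ X j x}) := by
      rintro x ⟨h1, j, h2, h3, h4⟩
      by_cases hx : a ≤ X n x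
      · exact Or.inl ⟨hx, h1⟩
      · refine Or.inr ⟨⟨h1, hx⟩, j, ?_, by omega, h4⟩
        rcases h2.eq_or_lt with rfl | h
        · exact absurd h4 hx
        · exact h
    have h1 := measureReal_mono (μ := ℙ) hsub (measure_ne_top _ _)
    have h2 := measureReal_union_le (μ := ℙ) ({x | a ≤ X n x} ∩ B)
          ((B \ {x | a ≤ X n x}) ∩ {x | ∃ j, n+1 ≤ j ∧ j ≤ n + 1 + k ∧ a ≤ X j x})
    have hd : MeasurableSet[ℱ n] (B \ {x | a ≤ X n x}) := hB.diff hG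
    have h3 := ih (n+1) (B \ {x | a ≤ X n x}) (ℱ.mono (Nat.le_succ n) _ hd)
    have h4 := hs n _ hd
    have h5 : a * ℙ.real ({x | a ≤ X n x} ∩ B) ≤ ∫ x in B ∩ {x | a ≤ X n x}, X n x ∂ℙ := by
      have := mul_meas_ge_le_integral_of_nonneg (μ := ℙ.restrict (B ∩ {x | a ≤ X n x})) (f := X n)
        (Eventually.of_forall (h0 n)) (hi n).integrableOn a
      rw [measureReal_restrict_apply hG'] at this
      convert this using 3
      ext x; simp; tauto
    have h6 := integral_inter_add_sdiff (μ := ℙ) (f := X n) (s := B) hG' (hi n).integrableOn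
    calc _ ≤ a * (ℙ.real ({x | a ≤ X n x} ∩ B) + ℙ.real ((B \ {x | a ≤ X n x}) ∩ {x | ∃ j, n+1 ≤ j ∧ j ≤ n + 1 + k ∧ a ≤ X j x})) :=
          mul_le_mul_of_nonneg_left (h1.trans h2) ha.le
      _ ≤ _ := by rw [mul_add]; linarith

lemma BMD.upper (h : BMD ℙ ℱ Z v c) {l : ℝ} (hl : 0 ≤ l) (hlc : l * c ≤ 1/2) (N : ℕ)
    (thr vp : ℝ) :
    ℙ.real {x | ∃ j, j ≤ N ∧ thr ≤ psum Z j x ∧ psum v j x ≤ vp}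
      ≤ Real.exp (-(l * thr) + l^2/2 * (1 + 2*l*c) * vp) := by
  have hα : Nonempty α := by
    by_contra hne
    rw [not_nonempty_iff] at hne
    have := measure_univ (μ := ℙ)
    rw [Set.eq_empty_of_isEmpty (univ : Set α)] at this
    simp at this
  have hc : 0 ≤ c := (abs_nonneg _).trans (h.bZ 0 hα.some)
  set a := l^2/2 * (1 + 2*l*c) with ha
  have ha0 : 0 ≤ a := by positivity
  have key := super_maximal (ℙ := ℙ) (ℱ := ℱ) (X := fun n x => Real.exp (l * psum Z n x - a * psum v n x))
    (h.mExp l a) (h.iExp l a) (fun _ _ => (Real.exp_pos _).le)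
    (fun n B hB => h.super n hl hlc hB) (Real.exp_pos (l * thr - a * vp)) N 0 univ MeasurableSet.univ
  have h0 := h.super0 0 hl hlc (B := univ) MeasurableSet.univ
  have h1 := key.trans h0
  have h2 : ℙ.real {x | ∃ j, j ≤ N ∧ thr ≤ psum Z j x ∧ psum v j x ≤ vp} ≤
      ℙ.real (univ ∩ {x | ∃ j, 0 ≤ j ∧ j ≤ 0 + N ∧
        Real.exp (l * thr - a * vp) ≤ Real.exp (l * psum Z j x - a * psum v j x)}) := by
    refine measureReal_mono ?_ (measure_ne_top _ _)
    rintro x ⟨j, h3, h4, h5⟩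
    refine ⟨trivial, j, Nat.zero_le _, by omega, Real.exp_le_exp.2 ?_⟩
    have := mul_le_mul_of_nonneg_left h4 hl
    have := mul_le_mul_of_nonneg_left h5 ha0
    linarith
  rw [show -(l*thr) + a * vp = -(l * thr - a * vp) by ring, Real.exp_neg]
  rw [← one_div, le_div_iff₀ (Real.exp_pos _)]
  simp at h1
  calc _ ≤ ℙ.real (univ ∩ {x | ∃ j, 0 ≤ j ∧ j ≤ 0 + N ∧
        Real.exp (l * thr - a * vp) ≤ Real.exp (l * psum Z j x - a * psum v j x)}) *
          Real.exp (l * thr - a * vp) := mul_le_mul_of_nonneg_right h2 (Real.exp_pos _).le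
    _ ≤ 1 := by rw [mul_comm]; simpa using h1

end

section
variable {α : Type*} {m0 : MeasurableSpace α} {ℙ : Measure α} [IsProbabilityMeasure ℙ]
  {ℱ : Filtration ℕ m0} {Z v : ℕ → α → ℝ} {c : ℝ}

lemma young_exp {u q τ : ℝ} (hq : 1 < q) :
    Real.exp u ≤ Real.exp (q * u - (q-1) * τ) + Real.exp τ := by
  rcases le_total u τ with h | h
  · have := Real.exp_le_exp.2 h
    have := Real.exp_pos (q * u - (q-1) * τ)
    linarith
  · have : u ≤ q * u - (q-1) * τ := by nlinarith
    have := Real.exp_le_exp.2 this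
    have := Real.exp_pos τ
    linarith

lemma BMD.lower (h : BMD ℙ ℱ Z v c) {l q η thr vm vp : ℝ} (hl : 0 ≤ l) (hq : 1 < q)
    (hc : 0 ≤ c) (hqlc : (q * l) * c ≤ 1/2) (hη : 0 ≤ η) (hηl : η ≤ l) (N : ℕ)
    (hV : ∀ x, psum v N x ≤ vp)
    (h1 : (l-η)^2/2 * (1 + 2*(l-η)*c) ≤ l^2/2 * (1 - 2*l*c))
    (h2 : Real.exp (η * thr - (l^2/2 * (1 - 2*l*c) - (l-η)^2/2 * (1 + 2*(l-η)*c)) * vm) ≤ 1/2)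
    {B : Set α} (hB : MeasurableSet[ℱ 0] B) :
    1/4 * Real.exp (-((((q*l)^2/2 * (1 + 2*(q*l)*c) - q * (l^2/2 * (1 - 2*l*c))) * vp + Real.log 4)
      / (q-1))) * ℙ.real B ≤ ℙ.real (B ∩ ({x | thr ≤ psum Z N x} ∪ {x | psum v N x < vm})) := by
  have hB' : MeasurableSet B := ℱ.le _ _ hB
  have hlc : l * c ≤ 1/2 := by nlinarith [mul_nonneg hl hc]
  have hlc' : (l-η) * c ≤ 1/2 := by nlinarith [mul_nonneg hl hc, mul_nonneg hη hc]
  set c1 := l^2/2 * (1 - 2*l*c) with hc1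
  set c2 := (l-η)^2/2 * (1 + 2*(l-η)*c) with hc2
  set c3 := (q*l)^2/2 * (1 + 2*(q*l)*c) with hc3
  have hql : 0 ≤ q * l := by positivity
  have hc31 : q * c1 ≤ c3 := by
    rw [hc1, hc3]
    have e1 : q * (l^2/2 * (1 - 2*l*c)) ≤ q * (l^2/2) := by
      have : 0 ≤ l * c := mul_nonneg hl hc
      have : 0 ≤ q * (l^2/2) * (2 * (l * c)) := by positivity
      nlinarith
    have e2 : q * (l^2/2) ≤ (q*l)^2/2 := by nlinarith [mul_nonneg (sub_nonneg.2 hq.le) (sq_nonneg l)]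
    have e3 : (q*l)^2/2 ≤ (q*l)^2/2 * (1 + 2*(q*l)*c) := by
      have : 0 ≤ (q*l)*c := by positivity
      nlinarith [sq_nonneg (q*l)]
    linarith
  set τ := ((c3 - q * c1) * vp + Real.log 4) / (q-1) with hτ
  set A : Set α := {x | thr ≤ psum Z N x} ∪ {x | psum v N x < vm} with hA
  have mS : Measurable (psum Z N) := (h.mS N).mono (ℱ.le _) le_rfl
  have mV : Measurable (psum v N) := (h.mV' N).mono (ℱ.le _) le_rfl
  have hAm : MeasurableSet A :=
    (measurableSet_le measurable_const mS).union (measurableSet_lt mV measurable_const)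
  have s1 := h.sub0 N hl hlc hB
  rw [← hc1] at s1
  have i1 := h.iExp l c1 N
  rw [← integral_inter_add_sdiff hAm i1.integrableOn] at s1
  -- the complement part
  have s2 : ∫ x in B \ A, Real.exp (l * psum Z N x - c1 * psum v N x) ∂ℙ ≤ 1/2 * ℙ.real B := by
    have i2 := h.iExp (l-η) c2 N
    calc ∫ x in B \ A, Real.exp (l * psum Z N x - c1 * psum v N x) ∂ℙ
        ≤ ∫ x in B \ A, Real.exp (η * thr - (c1 - c2) * vm) *
            Real.exp ((l-η) * psum Z N x - c2 * psum v N x) ∂ℙ := by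
          refine setIntegral_mono_on i1.integrableOn (i2.const_mul _).integrableOn
            (hB'.diff hAm) ?_
          intro x hx
          have hx1 : psum Z N x < thr := by
            by_contra hcon; exact hx.2 (Or.inl (not_lt.1 hcon))
          have hx2 : vm ≤ psum v N x := by
            by_contra hcon; exact hx.2 (Or.inr (not_le.1 hcon))
          rw [← Real.exp_add]
          apply Real.exp_le_exp.2
          have e1 := mul_le_mul_of_nonneg_left hx1.le hη
          have e2 := mul_le_mul_of_nonneg_left hx2 (sub_nonneg.2 h1)
          linarith
      _ ≤ ∫ x in B, Real.exp (η * thr - (c1 - c2) * vm) *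
            Real.exp ((l-η) * psum Z N x - c2 * psum v N x) ∂ℙ := by
          refine setIntegral_mono_set (i2.const_mul _).integrableOn
            (Eventually.of_forall fun x => by positivity) ?_
          exact (sdiff_subset (s := B) (t := A)).eventuallyLE
      _ ≤ 1/2 * ℙ.real B := by
          rw [integral_const_mul]
          refine mul_le_mul h2 (h.super0 N (sub_nonneg.2 hηl) hlc' hB) ?_ (by norm_num)
          exact integral_nonneg fun x => (Real.exp_pos _).le
  have s3 : ∫ x in B ∩ A, Real.exp (l * psum Z N x - c1 * psum v N x) ∂ℙ
      ≤ 1/4 * ℙ.real B + Real.exp τ * ℙ.real (B ∩ A) := by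
    have i3 := h.iExp (q*l) c3 N
    have hk : Real.exp ((c3 - q*c1) * vp - (q-1)*τ) = 1/4 := by
      have : (q-1)*τ = (c3 - q * c1) * vp + Real.log 4 := by
        rw [hτ]; field_simp [(sub_pos.2 hq).ne']
      rw [this, show (c3 - q*c1) * vp - ((c3 - q * c1) * vp + Real.log 4) = - Real.log 4 by ring,
        Real.exp_neg, Real.exp_log (by norm_num)]; norm_num
    calc ∫ x in B ∩ A, Real.exp (l * psum Z N x - c1 * psum v N x) ∂ℙ
        ≤ ∫ x in B ∩ A, (1/4 * Real.exp ((q*l) * psum Z N x - c3 * psum v N x) + Real.exp τ) ∂ℙ := by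
          refine setIntegral_mono_on i1.integrableOn
            (((i3.const_mul _).add (integrable_const _)).integrableOn) (hB'.inter hAm) ?_
          intro x hx
          refine (young_exp (τ := τ) hq).trans ?_
          gcongr
          rw [← hk, ← Real.exp_add]
          apply Real.exp_le_exp.2
          have e2 := mul_le_mul_of_nonneg_left (hV x) (sub_nonneg.2 hc31)
          linarith
      _ = 1/4 * ∫ x in B ∩ A, Real.exp ((q*l) * psum Z N x - c3 * psum v N x) ∂ℙ
            + Real.exp τ * ℙ.real (B ∩ A) := by
          rw [integral_add (i3.const_mul _).integrableOn (integrable_const _).integrableOn,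
            integral_const_mul]
          simp [mul_comm]
      _ ≤ _ := by
          gcongr
          refine le_trans ?_ (h.super0 N hql hqlc hB)
          refine setIntegral_mono_set i3.integrableOn
            (Eventually.of_forall fun x => (Real.exp_pos _).le) ?_
          exact (inter_subset_left (s := B) (t := A)).eventuallyLE
  have s4 : 1/4 * ℙ.real B ≤ Real.exp τ * ℙ.real (B ∩ A) := by linarith
  have := mul_le_mul_of_nonneg_left s4 (Real.exp_pos (-τ)).le
  rw [← mul_assoc, ← mul_assoc, ← Real.exp_add] at this
  simp only [neg_add_cancel, Real.exp_zero, one_mul] at this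
  linarith
end

section
variable {α : Type*} {m0 : MeasurableSpace α} {ℙ : Measure α} [IsProbabilityMeasure ℙ]
  {ℱ : Filtration ℕ m0} {Z v : ℕ → α → ℝ} {b : ℕ → ℝ}

/-- Martingale differences with deterministic bounds `b j`. -/
structure GMD {α : Type*} {m0 : MeasurableSpace α} (ℙ : Measure α) (ℱ : Filtration ℕ m0)
    (Z v : ℕ → α → ℝ) (b : ℕ → ℝ) : Prop where
  mZ : ∀ j, Measurable[ℱ (j+1)] (Z j)
  mv : ∀ j, Measurable[ℱ j] (v j)
  bZ : ∀ j x, |Z j x| ≤ b j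
  v0 : ∀ j x, 0 ≤ v j x
  bv : ∀ j x, v j x ≤ b j ^ 2
  cZ : ∀ j (Y : α → ℝ), Measurable[ℱ j] Y → (∃ C, ∀ x, |Y x| ≤ C) → ∫ x, Y x * Z j x ∂ℙ = 0
  cv : ∀ j (Y : α → ℝ), Measurable[ℱ j] Y → (∃ C, ∀ x, |Y x| ≤ C) →
    ∫ x, Y x * Z j x ^ 2 ∂ℙ = ∫ x, Y x * v j x ∂ℙ

/-- Shifted filtration. -/
def shiftFil {m0 : MeasurableSpace α} (ℱ : Filtration ℕ m0) (n : ℕ) : Filtration ℕ m0 where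
  seq i := ℱ (n + i)
  mono' _ _ h := ℱ.mono (Nat.add_le_add_left h n)
  le' _ := ℱ.le _

lemma GMD.neg (h : GMD ℙ ℱ Z v b) : GMD ℙ ℱ (fun j x => - Z j x) v b where
  mZ j := (h.mZ j).neg
  mv := h.mv
  bZ j x := by rw [abs_neg]; exact h.bZ j x
  v0 := h.v0
  bv := h.bv
  cZ j Y h1 h2 := by simp only [mul_neg, integral_neg, h.cZ j Y h1 h2, neg_zero]
  cv j Y h1 h2 := by simp only [neg_sq]; exact h.cv j Y h1 h2

/-- Restricting to a block and to predictable events. -/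
lemma GMD.toBMD (h : GMD ℙ ℱ Z v b) (hb : Monotone b) (hb0 : ∀ j, 0 ≤ b j) (n N : ℕ)
    (G : ℕ → Set α) (hG : ∀ i, MeasurableSet[ℱ (n+i)] (G i)) :
    BMD ℙ (shiftFil ℱ n) (fun i x => if i < N then (G i).indicator (Z (n+i)) x else 0)
      (fun i x => if i < N then (G i).indicator (v (n+i)) x else 0) (b (n+N)) where
  mZ j := by
    by_cases hj : j < N
    · simp only [hj, if_true]
      exact (h.mZ (n+j)).indicator (ℱ.mono (Nat.le_succ _) _ (hG j))
    · simp only [hj, if_false]; exact measurable_const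
  mv j := by
    by_cases hj : j < N
    · simp only [hj, if_true]
      exact (h.mv (n+j)).indicator (hG j)
    · simp only [hj, if_false]; exact measurable_const
  bZ j x := by
    by_cases hj : j < N
    · simp only [hj, if_true]
      by_cases hx : x ∈ G j
      · simp only [hx, indicator_of_mem]
        exact (h.bZ _ x).trans (hb (by omega))
      · simpa [hx] using hb0 _
    · simpa [hj] using hb0 _
  v0 j x := by
    by_cases hj : j < N
    · simp only [hj, if_true]
      exact indicator_nonneg (fun _ _ => h.v0 _ _) x
    · simp [hj]
  bv j x := by
    by_cases hj : j < N
    · simp only [hj, if_true]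
      by_cases hx : x ∈ G j
      · simp only [hx, indicator_of_mem]
        exact (h.bv _ x).trans (pow_le_pow_left₀ (hb0 _) (hb (by omega)) 2)
      · simpa [hx] using sq_nonneg _
    · simpa [hj] using sq_nonneg _
  cZ j Y h1 h2 := by
    by_cases hj : j < N
    · simp only [hj, if_true]
      have := h.cZ (n+j) ((G j).indicator Y) (h1.indicator (hG j)) (bdd_indicator _ h2)
      rw [← this]; congr 1; ext x
      by_cases hx : x ∈ G j <;> simp [hx]
    · simp [hj]
  cv j Y h1 h2 := by
    by_cases hj : j < N
    · simp only [hj, if_true]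
      have := h.cv (n+j) ((G j).indicator Y) (h1.indicator (hG j)) (bdd_indicator _ h2)
      have e1 : ∀ x, Y x * (G j).indicator (Z (n+j)) x ^ 2 = (G j).indicator Y x * Z (n+j) x ^ 2 := by
        intro x; by_cases hx : x ∈ G j <;> simp [hx]
      have e2 : ∀ x, Y x * (G j).indicator (v (n+j)) x = (G j).indicator Y x * v (n+j) x := by
        intro x; by_cases hx : x ∈ G j <;> simp [hx]
      simp only [e1, e2, this]
    · simp [hj]


lemma low_aux1 {δ t : ℝ} (hδ : 0 < δ) (hδ2 : δ ≤ 1/4) (ht0 : 0 ≤ t) (hlc : t ≤ δ^2/16) :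
    (1+δ/8) * (1+δ) * (δ + (2*(1+δ)^2+2)*t) ≤ (1+3*δ)*δ := by
  have h1 : (2*(1+δ)^2+2)*t ≤ δ^2 := by
    have h0 : (1+δ)^2 ≤ (5/4)^2 := pow_le_pow_left₀ (by linarith) (by linarith) 2
    have : 2*(1+δ)^2+2 ≤ 16 := by linarith
    have := mul_le_mul_of_nonneg_right this ht0
    linarith
  have h2 : (1+δ/8) * (1+δ) * (δ + (2*(1+δ)^2+2)*t) ≤ (1+δ/8) * (1+δ) * (δ + δ^2) := by
    gcongr
  have h3 : (1+δ/8) * (1+δ) * (δ + δ^2) ≤ (1+3*δ)*δ := by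
    have h4 : δ^2 ≤ δ/4 := by nlinarith
    have h5 : δ^3 ≤ δ/16 := by nlinarith
    have : (1+δ/8) * (1+δ) * (1+δ) ≤ 1 + 3*δ := by
      have : (1+δ/8) * (1+δ) * (1+δ) = 1 + 17/8*δ + 5/4*δ^2+δ^3/8 := by ring
      rw [this]; linarith
    have := mul_le_mul_of_nonneg_right this hδ.le
    calc _ = (1+δ/8) * (1+δ) * (1+δ) * δ := by ring
      _ ≤ _ := this
  linarith

lemma low_aux2 {δ t : ℝ} (hδ : 0 < δ) (hδ2 : δ ≤ 1/4) (ht0 : 0 ≤ t) (hlc : t ≤ δ^2/16)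
    (ha3 : (1-δ)^2 * (1 + 2*(1-δ)*t) ≤ (1-δ)^2 + 2*t) :
    2*δ*(1-δ) - (1-δ/8)*((1-2*t) - (1-δ)^2 * (1 + 2*(1-δ)*t)) ≤ -(δ^2/2) := by
  have : (1-δ/8)*(2*δ - δ^2 - 4*t) ≤ (1-δ/8)*((1-2*t) - (1-δ)^2 * (1 + 2*(1-δ)*t)) := by
    refine mul_le_mul_of_nonneg_left ?_ (by linarith)
    nlinarith
  have h3 : 0 ≤ δ * t := mul_nonneg hδ.le ht0
  have h4 : 0 ≤ δ^3 := by positivity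
  nlinarith

/-- Packaged lower bound. -/
lemma BMD.lower' {c : ℝ} (h : BMD ℙ ℱ Z v c) {δ w L : ℝ} (hδ : 0 < δ) (hδ2 : δ ≤ 1/4) (hw : 0 < w)
    (hL : Real.log 2 ≤ L * δ^2/2) (hc : 0 ≤ c) (hlc : Real.sqrt (2*L/w) * c ≤ δ^2/16) (N : ℕ)
    (hV : ∀ x, psum v N x ≤ (1 + δ/8) * w) {B : Set α} (hB : MeasurableSet[ℱ 0] B) :
    1/4 * Real.exp (-(Real.log 4/δ)) * Real.exp (-((1+3*δ)*L)) * ℙ.real B ≤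
      ℙ.real (B ∩ ({x | (1-δ) * Real.sqrt (2*L*w) ≤ psum Z N x}
        ∪ {x | psum v N x < (1 - δ/8) * w})) := by
  have hlog2 : 0 < Real.log 2 := Real.log_pos (by norm_num)
  have hL0 : 0 < L := by
    by_contra hcon
    push Not at hcon
    nlinarith [sq_nonneg δ]
  set l := Real.sqrt (2*L/w) with hl
  have hl0 : 0 ≤ l := Real.sqrt_nonneg _
  have hl2 : l^2 * w = 2 * L := by
    rw [hl, Real.sq_sqrt (by positivity)]; field_simp
  have hlw : Real.sqrt (2*L*w) = l * w := by
    rw [hl, show 2*L*w = (2*L/w) * (w*w) by field_simp, Real.sqrt_mul (by positivity),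
      Real.sqrt_mul_self hw.le]
  set t := l * c with ht
  have ht0 : 0 ≤ t := mul_nonneg hl0 hc
  have hδδ : δ^2 ≤ 1/16 := by nlinarith
  have ha : (l-δ*l)^2/2 * (1 + 2*(l-δ*l)*c) = l^2/2 * ((1-δ)^2 * (1 + 2*(1-δ)*t)) := by
    rw [ht]; ring
  have ha2 : l^2/2 * (1 - 2*l*c) = l^2/2*(1-2*t) := by rw [ht]; ring
  have ha3 : (1-δ)^2 * (1 + 2*(1-δ)*t) ≤ (1-δ)^2 + 2*t := by
    have : (1-δ)^2*(1-δ) ≤ 1 := by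
      have h1 : 0 ≤ 1-δ := by linarith
      have h2 : 1-δ ≤ 1 := by linarith
      calc (1-δ)^2*(1-δ) = (1-δ)^3 := by ring
        _ ≤ 1 := pow_le_one₀ h1 h2
    nlinarith [mul_le_mul_of_nonneg_right this ht0]
  have key := h.lower (l := l) (q := 1+δ) (η := δ*l) (thr := (1-δ) * Real.sqrt (2*L*w))
    (vm := (1-δ/8)*w) (vp := (1+δ/8)*w) hl0 (by linarith) hc
    (by rw [mul_assoc, ← ht]; nlinarith) (by positivity) (by nlinarith) N hV
    (by
      rw [ha, ha2]
      refine mul_le_mul_of_nonneg_left ?_ (by positivity)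
      nlinarith)
    (by
      rw [ha, ha2, hlw]
      have : Real.exp (-Real.log 2) = 1/2 := by
        rw [Real.exp_neg, Real.exp_log (by norm_num)]; norm_num
      rw [← this]
      apply Real.exp_le_exp.2
      have e : δ * l * ((1 - δ) * (l * w)) -
          (l ^ 2 / 2 * (1 - 2 * t) - l ^ 2 / 2 * ((1 - δ) ^ 2 * (1 + 2 * (1 - δ) * t))) *
          ((1 - δ / 8) * w) = (l^2*w)/2 * (2*δ*(1-δ) -
            (1-δ/8)*((1-2*t) - (1-δ)^2 * (1 + 2*(1-δ)*t))) := by ring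
      rw [e, hl2]
      have e2 : 2*δ*(1-δ) - (1-δ/8)*((1-2*t) - (1-δ)^2 * (1 + 2*(1-δ)*t)) ≤ -(δ^2/2) := by
        exact low_aux2 hδ hδ2 ht0 hlc ha3
      have := mul_le_mul_of_nonneg_left e2 hL0.le
      linarith)
    hB
  refine le_trans ?_ key
  rw [mul_assoc (1/4), ← Real.exp_add]
  gcongr
  have e : (((1 + δ) * l) ^ 2 / 2 * (1 + 2 * ((1 + δ) * l) * c) -
      (1 + δ) * (l ^ 2 / 2 * (1 - 2 * l * c))) * ((1 + δ / 8) * w) =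
      (l^2*w)/2 * ((1+δ/8) * (1+δ) * (δ + (2*(1+δ)^2+2)*t)) := by rw [ht]; ring
  rw [e, hl2, add_sub_cancel_left, add_div, neg_add, add_comm]
  refine add_le_add_left (neg_le_neg ?_) _
  rw [div_le_iff₀ hδ]
  have e2 := low_aux1 hδ hδ2 ht0 hlc
  have := mul_le_mul_of_nonneg_left e2 hL0.le
  linarith

/-- A conditional Borel-Cantelli lemma. -/
lemma cond_BC {𝒢 : Filtration ℕ m0} {A : ℕ → Set α} (hA : ∀ k, MeasurableSet[𝒢 (k+1)] (A k))
    {p : ℕ → ℝ} {k0 : ℕ} (hp : ∀ k, k0 ≤ k → ∀ B, MeasurableSet[𝒢 k] B →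
      p k * ℙ.real B ≤ ℙ.real (B ∩ A k))
    (hs : Tendsto (fun n => ∑ k ∈ Finset.range n, p k) atTop atTop) :
    ∀ᵐ x ∂ℙ, ∃ᶠ k in atTop, x ∈ A k := by
  have key : ∀ m, k0 ≤ m → ℙ {x | ∀ k, m ≤ k → x ∉ A k} = 0 := by
    intro m hm
    have hD : ∀ M, MeasurableSet[𝒢 (m+M)] {x | ∀ k, m ≤ k → k < m + M → x ∉ A k} ∧
        ℙ.real {x | ∀ k, m ≤ k → k < m + M → x ∉ A k} ≤
          Real.exp (-(∑ k ∈ Finset.range (m+M), p k - ∑ k ∈ Finset.range m, p k)) := by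
      intro M
      induction M with
      | zero =>
        have : {x | ∀ k, m ≤ k → k < m + 0 → x ∉ A k} = univ := by
          ext x; simp; intro k h1 h2; omega
        rw [this]; simp
      | succ M ih =>
        have e : {x | ∀ k, m ≤ k → k < m + (M+1) → x ∉ A k} =
            {x | ∀ k, m ≤ k → k < m + M → x ∉ A k} \ A (m+M) := by
          ext x
          constructor
          · intro h
            exact ⟨fun k h1 h2 => h k h1 (by omega), h _ (by omega) (by omega)⟩
          · rintro ⟨h1, h2⟩ k h3 h4
            rcases Nat.lt_or_ge k (m+M) with h5 | h5
            · exact h1 k h3 h5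
            · have : k = m + M := by omega
              rw [this]; exact h2
        rw [e]
        refine ⟨(𝒢.mono (by omega) _ ih.1).diff (hA _), ?_⟩
        have h1 := hp (m+M) (by omega) _ ih.1
        have h2 := measureReal_sdiff_add_inter (μ := ℙ)
          (s := {x | ∀ k, m ≤ k → k < m + M → x ∉ A k}) (t := A (m+M)) (𝒢.le _ _ (hA _))
        have h3 : ℙ.real ({x | ∀ k, m ≤ k → k < m + M → x ∉ A k} \ A (m+M)) ≤
            (1 - p (m+M)) * ℙ.real {x | ∀ k, m ≤ k → k < m + M → x ∉ A k} := by linarith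
        have h4 : 1 - p (m+M) ≤ Real.exp (-p (m+M)) := by
          have := Real.add_one_le_exp (-p (m+M)); linarith
        refine h3.trans ((mul_le_mul_of_nonneg_right h4 measureReal_nonneg).trans
          ((mul_le_mul_of_nonneg_left ih.2 (Real.exp_pos _).le).trans (le_of_eq ?_)))
        rw [← Real.exp_add, ← add_assoc, Finset.sum_range_succ]; congr 1; ring
    have hle : ∀ M, ℙ.real {x | ∀ k, m ≤ k → x ∉ A k} ≤
        Real.exp (-(∑ k ∈ Finset.range (m+M), p k - ∑ k ∈ Finset.range m, p k)) := by
      intro M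
      refine (measureReal_mono ?_ (measure_ne_top _ _)).trans (hD M).2
      intro x hx k h1 _; exact hx k h1
    have hlim : Tendsto (fun M => Real.exp (-(∑ k ∈ Finset.range (m+M), p k -
        ∑ k ∈ Finset.range m, p k))) atTop (𝓝 0) := by
      refine Real.tendsto_exp_atBot.comp (tendsto_neg_atTop_atBot.comp ?_)
      refine tendsto_atTop_add_const_right _ _ ?_
      have : Tendsto (fun M => m + M) atTop atTop := tendsto_atTop_mono (fun M => Nat.le_add_left M m) tendsto_id
      exact hs.comp this
    have h0 : ℙ.real {x | ∀ k, m ≤ k → x ∉ A k} ≤ 0 := ge_of_tendsto' hlim hle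
    exact (measureReal_eq_zero_iff (measure_ne_top _ _)).1 (le_antisymm h0 measureReal_nonneg)
  have : ∀ᵐ x ∂ℙ, ∀ m, k0 ≤ m → ¬ ∀ k, m ≤ k → x ∉ A k := by
    rw [ae_all_iff]; intro m
    by_cases hm : k0 ≤ m
    · have h1 : ∀ᵐ x ∂ℙ, ¬ ∀ k, m ≤ k → x ∉ A k := by
        rw [ae_iff]; simpa using key m hm
      filter_upwards [h1] with x hx _ using hx
    · exact Eventually.of_forall fun x h => absurd h hm
  filter_upwards [this] with x hx
  rw [frequently_atTop]
  intro a
  have := hx (max k0 a) (le_max_left _ _)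
  push Not at this
  obtain ⟨k, h1, h2⟩ := this
  exact ⟨k, (le_max_right _ _).trans h1, h2⟩
end

/-- Iterated logarithm. -/
def LL (t : ℝ) : ℝ := Real.log (Real.log t)

/-- The LIL normalisation. -/
def phi (s t : ℝ) : ℝ := Real.sqrt (2 * s * t * LL t)

lemma one_le_log {t : ℝ} (ht : 3 ≤ t) : 1 ≤ Real.log t := by
  rw [Real.le_log_iff_exp_le (by linarith)]
  have := Real.exp_one_lt_d9
  linarith

lemma LL_nonneg {t : ℝ} (ht : 3 ≤ t) : 0 ≤ LL t := Real.log_nonneg (one_le_log ht)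

lemma LL_mono {a b : ℝ} (ha : 3 ≤ a) (hab : a ≤ b) : LL a ≤ LL b := by
  have := one_le_log ha
  exact Real.log_le_log (by linarith) (Real.log_le_log (by linarith) hab)

lemma phi_mono {s a b : ℝ} (hs : 0 ≤ s) (ha : 3 ≤ a) (hab : a ≤ b) : phi s a ≤ phi s b := by
  apply Real.sqrt_le_sqrt
  have := LL_nonneg ha
  have := LL_mono ha hab
  have : 0 ≤ b := by linarith
  gcongr

lemma phi_nonneg (s t : ℝ) : 0 ≤ phi s t := Real.sqrt_nonneg _

lemma tendsto_LL : Tendsto LL atTop atTop := Real.tendsto_log_atTop.comp Real.tendsto_log_atTop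

lemma summable_exp_LL {θ ε : ℝ} (hθ : 1 < θ) (hε : 0 < ε) :
    Summable (fun k : ℕ => Real.exp (-((1+ε) * LL (θ^k)))) := by
  have hl : 0 < Real.log θ := Real.log_pos hθ
  have h1 : Summable (fun k : ℕ => (k : ℝ) ^ (-(1+ε)) * (Real.log θ) ^ (-(1+ε))) :=
    (Real.summable_nat_rpow.2 (by linarith)).mul_right _
  refine (summable_congr_atTop ?_).1 h1
  filter_upwards [eventually_ge_atTop 1] with k hk
  have hk' : (0:ℝ) < k := by exact_mod_cast hk
  rw [← Real.mul_rpow hk'.le hl.le, LL, Real.log_pow, Real.rpow_def_of_pos (by positivity)]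
  congr 1; ring

section
variable {α : Type*} {m0 : MeasurableSpace α} {ℙ : Measure α} [IsProbabilityMeasure ℙ]
  {ℱ : Filtration ℕ m0} {Z v : ℕ → α → ℝ} {b : ℕ → ℝ} {s : ℝ}

lemma GMD.upper_ev (h : GMD ℙ ℱ Z v b) (hb : Monotone b) (hb0 : ∀ j, 0 ≤ b j)
    {l : ℝ} (hl : 0 ≤ l) (N : ℕ) (hlc : l * b N ≤ 1/2) (thr vp : ℝ) :
    ℙ.real {x | ∃ j, j ≤ N ∧ thr ≤ psum Z j x ∧ psum v j x ≤ vp} ≤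
      Real.exp (-(l*thr) + l^2/2*(1+2*l*b N)*vp) := by
  have h1 := h.toBMD hb hb0 0 N (fun _ => univ) (fun _ => MeasurableSet.univ)
  simp only [zero_add, indicator_univ] at h1
  have h2 := h1.upper hl hlc N thr vp
  refine le_trans (le_of_eq ?_) h2
  congr 1
  ext x
  have e : ∀ (Y : ℕ → α → ℝ) j, j ≤ N → psum (fun i x => if i < N then Y i x else 0) j x = psum Y j x := by
    intro Y j hj
    unfold psum
    refine Finset.sum_congr rfl fun i hi => ?_
    exact if_pos ((Finset.mem_range.1 hi).trans_le hj)
  constructor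
  · rintro ⟨j, h1, h2, h3⟩
    exact ⟨j, h1, by rw [e Z j h1]; exact h2, by rw [e v j h1]; exact h3⟩
  · rintro ⟨j, h1, h2, h3⟩
    exact ⟨j, h1, by rw [e Z j h1] at h2; exact h2, by rw [e v j h1] at h3; exact h3⟩

lemma upper_aux {ε t : ℝ} (hε : 0 < ε) (hε2 : ε ≤ 1/2) (ht0 : 0 ≤ t) (ht : t ≤ ε/8) :
    1 + ε/4 ≤ (1+ε)^2 * (2 - (1+2*t)*(1+ε/4)*(1+ε/4)) := by
  have h1 : (1+2*t)*(1+ε/4)*(1+ε/4) ≤ (1+ε/4)*(1+ε/4)*(1+ε/4) := by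
    gcongr; linarith
  have h2 : (1+ε/4)*(1+ε/4)*(1+ε/4) ≤ 1 + ε := by
    have a1 : ε^2 ≤ ε/2 := by nlinarith
    have a2 : ε^3 ≤ ε/4 := by nlinarith
    have : (1+ε/4)*(1+ε/4)*(1+ε/4) = 1 + 3/4*ε + 3/16*ε^2 + ε^3/64 := by ring
    linarith
  have h3 : (1+ε)^2 * (1-ε) ≤ (1+ε)^2 * (2 - (1+2*t)*(1+ε/4)*(1+ε/4)) := by
    exact mul_le_mul_of_nonneg_left (by linarith) (sq_nonneg _)
  have h4 : 1 + ε/4 ≤ (1+ε)^2 * (1-ε) := by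
    have : (1+ε)^2 * (1-ε) - (1+ε/4) = ε * (3/4 - ε - ε^2) := by ring
    have a1 : ε^2 ≤ 1/4 := by nlinarith
    have : 0 ≤ ε * (3/4 - ε - ε^2) := mul_nonneg hε.le (by linarith)
    linarith
  linarith

/-- Upper half of the LIL. -/
lemma GMD.lil_upper (h : GMD ℙ ℱ Z v b) (hb : Monotone b) (hb0 : ∀ j, 0 ≤ b j)
    (hbl : Tendsto (fun n : ℕ => b n * Real.sqrt (LL n / n)) atTop (𝓝 0))
    (hs : 0 < s) (hV : ∀ᵐ x ∂ℙ, Tendsto (fun n : ℕ => psum v n x / n) atTop (𝓝 s))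
    {ε : ℝ} (hε : 0 < ε) (hε2 : ε ≤ 1/2) :
    ∀ᵐ x ∂ℙ, ∀ᶠ n : ℕ in atTop, psum Z n x ≤ (1+ε) * phi s n := by
  set θ : ℝ := 1 + ε/4 with hθ
  have hθ1 : 1 < θ := by linarith
  have hθ2 : θ ≤ 2 := by linarith
  have hT : Tendsto (fun k : ℕ => θ^k) atTop atTop := tendsto_pow_atTop_atTop_of_one_lt hθ1
  set N : ℕ → ℕ := fun k => ⌊θ^(k+1)⌋₊ with hN
  have hNt : Tendsto N atTop atTop :=
    tendsto_nat_floor_atTop.comp (hT.comp (tendsto_add_atTop_nat 1))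
  set A : ℕ → Set α := fun k => {x | ∃ j, j ≤ N k ∧ (1+ε) * phi s (θ^k) ≤ psum Z j x ∧
    psum v j x ≤ (1+ε/4)*s*θ^(k+1)} with hA
  have hlam : ∀ᶠ k in atTop, ((1+ε) * phi s (θ^k) / (s * θ^k)) * b (N k) ≤ ε/8 := by
    have h1 : Tendsto (fun k => (1+ε) * Real.sqrt (4/s) * (b (N k) * Real.sqrt (LL (N k) / N k)))
        atTop (𝓝 0) := by
      simpa using (hbl.comp hNt).const_mul ((1+ε) * Real.sqrt (4/s))
    filter_upwards [h1.eventually (eventually_le_nhds (show (0:ℝ) < ε/8 by positivity)),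
      hT.eventually_ge_atTop (max 3 (1/(θ-1)))] with k hk hk2
    refine le_trans ?_ hk
    have hk3 : 3 ≤ θ^k := (le_max_left _ _).trans hk2
    have hk4 : 1/(θ-1) ≤ θ^k := (le_max_right _ _).trans hk2
    have hk5 : θ^k + 1 ≤ θ^(k+1) := by
      rw [div_le_iff₀ (by linarith)] at hk4
      rw [pow_succ]; linarith
    have hk6 : θ^k ≤ N k := by
      have := Nat.lt_floor_add_one (θ^(k+1))
      simp only [hN]; linarith
    have hk7 : (N k : ℝ) ≤ 2 * θ^k := by
      have := Nat.floor_le (show 0 ≤ θ^(k+1) by positivity)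
      simp only [hN]
      refine this.trans ?_
      rw [pow_succ]; nlinarith
    have hT0 : 0 < θ^k := by positivity
    have hN0 : (0:ℝ) < N k := by linarith
    have e : phi s (θ^k) / (s * θ^k) ≤ Real.sqrt (4/s) * Real.sqrt (LL (N k) / N k) := by
      rw [← Real.sqrt_mul (by positivity), div_le_iff₀ (by positivity)]
      rw [phi]
      apply Real.sqrt_le_iff.2
      refine ⟨by positivity, ?_⟩
      have hLL := LL_nonneg hk3
      have hLL2 := LL_mono hk3 hk6
      rw [mul_pow, Real.sq_sqrt (mul_nonneg (by positivity) (div_nonneg (hLL.trans hLL2) hN0.le))]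
      have e1 : 4/s * (LL (N k)/N k) * (s * θ^k)^2 = 2 * s * θ^k * LL (N k) * (2*θ^k / N k) := by
        field_simp; ring
      rw [e1]
      have e2 : 1 ≤ 2*θ^k / N k := by rw [le_div_iff₀ hN0]; linarith
      calc 2 * s * θ^k * LL (θ^k) ≤ 2 * s * θ^k * LL (N k) := by gcongr
        _ ≤ _ := le_mul_of_one_le_right (mul_nonneg (by positivity) (hLL.trans hLL2)) e2
    calc (1+ε) * phi s (θ^k) / (s * θ^k) * b (N k)
        = (1+ε) * (phi s (θ^k) / (s * θ^k)) * b (N k) := by ring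
      _ ≤ (1+ε) * (Real.sqrt (4/s) * Real.sqrt (LL (N k) / N k)) * b (N k) := by
          have := hb0 (N k)
          gcongr
      _ = _ := by ring
  have hprob : ∀ᶠ k in atTop, ℙ.real (A k) ≤ Real.exp (-((1+ε/4) * LL (θ^k))) := by
    filter_upwards [hlam, hT.eventually_ge_atTop 3] with k hk hk3
    set l := (1+ε) * phi s (θ^k) / (s * θ^k) with hl
    have hT0 : 0 < θ^k := by positivity
    have hl0 : 0 ≤ l := by
      have := phi_nonneg s (θ^k)
      positivity
    have hLL := LL_nonneg hk3
    refine (h.upper_ev hb hb0 hl0 (N k) (by linarith) _ _).trans ?_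
    apply Real.exp_le_exp.2
    have hphi : phi s (θ^k)^2 = 2 * s * θ^k * LL (θ^k) := by
      rw [phi, Real.sq_sqrt (by positivity)]
    have e1 : l * ((1+ε) * phi s (θ^k)) = 2 * ((1+ε)^2 * LL (θ^k)) := by
      rw [hl]
      field_simp
      rw [hphi]; ring
    have e2 : l^2 * (s*θ^k) = 2 * ((1+ε)^2 * LL (θ^k)) := by
      rw [← e1, hl]; field_simp
    have e3 : l^2/2*(1+2*l*b (N k))*((1+ε/4)*s*θ^(k+1)) =
        (1+ε)^2 * LL (θ^k) * ((1+2*(l*b (N k)))*(1+ε/4)*(1+ε/4)) := by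
      have : l^2/2*(1+2*l*b (N k))*((1+ε/4)*s*θ^(k+1)) = l^2 * (s*θ^k) / 2 *
        ((1+2*(l*b (N k)))*(1+ε/4)*(1+ε/4)) := by rw [pow_succ, hθ]; ring
      rw [this, e2]; ring
    rw [e1, e3]
    have := mul_le_mul_of_nonneg_right
      (upper_aux hε hε2 (mul_nonneg hl0 (hb0 (N k))) hk) hLL
    linarith
  have hsum : Summable (fun k => ℙ.real (A k)) := by
    have h1 := summable_exp_LL hθ1 (show 0 < ε/4 by positivity)
    refine h1.of_norm_bounded_eventually_nat ?_
    filter_upwards [hprob] with k hk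
    rw [Real.norm_of_nonneg measureReal_nonneg]; exact hk
  have hBC : ∀ᵐ x ∂ℙ, ∀ᶠ k in atTop, x ∉ A k := by
    apply ae_eventually_notMem
    have : ∀ k, ℙ (A k) = ENNReal.ofReal (ℙ.real (A k)) := fun k =>
      (ofReal_measureReal (measure_ne_top _ _)).symm
    simp_rw [this]
    exact hsum.tsum_ofReal_ne_top
  filter_upwards [hBC, hV] with x hx1 hx2
  obtain ⟨k0, hk0⟩ := eventually_atTop.1 (hx1.and (hT.eventually_ge_atTop 3))
  have hv : ∀ᶠ n : ℕ in atTop, psum v n x / n ≤ (1+ε/4)*s :=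
    hx2.eventually (eventually_le_nhds (by nlinarith))
  filter_upwards [hv, eventually_ge_atTop 1, tendsto_natCast_atTop_atTop.eventually_ge_atTop (θ^k0)]
    with n hn1 hn2 hn3
  have hn2' : (1:ℝ) ≤ n := by exact_mod_cast hn2
  obtain ⟨k, hk1, hk2⟩ := exists_nat_pow_near hn2' hθ1
  have hk : k0 ≤ k := by
    by_contra hcon
    have : θ^(k+1) ≤ θ^k0 := pow_le_pow_right₀ hθ1.le (by omega)
    linarith
  obtain ⟨h1, h2⟩ := hk0 k hk
  by_contra hcon
  push Not at hcon
  apply h1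
  refine ⟨n, Nat.le_floor hk2.le, ?_, ?_⟩
  · refine le_trans ?_ hcon.le
    have := phi_mono hs.le h2 hk1
    gcongr
  · rw [div_le_iff₀ (by linarith)] at hn1
    refine hn1.trans ?_
    gcongr
end

section
variable {α : Type*} {m0 : MeasurableSpace α} {ℙ : Measure α} [IsProbabilityMeasure ℙ]
  {ℱ : Filtration ℕ m0} {Z v : ℕ → α → ℝ} {b : ℕ → ℝ} {s : ℝ}

/-- The stopping-type sets used in blocks. -/
def blkG (v : ℕ → α → ℝ) (n : ℕ) (u : ℝ) (i : ℕ) : Set α :=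
  {x | ∑ j ∈ Finset.range (i+1), v (n+j) x ≤ u}

/-- Block-restricted process. -/
def blk (v : ℕ → α → ℝ) (n N : ℕ) (u : ℝ) (Z : ℕ → α → ℝ) (i : ℕ) (x : α) : ℝ :=
  if i < N then (blkG v n u i).indicator (Z (n+i)) x else 0

lemma GMD.blkBMD (h : GMD ℙ ℱ Z v b) (hb : Monotone b) (hb0 : ∀ j, 0 ≤ b j) (n N : ℕ) (u : ℝ) :
    BMD ℙ (shiftFil ℱ n) (blk v n N u Z) (blk v n N u v) (b (n+N)) := by
  refine h.toBMD hb hb0 n N (blkG v n u) (fun i => ?_)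
  refine measurableSet_le ?_ measurable_const
  refine Finset.measurable_sum _ fun j hj => ?_
  exact (h.mv (n+j)).mono (ℱ.mono (by have := Finset.mem_range.1 hj; omega)) le_rfl

lemma blk_bound (n N : ℕ) {u : ℝ} (hu : 0 ≤ u) (hv : ∀ j x, 0 ≤ v j x) (i : ℕ) (x : α) :
    psum (blk v n N u v) i x ≤ u := by
  induction i with
  | zero => simpa [psum_zero] using hu
  | succ i ih =>
    rw [psum_succ]
    by_cases hx : x ∈ blkG v n u i
    · have h1 : ∀ j, blk v n N u v j x ≤ v (n+j) x := by
        intro j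
        unfold blk
        split_ifs
        · exact indicator_le_self' (fun _ _ => hv _ _) x
        · exact hv _ _
      rw [← psum_succ]
      refine le_trans ?_ hx
      exact Finset.sum_le_sum fun j _ => h1 j
    · have : blk v n N u v i x = 0 := by
        unfold blk; simp [hx]
      rw [this]; linarith

lemma blk_eq (n N : ℕ) {u : ℝ} (hv : ∀ j x, 0 ≤ v j x) {x : α}
    (hx : psum v (n+N) x - psum v n x ≤ u) (Y : ℕ → α → ℝ) :
    psum (blk v n N u Y) N x = psum Y (n+N) x - psum Y n x := by
  have e : ∀ W : ℕ → α → ℝ, psum W (n+N) x - psum W n x = ∑ j ∈ Finset.range N, W (n+j) x := by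
    intro W; unfold psum; rw [Finset.sum_range_add]; ring
  rw [e] at hx ⊢
  unfold psum
  refine Finset.sum_congr rfl fun i hi => ?_
  have hi' := Finset.mem_range.1 hi
  unfold blk
  rw [if_pos hi', indicator_of_mem]
  refine le_trans ?_ hx
  exact Finset.sum_le_sum_of_subset_of_nonneg (Finset.range_subset_range.2 hi')
    (fun _ _ _ => hv _ _)

lemma sqrt_ge_self_mul {a c : ℝ} (ha : 0 ≤ a) (ha1 : a ≤ 1) :
    a * Real.sqrt c ≤ Real.sqrt (a * c) := by
  rw [Real.sqrt_mul ha]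
  refine mul_le_mul_of_nonneg_right ?_ (Real.sqrt_nonneg _)
  apply Real.le_sqrt_of_sq_le
  nlinarith

set_option maxHeartbeats 1000000 in
/-- Lower half of the LIL. -/
lemma GMD.lil_lower (h : GMD ℙ ℱ Z v b) (hb : Monotone b) (hb0 : ∀ j, 0 ≤ b j)
    (hbl : Tendsto (fun n : ℕ => b n * Real.sqrt (LL n / n)) atTop (𝓝 0))
    (hs : 0 < s) (hV : ∀ᵐ x ∂ℙ, Tendsto (fun n : ℕ => psum v n x / n) atTop (𝓝 s))
    {ε : ℝ} (hε : 0 < ε) (hε2 : ε ≤ 1/2) :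
    ∀ᵐ x ∂ℙ, ∃ᶠ n : ℕ in atTop, (1-ε) * phi s n ≤ psum Z n x := by
  obtain ⟨m, hm⟩ := exists_nat_ge (4/ε)
  have hm8 : (8:ℝ) ≤ m := by
    refine le_trans ?_ hm
    rw [le_div_iff₀ hε]; linarith
  have hm0 : (0:ℝ) < m := by linarith
  have hmε : 4 ≤ ε * m := by
    rw [div_le_iff₀ hε] at hm; linarith
  set r : ℕ := m^2 with hr
  have hrm : (r:ℝ) = m^2 := by rw [hr]; push_cast; rfl
  have hr64 : (64:ℝ) ≤ r := by rw [hrm]; nlinarith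
  have hr1 : 1 < r := by
    have : (1:ℝ) < r := by linarith
    exact_mod_cast this
  have hr0 : (0:ℝ) < r := by linarith
  set δ : ℝ := ε/20 with hδ
  have hδ0 : 0 < δ := by positivity
  have hδ4 : δ ≤ 1/40 := by linarith
  set M : ℕ → ℕ := fun k => r^(k+1) - r^k with hM
  have hle : ∀ k, r^k ≤ r^(k+1) := fun k => Nat.pow_le_pow_right (by omega) (by omega)
  have hMn : ∀ k, r^k + M k = r^(k+1) := fun k => by simp only [hM]; have := hle k; omega
  have hMc : ∀ k, (M k : ℝ) = (r:ℝ)^k * (r-1) := by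
    intro k
    have := congrArg (fun n : ℕ => (n:ℝ)) (hMn k)
    push_cast at this
    rw [pow_succ] at this
    linarith
  have hM0 : ∀ k, (0:ℝ) < M k := fun k => by
    rw [hMc]; exact mul_pos (by positivity) (by linarith)
  have hTk : Tendsto (fun k : ℕ => r^k) atTop atTop := tendsto_pow_atTop_atTop_of_one_lt hr1
  have hTk1 : Tendsto (fun k : ℕ => r^(k+1)) atTop atTop := hTk.comp (tendsto_add_atTop_nat 1)
  have hTkr : Tendsto (fun k : ℕ => ((r^(k+1) : ℕ) : ℝ)) atTop atTop :=
    tendsto_natCast_atTop_atTop.comp hTk1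
  have hTkr0 : Tendsto (fun k : ℕ => ((r^k : ℕ) : ℝ)) atTop atTop :=
    tendsto_natCast_atTop_atTop.comp hTk
  set w : ℕ → ℝ := fun k => s * M k with hw
  have hw0 : ∀ k, 0 < w k := fun k => mul_pos hs (hM0 k)
  set L : ℕ → ℝ := fun k => (1-4*δ) * LL ((r^(k+1) : ℕ) : ℝ) with hL
  set u : ℕ → ℝ := fun k => (1+δ/8) * w k with hu
  have hu0 : ∀ k, 0 ≤ u k := fun k => by have := hw0 k; positivity
  set Z' : ℕ → ℕ → α → ℝ := fun k => blk v (r^k) (M k) (u k) Z with hZ'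
  set v' : ℕ → ℕ → α → ℝ := fun k => blk v (r^k) (M k) (u k) v with hv'
  set A : ℕ → Set α := fun k => {x | (1-δ) * Real.sqrt (2*L k*w k) ≤ psum (Z' k) (M k) x}
        ∪ {x | psum (v' k) (M k) x < (1 - δ/8) * w k} with hA
  let 𝒢 : Filtration ℕ m0 :=
    { seq := fun k => ℱ (r^k)
      mono' := fun i j hij => ℱ.mono (Nat.pow_le_pow_right (by omega) hij)
      le' := fun k => ℱ.le _ }
  have hbmd : ∀ k, BMD ℙ (shiftFil ℱ (r^k)) (Z' k) (v' k) (b (r^(k+1))) := by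
    intro k
    have := h.blkBMD hb hb0 (r^k) (M k) (u k)
    rwa [hMn k] at this
  have hAm : ∀ k, MeasurableSet[𝒢 (k+1)] (A k) := by
    intro k
    have e : shiftFil ℱ (r^k) (M k) = 𝒢 (k+1) := by
      change ℱ (r^k + M k) = ℱ (r^(k+1))
      rw [hMn]
    rw [← e]
    exact (measurableSet_le measurable_const ((hbmd k).mS (M k))).union
      (measurableSet_lt ((hbmd k).mV' (M k)) measurable_const)
  set c0 : ℝ := 1/4 * Real.exp (-(Real.log 4/δ)) / Real.log r with hc0
  have hlr : 0 < Real.log r := Real.log_pos (by exact_mod_cast hr1)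
  have hc00 : 0 < c0 := by positivity
  have hev : ∀ᶠ k in atTop, ∀ B, MeasurableSet[𝒢 k] B →
      (c0 * (1/((k:ℝ)+1))) * ℙ.real B ≤ ℙ.real (B ∩ A k) := by
    have h1 : Tendsto (fun k : ℕ => Real.sqrt (4/s) *
        (b (r^(k+1)) * Real.sqrt (LL ((r^(k+1) : ℕ) : ℝ) / ((r^(k+1) : ℕ) : ℝ)))) atTop (𝓝 0) := by
      simpa using (hbl.comp hTk1).const_mul (Real.sqrt (4/s))
    filter_upwards [h1.eventually (eventually_le_nhds (show (0:ℝ) < δ^2/16 by positivity)),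
      hTkr.eventually_ge_atTop 3,
      (tendsto_LL.comp hTkr).eventually_ge_atTop (4 * Real.log 2/δ^2)] with k hk1 hk2 hk3 B hB
    have hLL := LL_nonneg hk2
    simp only [Function.comp] at hk3
    rw [div_le_iff₀ (by positivity)] at hk3
    have hc := (hbmd k).lower' (δ := δ) (w := w k) (L := L k) hδ0 (by linarith) (hw0 k)
      (by
        simp only [hL]
        nlinarith [mul_nonneg hLL (sq_nonneg δ)]) (hb0 _)
      (by
        refine le_trans ?_ hk1
        rw [mul_comm (b (r^(k+1))), ← mul_assoc (Real.sqrt (4/s))]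
        refine mul_le_mul_of_nonneg_right ?_ (hb0 _)
        rw [← Real.sqrt_mul (by positivity)]
        apply Real.sqrt_le_sqrt
        have e1 : ((r^(k+1) : ℕ) : ℝ) ≤ 2 * M k := by
          rw [hMc]; push_cast; rw [pow_succ]
          nlinarith [show (0:ℝ) < (r:ℝ)^k by positivity]
        have hp : (0:ℝ) < ((r^(k+1) : ℕ) : ℝ) := by linarith
        have hMk := hM0 k
        simp only [hw, hL]
        rw [div_mul_div_comm, div_le_div_iff₀ (mul_pos hs hMk) (mul_pos hs hp)]
        have e2 : (1-4*δ) * LL ((r^(k+1) : ℕ) : ℝ) ≤ LL ((r^(k+1) : ℕ) : ℝ) := by nlinarith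
        calc 2 * ((1-4*δ) * LL ((r^(k+1) : ℕ) : ℝ)) * (s * ((r^(k+1) : ℕ) : ℝ))
            ≤ 2 * LL ((r^(k+1) : ℕ) : ℝ) * (s * (2 * M k)) := by gcongr
          _ = _ := by ring)
      (M k) (fun x => blk_bound _ _ (hu0 k) h.v0 _ x) (B := B) hB
    refine le_trans ?_ hc
    refine mul_le_mul_of_nonneg_right ?_ measureReal_nonneg
    have e3 : Real.exp (-LL ((r^(k+1) : ℕ) : ℝ)) = 1/(Real.log r * ((k:ℝ)+1)) := by
      rw [LL, Real.exp_neg, Real.exp_log]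
      · push_cast
        rw [Real.log_pow]; push_cast; rw [one_div, mul_comm]
      · have := one_le_log hk2; linarith
    have e4 : Real.exp (-LL ((r^(k+1) : ℕ) : ℝ)) ≤ Real.exp (-((1+3*δ)*L k)) := by
      apply Real.exp_le_exp.2
      simp only [hL]
      have : (1+3*δ)*(1-4*δ) ≤ 1 := by nlinarith
      nlinarith [mul_le_mul_of_nonneg_right this hLL]
    calc c0 * (1/((k:ℝ)+1)) = 1/4 * Real.exp (-(Real.log 4/δ)) * (1/(Real.log r * ((k:ℝ)+1))) := by
          rw [hc0]; field_simp
      _ ≤ _ := by rw [← e3]; gcongr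
  obtain ⟨k0, hk0⟩ := eventually_atTop.1 hev
  have hBC : ∀ᵐ x ∂ℙ, ∃ᶠ k in atTop, x ∈ A k := by
    refine cond_BC (𝒢 := 𝒢) hAm (p := fun k => c0 * (1/((k:ℝ)+1))) (k0 := k0) (fun k hk B hB => hk0 k hk B hB) ?_
    simp_rw [← Finset.mul_sum]
    exact Real.tendsto_sum_range_one_div_nat_succ_atTop.const_mul_atTop hc00
  have hup := h.neg.lil_upper hb hb0 hbl hs hV (ε := 1/2) (by norm_num) le_rfl
  filter_upwards [hBC, hup, hV] with x hx1 hx2 hx3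
  have hblk : Tendsto (fun k => (psum v (r^(k+1)) x - psum v (r^k) x) / M k) atTop (𝓝 s) := by
    have a1 := (hx3.comp hTk1).mul_const ((r:ℝ)/(r-1))
    have a2 := (hx3.comp hTk).mul_const (1/((r:ℝ)-1))
    have a3 := a1.sub a2
    have hr1' : (r:ℝ) - 1 ≠ 0 := by linarith
    have : s * ((r:ℝ)/(r-1)) - s * (1/((r:ℝ)-1)) = s := by field_simp
    rw [this] at a3
    refine a3.congr fun k => ?_
    simp only [Function.comp]
    have e0 : ((r^(k+1) : ℕ) : ℝ) = (r:ℝ)^k * r := by push_cast; rw [pow_succ]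
    rw [hMc, e0]; push_cast
    field_simp
  have e1 : ∀ᶠ k in atTop, (psum v (r^(k+1)) x - psum v (r^k) x) / M k ≤ (1+δ/8)*s :=
    hblk.eventually (eventually_le_nhds (by nlinarith))
  have e2 : ∀ᶠ k in atTop, (1-δ/8)*s ≤ (psum v (r^(k+1)) x - psum v (r^k) x) / M k :=
    hblk.eventually (eventually_ge_nhds (by nlinarith))
  have hfr : ∃ᶠ k in atTop, (1-ε) * phi s ((r^(k+1) : ℕ) : ℝ) ≤ psum Z (r^(k+1)) x := by
    refine (hx1.and_eventually (e1.and (e2.and ((hTk.eventually hx2).and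
      (hTkr0.eventually_ge_atTop 3))))).mono ?_
    rintro k ⟨hxA, h1, h2, h3, h4⟩
    rw [div_le_iff₀ (hM0 k)] at h1
    rw [le_div_iff₀ (hM0 k)] at h2
    have hux : psum v (r^k + M k) x - psum v (r^k) x ≤ u k := by
      rw [hMn]; refine h1.trans (le_of_eq ?_); simp only [hu, hw]; ring
    have eV := blk_eq (r^k) (M k) h.v0 hux v
    have eZ := blk_eq (r^k) (M k) h.v0 hux Z
    rw [hMn] at eV eZ
    rcases hxA with hxA | hxA
    · change (1-δ) * Real.sqrt (2*L k*w k) ≤ psum (blk v (r^k) (M k) (u k) Z) (M k) x at hxA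
      rw [eZ] at hxA
      have h5 : - psum Z (r^k) x ≤ (1+1/2) * phi s ((r^k : ℕ) : ℝ) := by
        refine le_trans (le_of_eq ?_) h3
        simp [psum]
      have hnn : ((r^k : ℕ) : ℝ) ≤ ((r^(k+1) : ℕ) : ℝ) := by exact_mod_cast hle k
      have hp0 : (0:ℝ) < ((r^k : ℕ) : ℝ) := by linarith
      have hLL0 := LL_nonneg h4
      have hLL := LL_mono h4 hnn
      set φ := phi s ((r^(k+1) : ℕ) : ℝ) with hφ
      have hφ0 : 0 ≤ φ := phi_nonneg _ _
      have h6 : phi s ((r^k : ℕ) : ℝ) ≤ 1/m * φ := by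
        rw [hφ, phi, phi]
        apply Real.sqrt_le_iff.2
        refine ⟨by positivity, ?_⟩
        rw [mul_pow, Real.sq_sqrt (mul_nonneg (by positivity) (hLL0.trans hLL))]
        have : (1/(m:ℝ))^2 * (2 * s * ((r^(k+1) : ℕ) : ℝ) * LL ((r^(k+1) : ℕ) : ℝ)) =
            2 * s * ((r^k : ℕ) : ℝ) * LL ((r^(k+1) : ℕ) : ℝ) := by
          have : ((r^(k+1) : ℕ) : ℝ) = ((r^k : ℕ) : ℝ) * m^2 := by
            push_cast; rw [pow_succ, hrm]
          conv_lhs => rw [show 2 * s * ((r^(k+1) : ℕ) : ℝ) * LL ((r^(k+1) : ℕ) : ℝ) =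
            2 * s * (((r^k : ℕ) : ℝ) * m^2) * LL ((r^(k+1) : ℕ) : ℝ) by rw [← this]]
          field_simp
        rw [this]
        gcongr
      have h7 : ((1-4*δ)*(1-1/r)) * φ ≤ Real.sqrt (2*L k*w k) := by
        have hrr : 1/(r:ℝ) ≤ 1 := by rw [div_le_one hr0]; linarith
        have hrr0 : 0 ≤ 1/(r:ℝ) := by positivity
        have : 2*L k*w k = ((1-4*δ)*(1-1/r)) * (2 * s * ((r^(k+1) : ℕ) : ℝ) * LL ((r^(k+1) : ℕ) : ℝ)) := by
          simp only [hL, hw]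
          rw [hMc]
          have : ((r^(k+1) : ℕ) : ℝ) * (1-1/r) = (r:ℝ)^k * (r-1) := by
            push_cast; rw [pow_succ]; field_simp
          rw [← this]; ring
        rw [this, hφ, phi]
        refine sqrt_ge_self_mul (mul_nonneg (by linarith) (by linarith)) ?_
        exact mul_le_one₀ (by linarith) (by linarith) (by linarith)
      have h8 : 1/(r:ℝ) ≤ 1/m := by
        rw [hrm]
        apply one_div_le_one_div_of_le hm0
        nlinarith
      have h9 : 1/(m:ℝ) ≤ ε/4 := by
        rw [div_le_div_iff₀ hm0 (by norm_num)]; linarith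
      have h10 : 1 - ε ≤ (1-δ)*((1-4*δ)*(1-1/r)) - 3/2*(1/m) := by
        have q0 : 0 ≤ 1/(r:ℝ) := by positivity
        have q1 : (1-δ)*((1-4*δ)*(1-1/r)) ≥ 1 - 5*δ - 1/r := by
          have : (1-δ)*(1-4*δ) ≤ 1 := by nlinarith
          have h11 : (1-δ)*(1-4*δ) ≥ 1 - 5*δ := by nlinarith
          nlinarith [mul_le_mul_of_nonneg_right this q0]
        rw [hδ] at q1 ⊢
        linarith
      have h12 := mul_le_mul_of_nonneg_right h10 hφ0
      have h13 := mul_le_mul_of_nonneg_left h7 (show 0 ≤ 1-δ by linarith)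
      linarith
    · exfalso
      change psum (blk v (r^k) (M k) (u k) v) (M k) x < (1-δ/8) * w k at hxA
      rw [eV] at hxA
      simp only [hw] at hxA
      linarith
  exact hTk1.frequently hfr
end

/-- Kronecker's lemma for nonnegative series. -/
lemma kronecker_nonneg {c w : ℕ → ℝ} (hc : ∀ j, 0 ≤ c j) (hw : ∀ j, 0 < w j) (hm : Monotone w)
    (hw2 : Tendsto w atTop atTop) (hs : Summable (fun j => c j / w j)) :
    Tendsto (fun n => (∑ j ∈ Finset.range n, c j) / w n) atTop (𝓝 0) := by
  have h := tendsto_tsum_of_dominated_convergence (𝓕 := atTop)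
    (f := fun n j => if j < n then c j / w n else 0) (g := fun _ => (0:ℝ)) hs ?_ ?_
  · rw [tsum_zero] at h
    refine h.congr fun n => ?_
    rw [tsum_eq_sum (s := Finset.range n), Finset.sum_div]
    · refine Finset.sum_congr rfl fun j hj => ?_
      rw [if_pos (Finset.mem_range.1 hj)]
    · intro j hj
      rw [if_neg]; simpa using hj
  · intro k
    have h1 : Tendsto (fun n => c k / w n) atTop (𝓝 0) := hw2.const_div_atTop _
    refine squeeze_zero (fun n => ?_) (fun n => ?_) h1
    · split_ifs
      · exact div_nonneg (hc _) (hw _).le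
      · exact le_rfl
    · split_ifs
      · exact le_rfl
      · exact div_nonneg (hc _) (hw _).le
  · refine Eventually.of_forall fun n k => ?_
    have := hc k
    have := hw k
    have := hw n
    split_ifs with hk
    · rw [Real.norm_of_nonneg (by positivity)]
      exact div_le_div_of_nonneg_left (hc k) (hw k) (hm hk.le)
    · rw [norm_zero]; positivity

/-- Kronecker's lemma with weights `n+1`. -/
lemma kronecker_signed {y : ℕ → ℝ} {l : ℝ}
    (h : Tendsto (fun n => ∑ j ∈ Finset.range n, y j / ((j:ℝ)+1)) atTop (𝓝 l)) :
    Tendsto (fun n : ℕ => (∑ j ∈ Finset.range n, y j) / n) atTop (𝓝 0) := by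
  set S : ℕ → ℝ := fun n => ∑ j ∈ Finset.range n, y j / ((j:ℝ)+1) with hS
  have e : ∀ n, ∑ j ∈ Finset.range n, y j = n * S n - ∑ j ∈ Finset.range n, S j := by
    intro n
    induction n with
    | zero => simp
    | succ n ih =>
      have : S (n+1) = S n + y n / ((n:ℝ)+1) := by simp [hS, Finset.sum_range_succ]
      rw [Finset.sum_range_succ, ih, Finset.sum_range_succ, this]
      push_cast
      field_simp
      ring
  have h2 := h.sub h.cesaro
  rw [sub_self] at h2
  refine h2.congr' ?_
  filter_upwards [eventually_ge_atTop 1] with n hn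
  have : (0:ℝ) < n := by exact_mod_cast hn
  rw [e]
  field_simp

section
variable {α : Type*} {m0 : MeasurableSpace α} {ℙ : Measure α} [IsProbabilityMeasure ℙ]

/-- A nonnegative series with summable expectations converges a.s. -/
lemma ae_summable {f : ℕ → α → ℝ} {e : ℕ → ℝ} (hf : ∀ j, Integrable (f j) ℙ)
    (h0 : ∀ j x, 0 ≤ f j x) (he : ∀ j, ∫ x, f j x ∂ℙ ≤ e j) (hs : Summable e) :
    ∀ᵐ x ∂ℙ, Summable (fun j => f j x) := by
  have h1 : ∫⁻ x, ∑' j, ENNReal.ofReal (f j x) ∂ℙ ≠ ∞ := by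
    rw [lintegral_tsum (fun j => (hf j).aemeasurable.ennreal_ofReal)]
    refine ne_top_of_le_ne_top (hs.tsum_ofReal_ne_top) (ENNReal.tsum_le_tsum fun j => ?_)
    rw [← ofReal_integral_eq_lintegral_ofReal (hf j) (Eventually.of_forall (h0 j))]
    exact ENNReal.ofReal_le_ofReal (he j)
  have h2 := ae_lt_top' (AEMeasurable.tsum fun j => (hf j).aemeasurable.ennreal_ofReal) h1
  filter_upwards [h2] with x hx
  have := ENNReal.summable_toReal hx.ne
  refine this.congr fun j => ?_
  rw [ENNReal.toReal_ofReal (h0 j x)]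

/-- Clipping. -/
def clip (t y : ℝ) : ℝ := max (-t) (min t y)

lemma clip_abs {t : ℝ} (ht : 0 ≤ t) (y : ℝ) : |clip t y| ≤ t := by
  unfold clip
  rw [abs_le]
  exact ⟨le_max_left _ _, max_le (by linarith) (min_le_left _ _)⟩

lemma clip_eq {t y : ℝ} (h : |y| ≤ t) : clip t y = y := by
  unfold clip
  rw [abs_le] at h
  rw [min_eq_right h.2, max_eq_right h.1]

lemma measurable_clip (t : ℝ) : Measurable (clip t) := by
  unfold clip; fun_prop

/-- test-function form of conditional expectation. -/
lemma integral_mul_condExp' {m : MeasurableSpace α} (hm : m ≤ m0) {f Y : α → ℝ}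
    (hf : Integrable f ℙ) (hY : Measurable[m] Y) (hb : ∃ C, ∀ x, |Y x| ≤ C) :
    ∫ x, Y x * f x ∂ℙ = ∫ x, Y x * (ℙ[f|m]) x ∂ℙ := by
  obtain ⟨C, hC⟩ := hb
  have h1 := condExp_stronglyMeasurable_mul_of_bound hm (f := Y) (g := f) (μ := ℙ)
    hY.stronglyMeasurable hf C (Eventually.of_forall hC)
  have h2 := integral_condExp (μ := ℙ) (m := m) (m₀ := m0) (f := Y * f) hm
  change _ = ∫ x, (Y * ℙ[f|m]) x ∂ℙ
  rw [← integral_congr_ae h1, h2]; rfl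

/-- Truncation. -/
def trU (t : ℝ) (Y : α → ℝ) (x : α) : ℝ := if |Y x| ≤ t then Y x else 0

/-- Compensator of the truncation. -/
def trm (ℙ : Measure α) (m : MeasurableSpace α) (t : ℝ) (Y : α → ℝ) (x : α) : ℝ :=
  clip t ((ℙ[trU t Y|m]) x)

lemma trU_abs {t : ℝ} (ht : 0 ≤ t) (Y : α → ℝ) (x : α) : |trU t Y x| ≤ t := by
  unfold trU; split_ifs with h
  · exact h
  · simpa using ht

lemma trU_meas {m : MeasurableSpace α} {Y : α → ℝ} (t : ℝ) (hY : Measurable[m] Y) :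
    Measurable[m] (trU t Y) :=
  Measurable.ite (measurableSet_le (hY.abs) measurable_const) hY measurable_const

lemma trm_meas {m : MeasurableSpace α} {Y : α → ℝ} (t : ℝ) :
    Measurable[m] (trm ℙ m t Y) :=
  (measurable_clip t).comp stronglyMeasurable_condExp.measurable

lemma trm_ae {m : MeasurableSpace α} {t : ℝ} (ht : 0 ≤ t) (Y : α → ℝ) :
    trm ℙ m t Y =ᵐ[ℙ] ℙ[trU t Y|m] := by
  have := ae_bdd_abs_condExp_of_ae_bdd_abs (m := m) (μ := ℙ) (R := t) (f := trU t Y)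
    (Eventually.of_forall (trU_abs ht Y))
  filter_upwards [this] with x hx
  exact clip_eq hx

lemma trU_sub {t p : ℝ} (ht : 0 < t) (hp : 1 ≤ p) (Y : α → ℝ) (x : α) :
    |trU t Y x - Y x| ≤ |Y x|^p * t^(1-p) := by
  unfold trU; split_ifs with h
  · simp; positivity
  · push Not at h
    rw [zero_sub, abs_neg]
    have h0 : 0 < |Y x| := ht.trans h
    have h1 : |Y x|^(1-p) ≤ t^(1-p) := Real.rpow_le_rpow_of_nonpos ht h.le (by linarith)
    calc |Y x| = |Y x|^p * |Y x|^(1-p) := by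
          rw [← Real.rpow_add h0]; simp
      _ ≤ _ := by gcongr

lemma trm_int {m : MeasurableSpace α} {t p C : ℝ} (ht : 0 < t) (hp : 1 ≤ p)
    {Y : α → ℝ} (hYm : Measurable[m0] Y) (hY : Integrable Y ℙ) (hYp : Integrable (fun x => |Y x|^p) ℙ)
    (hC : ∫ x, |Y x|^p ∂ℙ ≤ C) (h0 : ℙ[Y|m] =ᵐ[ℙ] 0) :
    ∫ x, |trm ℙ m t Y x| ∂ℙ ≤ C * t^(1-p) := by
  have hU : Integrable (trU t Y) ℙ := integrable_of_bdd (trU_meas t hYm) ⟨t, trU_abs ht.le Y⟩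
  have h1 : trm ℙ m t Y =ᵐ[ℙ] ℙ[trU t Y - Y|m] := by
    filter_upwards [trm_ae (ℙ := ℙ) (m := m) ht.le Y, condExp_sub hU hY m, h0] with x h1 h2 h3
    rw [h1, h2, Pi.sub_apply, h3]; simp
  calc ∫ x, |trm ℙ m t Y x| ∂ℙ = ∫ x, |(ℙ[trU t Y - Y|m]) x| ∂ℙ :=
        integral_congr_ae (h1.mono fun x hx => by simp only [hx])
    _ ≤ ∫ x, |(trU t Y - Y) x| ∂ℙ := integral_abs_condExp_le _
    _ ≤ ∫ x, |Y x|^p * t^(1-p) ∂ℙ := by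
        refine integral_mono (hU.sub hY).abs (hYp.mul_const _) fun x => ?_
        exact trU_sub ht hp Y x
    _ ≤ _ := by
        rw [integral_mul_const]
        exact mul_le_mul_of_nonneg_right hC (by positivity)

lemma tr_prob {t p C : ℝ} (ht : 0 < t) (hp : 0 < p)
    {Y : α → ℝ} (hYp : Integrable (fun x => |Y x|^p) ℙ)
    (hC : ∫ x, |Y x|^p ∂ℙ ≤ C) :
    ℙ.real {x | t < |Y x|} ≤ C * t^(-p) := by
  have h1 := mul_meas_ge_le_integral_of_nonneg (μ := ℙ) (f := fun x => |Y x|^p)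
    (Eventually.of_forall fun x => by positivity) hYp (t^p)
  have h2 : ℙ.real {x | t < |Y x|} ≤ ℙ.real {x | t^p ≤ |Y x|^p} := by
    refine measureReal_mono (fun x hx => ?_) (measure_ne_top _ _)
    exact Real.rpow_le_rpow ht.le (le_of_lt hx) hp.le
  rw [Real.rpow_neg ht.le, ← div_eq_mul_inv, le_div_iff₀ (by positivity)]
  have : 0 < t^p := by positivity
  nlinarith

lemma tr_eventually {Y : ℕ → α → ℝ} {t : ℕ → ℝ} {p C : ℝ} (ht : ∀ j, 0 < t j) (hp : 0 < p)
    (hYp : ∀ j, Integrable (fun x => |Y j x|^p) ℙ) (hC : ∀ j, ∫ x, |Y j x|^p ∂ℙ ≤ C)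
    (hs : Summable (fun j => (t j)^(-p))) :
    ∀ᵐ x ∂ℙ, ∀ᶠ j in atTop, trU (t j) (Y j) x = Y j x := by
  have h1 : ∀ᵐ x ∂ℙ, ∀ᶠ j in atTop, x ∉ {x | t j < |Y j x|} := by
    apply ae_eventually_notMem
    have : ∀ k, ℙ {x | t k < |Y k x|} = ENNReal.ofReal (ℙ.real {x | t k < |Y k x|}) := fun k =>
      (ofReal_measureReal (measure_ne_top _ _)).symm
    simp_rw [this]
    refine Summable.tsum_ofReal_ne_top ?_
    refine (hs.mul_left C).of_nonneg_of_le (fun _ => measureReal_nonneg) fun j => ?_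
    exact tr_prob (ht j) hp (hYp j) (hC j)
  filter_upwards [h1] with x hx
  filter_upwards [hx] with j hj
  simp only [not_lt] at hj
  unfold trU; rw [if_pos hj]

/-- eventually equal sequences have sums differing by a bounded amount -/
lemma sum_ev_eq {u w : ℕ → ℝ} (h : ∀ᶠ j in atTop, u j = w j) :
    ∃ c, ∀ᶠ n in atTop, ∑ j ∈ Finset.range n, u j = ∑ j ∈ Finset.range n, w j + c := by
  obtain ⟨N, hN⟩ := eventually_atTop.1 h
  refine ⟨∑ j ∈ Finset.range N, u j - ∑ j ∈ Finset.range N, w j, ?_⟩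
  filter_upwards [eventually_ge_atTop N] with n hn
  induction n, hn using Nat.le_induction with
  | base => ring
  | succ n hn ih => rw [Finset.sum_range_succ, Finset.sum_range_succ, ih, hN n hn]; ring
end

section
variable {α : Type*} {m0 : MeasurableSpace α} {ℙ : Measure α} [IsProbabilityMeasure ℙ]

lemma integrable_of_rpow {Y : α → ℝ} {p : ℝ} (hp : 1 ≤ p) (hYm : Measurable Y)
    (hYp : Integrable (fun x => |Y x|^p) ℙ) : Integrable Y ℙ := by
  refine ((integrable_const (1:ℝ)).add hYp).mono' hYm.aestronglyMeasurable
    (Eventually.of_forall fun x => ?_)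
  simp only [Pi.add_apply, Real.norm_eq_abs]
  rcases le_total |Y x| 1 with h | h
  · have : 0 ≤ |Y x|^p := by positivity
    linarith
  · have := Real.rpow_le_rpow_of_exponent_le h hp
    rw [Real.rpow_one] at this; linarith

lemma int3 {f g h : α → ℝ} (hf : Integrable f ℙ) (hg : Integrable g ℙ) (hh : Integrable h ℙ)
    (a b c : ℝ) : ∫ x, (a * f x + b * g x + c * h x) ∂ℙ =
      a * ∫ x, f x ∂ℙ + b * ∫ x, g x ∂ℙ + c * ∫ x, h x ∂ℙ := by
  have h1 : Integrable (fun x => a * f x + b * g x) ℙ := (hf.const_mul a).add (hg.const_mul b)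
  rw [integral_add h1 (hh.const_mul c), integral_add (hf.const_mul a) (hg.const_mul b),
    integral_const_mul, integral_const_mul, integral_const_mul]

/-- The centred truncation. -/
def trD (ℙ : Measure α) (m : MeasurableSpace α) (t : ℝ) (Y : α → ℝ) (x : α) : ℝ :=
  trU t Y x - trm ℙ m t Y x

lemma trD_abs {m : MeasurableSpace α} {t : ℝ} (ht : 0 ≤ t) (Y : α → ℝ) (x : α) :
    |trD ℙ m t Y x| ≤ 2 * t := by
  have h1 := trU_abs ht Y x
  have h2 : |trm ℙ m t Y x| ≤ t := clip_abs ht _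
  unfold trD
  calc _ ≤ |trU t Y x| + |trm ℙ m t Y x| := abs_sub _ _
    _ ≤ _ := by linarith

lemma trD_test {m : MeasurableSpace α} (hm : m ≤ m0) {t : ℝ} (ht : 0 ≤ t) {Y : α → ℝ}
    (hYm : Measurable[m0] Y) {W : α → ℝ} (hW : Measurable[m] W) (hb : ∃ C, ∀ x, |W x| ≤ C) :
    ∫ x, W x * trD ℙ m t Y x ∂ℙ = 0 := by
  have hU : Integrable (trU t Y) ℙ := integrable_of_bdd (trU_meas t hYm) ⟨t, trU_abs ht Y⟩
  have hW' : Measurable[m0] W := hW.mono hm le_rfl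
  have hM : Measurable[m0] (trm ℙ m t Y) := (trm_meas t).mono hm le_rfl
  obtain ⟨C, hC⟩ := hb
  have hC0 : ∀ x, 0 ≤ C := fun x => (abs_nonneg _).trans (hC x)
  have i1 : Integrable (fun x => W x * trU t Y x) ℙ := by
    refine hU.bdd_mul hW'.aestronglyMeasurable (Eventually.of_forall hC)
  have i2 : Integrable (fun x => W x * trm ℙ m t Y x) ℙ := by
    refine Integrable.bdd_mul (integrable_of_bdd hM ⟨t, fun x => clip_abs ht _⟩)
      hW'.aestronglyMeasurable (Eventually.of_forall hC)
  unfold trD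
  simp_rw [mul_sub]
  rw [integral_sub i1 i2, integral_mul_condExp' hm hU hW ⟨C, hC⟩, sub_eq_zero]
  refine integral_congr_ae ?_
  filter_upwards [trm_ae (ℙ := ℙ) (m := m) ht Y] with x hx
  rw [hx]

lemma trD_meas {m m1 : MeasurableSpace α} (hm : m ≤ m1) (t : ℝ) {Y : α → ℝ}
    (hYm : Measurable[m1] Y) : Measurable[m1] (trD ℙ m t Y) :=
  (trU_meas t hYm).sub ((trm_meas t).mono hm le_rfl)

lemma trD_condExp {m : MeasurableSpace α} (hm : m ≤ m0) {t : ℝ} (ht : 0 ≤ t) {Y : α → ℝ}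
    (hYm : Measurable[m0] Y) : ℙ[trD ℙ m t Y|m] =ᵐ[ℙ] 0 := by
  have hU : Integrable (trU t Y) ℙ := integrable_of_bdd (trU_meas t hYm) ⟨t, trU_abs ht Y⟩
  have hM : Measurable[m0] (trm ℙ m t Y) := (trm_meas t).mono hm le_rfl
  have hMi : Integrable (trm ℙ m t Y) ℙ := integrable_of_bdd hM ⟨t, fun x => clip_abs ht _⟩
  have e := condExp_of_stronglyMeasurable hm (trm_meas (ℙ := ℙ) (m := m) (Y := Y) t).stronglyMeasurable hMi
  have h1 := condExp_sub hU hMi m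
  filter_upwards [h1, trm_ae (ℙ := ℙ) (m := m) ht Y] with x h2 h3
  change (ℙ[trU t Y - trm ℙ m t Y|m]) x = _
  rw [h2, Pi.sub_apply, e, ← h3]; simp

lemma trD_sq {m : MeasurableSpace α} (hm : m ≤ m0) {t p C : ℝ} (ht : 0 < t) (hp2 : p ≤ 2)
    (hp0 : 0 < p) {Y : α → ℝ} (hYm : Measurable[m0] Y)
    (hYp : Integrable (fun x => |Y x|^p) ℙ) (hC : ∫ x, |Y x|^p ∂ℙ ≤ C) :
    ∫ x, (trD ℙ m t Y x)^2 ∂ℙ ≤ C * t^(2-p) := by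
  have hUm := trU_meas t hYm
  have hM : Measurable[m0] (trm ℙ m t Y) := (trm_meas t).mono hm le_rfl
  have bM : ∃ C, ∀ x, |trm ℙ m t Y x| ≤ C := ⟨t, fun x => clip_abs ht.le _⟩
  have bU : ∃ C, ∀ x, |trU t Y x| ≤ C := ⟨t, trU_abs ht.le Y⟩
  have hD := trD_meas (ℙ := ℙ) hm t hYm
  have bD : ∃ C, ∀ x, |trD ℙ m t Y x| ≤ C := ⟨_, trD_abs ht.le Y⟩
  have h1 := trD_test (ℙ := ℙ) hm ht.le hYm (trm_meas (ℙ := ℙ) (m := m) (Y := Y) t) bM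
  have i1 : Integrable (fun x => trU t Y x * trU t Y x) ℙ :=
    integrable_of_bdd (hUm.mul hUm) (bdd_mul bU bU)
  have i2 : Integrable (fun x => trm ℙ m t Y x * trD ℙ m t Y x) ℙ :=
    integrable_of_bdd (hM.mul hD) (bdd_mul bM bD)
  have i3 : Integrable (fun x => trm ℙ m t Y x * trm ℙ m t Y x) ℙ :=
    integrable_of_bdd (hM.mul hM) (bdd_mul bM bM)
  have e : ∀ x, (trD ℙ m t Y x)^2 = 1 * (trU t Y x * trU t Y x) + (-2) * (trm ℙ m t Y x * trD ℙ m t Y x)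
      + (-1) * (trm ℙ m t Y x * trm ℙ m t Y x) := by
    intro x; unfold trD; ring
  simp_rw [e]
  rw [int3 i1 i2 i3, h1]
  have h3 : 0 ≤ ∫ x, trm ℙ m t Y x * trm ℙ m t Y x ∂ℙ := integral_nonneg fun x => mul_self_nonneg _
  have h4 : ∫ x, trU t Y x * trU t Y x ∂ℙ ≤ ∫ x, |Y x|^p * t^(2-p) ∂ℙ := by
    refine integral_mono i1 (hYp.mul_const _) fun x => ?_
    simp only
    unfold trU; split_ifs with h
    · rcases eq_or_ne (Y x) 0 with h0 | h0
      · rw [h0]; simp; positivity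
      · have h0' : 0 < |Y x| := abs_pos.2 h0
        calc Y x * Y x = |Y x|^(2:ℝ) := by rw [Real.rpow_two, sq_abs]; ring
          _ = |Y x|^p * |Y x|^(2-p) := by rw [← Real.rpow_add h0']; ring_nf
          _ ≤ _ := by
            gcongr
    · simp; positivity
  rw [integral_mul_const] at h4
  have := mul_le_mul_of_nonneg_right hC (show 0 ≤ t^(2-p) by positivity)
  linarith

lemma summable_succ_rpow {q : ℝ} (hq : q < -1) : Summable (fun j : ℕ => ((j:ℝ)+1)^q) := by
  have := (summable_nat_add_iff 1).2 (Real.summable_nat_rpow.2 hq)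
  simpa using this

lemma slln_mart {ℱ : Filtration ℕ m0} {Y : ℕ → α → ℝ} {p C : ℝ} (hp : 1 < p) (hp2 : p ≤ 2)
    (hYm : ∀ j, Measurable[ℱ (j+1)] (Y j)) (hYp : ∀ j, Integrable (fun x => |Y j x|^p) ℙ)
    (hC : ∀ j, ∫ x, |Y j x|^p ∂ℙ ≤ C) (h0 : ∀ j, ℙ[Y j|ℱ j] =ᵐ[ℙ] 0) :
    ∀ᵐ x ∂ℙ, Tendsto (fun n : ℕ => (∑ j ∈ Finset.range n, Y j x) / n) atTop (𝓝 0) := by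
  have hYm' : ∀ j, Measurable (Y j) := fun j => (hYm j).mono (ℱ.le _) le_rfl
  have hC0 : 0 ≤ C := (integral_nonneg fun x => by positivity).trans (hC 0)
  set t : ℕ → ℝ := fun j => (j:ℝ)+1 with ht
  have ht0 : ∀ j, 0 < t j := fun j => by simp only [ht]; positivity
  set D : ℕ → α → ℝ := fun j => trD ℙ (ℱ j) (t j) (Y j) with hD
  have hDm : ∀ j, Measurable[ℱ (j+1)] (D j) := fun j =>
    trD_meas (ℱ.mono (Nat.le_succ j)) _ (hYm j)
  have hDb : ∀ j x, |D j x| ≤ 2 * t j := fun j => trD_abs (ht0 j).le _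
  set M : ℕ → α → ℝ := fun n x => ∑ j ∈ Finset.range n, D j x / t j with hM
  have hMs : ∀ n x, M (n+1) x = M n x + D n x / t n := fun n x => Finset.sum_range_succ _ _
  have hMm : ∀ n, Measurable[ℱ n] (M n) := fun n =>
    Finset.measurable_sum _ fun j hj =>
      ((hDm j).mono (ℱ.mono (by have := Finset.mem_range.1 hj; omega)) le_rfl).div_const _
  have hMb : ∀ n, ∃ c, ∀ x, |M n x| ≤ c := by
    intro n
    refine ⟨∑ j ∈ Finset.range n, 2, fun x => (Finset.abs_sum_le_sum_abs _ _).trans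
      (Finset.sum_le_sum fun j _ => ?_)⟩
    rw [abs_div, abs_of_pos (ht0 j), div_le_iff₀ (ht0 j)]
    exact hDb j x
  have hMi : ∀ n, Integrable (M n) ℙ := fun n =>
    integrable_of_bdd ((hMm n).mono (ℱ.le _) le_rfl) (hMb n)
  have hmart : Martingale M ℱ ℙ := by
    refine martingale_of_condExp_sub_eq_zero_nat (fun n => (hMm n).stronglyMeasurable) hMi fun n => ?_
    have e : M (n+1) - M n = (1/t n) • D n := by
      ext x; simp [hMs]; ring
    rw [e]
    have h1 := condExp_smul (μ := ℙ) (1/t n) (D n) (ℱ n)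
    have h2 := trD_condExp (ℙ := ℙ) (ℱ.le n) (ht0 n).le (hYm' n)
    filter_upwards [h1, h2] with x h3 h4
    rw [h3, Pi.smul_apply]
    change _ • (ℙ[trD ℙ (ℱ n) (t n) (Y n)|ℱ n]) x = 0
    rw [h4]; simp
  have hs : Summable (fun j : ℕ => ((j:ℝ)+1)^(-p)) := summable_succ_rpow (by linarith)
  have hM2 : ∀ n, ∫ x, M n x ^ 2 ∂ℙ ≤ ∑ j ∈ Finset.range n, C * ((j:ℝ)+1)^(-p) := by
    intro n
    induction n with
    | zero => simp [hM]
    | succ n ih =>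
      have hDm0 : Measurable (D n) := (hDm n).mono (ℱ.le _) le_rfl
      have hMm0 : Measurable (M n) := (hMm n).mono (ℱ.le _) le_rfl
      have bD : ∃ c, ∀ x, |D n x| ≤ c := ⟨_, hDb n⟩
      have i1 : Integrable (fun x => M n x ^ 2) ℙ := by
        simp_rw [pow_two]; exact integrable_of_bdd (hMm0.mul hMm0) (bdd_mul (hMb n) (hMb n))
      have i2 : Integrable (fun x => M n x * D n x) ℙ :=
        integrable_of_bdd (hMm0.mul hDm0) (bdd_mul (hMb n) bD)
      have i3 : Integrable (fun x => D n x ^ 2) ℙ := by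
        simp_rw [pow_two]; exact integrable_of_bdd (hDm0.mul hDm0) (bdd_mul bD bD)
      have e : ∀ x, M (n+1) x ^ 2 = 1 * M n x ^ 2 + (2/t n) * (M n x * D n x) + (1/t n^2) * D n x ^ 2 := by
        intro x; rw [hMs]; have := (ht0 n).ne'; field_simp; ring
      simp_rw [e]
      rw [int3 i1 i2 i3, Finset.sum_range_succ]
      have e1 : ∫ x, M n x * D n x ∂ℙ = 0 :=
        trD_test (ℱ.le n) (ht0 n).le (hYm' n) (hMm n) (hMb n)
      have e2 : ∫ x, D n x ^ 2 ∂ℙ ≤ C * t n^(2-p) :=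
        trD_sq (ℱ.le n) (ht0 n) hp2 (by linarith) (hYm' n) (hYp n) (hC n)
      have e3 : (1/t n^2) * (C * t n^(2-p)) = C * ((n:ℝ)+1)^(-p) := by
        have : t n^(2-p) = t n^2 * t n^(-p) := by
          rw [sub_eq_add_neg, Real.rpow_add (ht0 n), Real.rpow_two]
        rw [this]
        have := (ht0 n).ne'
        simp only [ht] at this ⊢
        field_simp
      have e4 := mul_le_mul_of_nonneg_left e2 (show 0 ≤ 1/t n^2 by positivity)
      rw [e1]; linarith
  have hM1 : ∀ n, eLpNorm (M n) 1 ℙ ≤ ((1 + ∑' j : ℕ, C * ((j:ℝ)+1)^(-p)).toNNReal : ℝ≥0) := by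
    intro n
    rw [eLpNorm_one_eq_lintegral_enorm, ← ofReal_integral_norm_eq_lintegral_enorm (hMi n)]
    refine ENNReal.ofReal_le_ofReal ?_
    have hMm0 : Measurable (M n) := (hMm n).mono (ℱ.le _) le_rfl
    have i1 : Integrable (fun x => M n x ^ 2) ℙ := by
        simp_rw [pow_two]; exact integrable_of_bdd (hMm0.mul hMm0) (bdd_mul (hMb n) (hMb n))
    calc ∫ x, ‖M n x‖ ∂ℙ ≤ ∫ x, (1 + M n x ^ 2) ∂ℙ := by
          refine integral_mono (hMi n).norm ((integrable_const _).add i1) fun x => ?_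
          simp only [Real.norm_eq_abs]
          nlinarith [sq_abs (M n x), sq_nonneg (|M n x| - 1)]
      _ = 1 + ∫ x, M n x ^ 2 ∂ℙ := by
          rw [integral_add (integrable_const _) i1]; simp
      _ ≤ _ := by
          gcongr
          refine (hM2 n).trans ((hs.mul_left C).sum_le_tsum _ fun j _ => ?_)
          positivity
  have hconv := Submartingale.ae_tendsto_limitProcess hmart.submartingale hM1
  have hev := tr_eventually (ℙ := ℙ) (Y := Y) (t := t) (p := p) (C := C) ht0 (by linarith) hYp hC hs
  have hms : ∀ᵐ x ∂ℙ, Summable (fun j => |trm ℙ (ℱ j) (t j) (Y j) x| / t j) := by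
    refine ae_summable (e := fun j => C * ((j:ℝ)+1)^(-p)) (fun j => ?_) (fun j x => ?_) (fun j => ?_)
      (hs.mul_left C)
    · refine Integrable.div_const (Integrable.abs ?_) _
      exact integrable_of_bdd ((trm_meas _).mono (ℱ.le j) le_rfl) ⟨t j, fun x => clip_abs (ht0 j).le _⟩
    · have := ht0 j
      positivity
    · rw [integral_div, div_le_iff₀ (ht0 j)]
      refine (trm_int (ht0 j) hp.le (hYm' j) (integrable_of_rpow hp.le (hYm' j) (hYp j))
        (hYp j) (hC j) (h0 j)).trans (le_of_eq ?_)
      rw [mul_assoc]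
      congr 1
      have : t j ^ (1-p) = t j * t j^(-p) := by
        rw [sub_eq_add_neg, Real.rpow_add (ht0 j), Real.rpow_one]
      rw [this, mul_comm]
  have hinv : Tendsto (fun n : ℕ => (n:ℝ)+1) atTop atTop :=
    tendsto_atTop_add_const_right _ _ tendsto_natCast_atTop_atTop
  filter_upwards [hconv, hev, hms] with x h1 h2 h3
  have k1 : Tendsto (fun n : ℕ => (∑ j ∈ Finset.range n, D j x) / n) atTop (𝓝 0) :=
    kronecker_signed (l := Filtration.limitProcess M ℱ ℙ x) h1
  have k2 := kronecker_nonneg (w := t) (fun j => abs_nonneg _) ht0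
    (fun i j hij => by simp only [ht]; gcongr) hinv h3
  have k3 : Tendsto (fun n : ℕ => (∑ j ∈ Finset.range n, trm ℙ (ℱ j) (t j) (Y j) x) / n) atTop (𝓝 0) := by
    have k4 := k2.const_mul 2
    rw [mul_zero] at k4
    refine squeeze_zero_norm' ?_ k4
    filter_upwards [eventually_ge_atTop 1] with n hn
    have hn' : (1:ℝ) ≤ n := by exact_mod_cast hn
    rw [norm_div, Real.norm_eq_abs, Real.norm_of_nonneg (by linarith : (0:ℝ) ≤ n)]
    have a1 := Finset.abs_sum_le_sum_abs (fun j => trm ℙ (ℱ j) (t j) (Y j) x) (Finset.range n)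
    have a2 : 0 ≤ ∑ j ∈ Finset.range n, |trm ℙ (ℱ j) (t j) (Y j) x| :=
      Finset.sum_nonneg fun _ _ => abs_nonneg _
    rw [← mul_div_assoc, div_le_div_iff₀ (by linarith) (ht0 n)]
    simp only [ht]
    nlinarith
  obtain ⟨c, hc⟩ := sum_ev_eq h2
  have k5 : Tendsto (fun n : ℕ => -c / (n:ℝ)) atTop (𝓝 0) :=
    tendsto_natCast_atTop_atTop.const_div_atTop _
  have k6 := (k1.add k3).add k5
  simp only [add_zero] at k6
  refine k6.congr' ?_
  filter_upwards [hc] with n hn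
  rw [← add_div, ← add_div]
  congr 1
  have : ∑ j ∈ Finset.range n, D j x + ∑ j ∈ Finset.range n, trm ℙ (ℱ j) (t j) (Y j) x
      = ∑ j ∈ Finset.range n, trU (t j) (Y j) x := by
    rw [← Finset.sum_add_distrib]
    refine Finset.sum_congr rfl fun j _ => ?_
    simp [hD, trD]
  linarith
end

section
variable {α : Type*} {m0 : MeasurableSpace α} {ℙ : Measure α} [IsProbabilityMeasure ℙ]

/-- clipped conditional variance of the truncated difference -/
def trv (ℙ : Measure α) (m : MeasurableSpace α) (t : ℝ) (Y : α → ℝ) (x : α) : ℝ :=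
  max 0 (clip ((2*t)^2) ((ℙ[fun y => trD ℙ m t Y y ^ 2|m]) x))

lemma trv_ae {m : MeasurableSpace α} {t : ℝ} (ht : 0 ≤ t) (Y : α → ℝ) :
    trv ℙ m t Y =ᵐ[ℙ] ℙ[fun y => trD ℙ m t Y y ^ 2|m] := by
  have h1 := ae_bdd_abs_condExp_of_ae_bdd_abs (m := m) (μ := ℙ) (R := (2*t)^2)
    (f := fun y => trD ℙ m t Y y ^ 2) (Eventually.of_forall fun x => by
      rw [abs_pow]; exact pow_le_pow_left₀ (abs_nonneg _) (trD_abs ht Y x) 2)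
  have h2 : 0 ≤ᵐ[ℙ] ℙ[fun y => trD ℙ m t Y y ^ 2|m] :=
    condExp_nonneg (Eventually.of_forall fun x => sq_nonneg _)
  filter_upwards [h1, h2] with x h3 h4
  unfold trv
  rw [clip_eq h3]
  exact max_eq_right h4

lemma sq_sub_sq_bound {m : MeasurableSpace α} {t ζ : ℝ} (ht : 0 < t) (hζ : 2 ≤ ζ) (Y : α → ℝ)
    (x : α) : |Y x ^ 2 - trD ℙ m t Y x ^ 2| ≤ |Y x|^ζ * t^(2-ζ) + 3 * t * |trm ℙ m t Y x| := by
  have hm : |trm ℙ m t Y x| ≤ t := clip_abs ht.le _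
  have hm0 := abs_nonneg (trm ℙ m t Y x)
  have hp : 0 ≤ |Y x|^ζ * t^(2-ζ) := by positivity
  have hm2 : trm ℙ m t Y x ^ 2 ≤ t * |trm ℙ m t Y x| := by
    rw [← sq_abs]; nlinarith
  unfold trD trU
  split_ifs with h
  · have e : Y x ^ 2 - (Y x - trm ℙ m t Y x)^2 = 2 * (Y x * trm ℙ m t Y x) - trm ℙ m t Y x ^ 2 := by ring
    rw [e]
    have h1 : |Y x * trm ℙ m t Y x| ≤ t * |trm ℙ m t Y x| := by
      rw [abs_mul]; gcongr
    have h2 := abs_sub (2 * (Y x * trm ℙ m t Y x)) (trm ℙ m t Y x ^ 2)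
    rw [abs_mul 2, abs_of_nonneg (sq_nonneg (trm ℙ m t Y x))] at h2
    rw [abs_of_pos (two_pos : (0:ℝ) < 2)] at h2
    linarith
  · push Not at h
    have h0 : 0 < |Y x| := ht.trans h
    have h1 : |Y x|^(2-ζ) ≤ t^(2-ζ) := Real.rpow_le_rpow_of_nonpos ht h.le (by linarith)
    have h3 : Y x ^ 2 ≤ |Y x|^ζ * t^(2-ζ) := by
      calc Y x ^ 2 = |Y x|^ζ * |Y x|^(2-ζ) := by
            rw [← Real.rpow_add h0, add_sub_cancel, Real.rpow_two, sq_abs]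
        _ ≤ _ := by gcongr
    rw [zero_sub, neg_sq]
    have h2 := abs_sub (Y x ^ 2) (trm ℙ m t Y x ^ 2)
    rw [abs_of_nonneg (sq_nonneg (trm ℙ m t Y x)), abs_of_nonneg (sq_nonneg (Y x))] at h2
    have : 0 ≤ t * |trm ℙ m t Y x| := by positivity
    linarith

lemma integrable_sq_of_rpow {Y : α → ℝ} {p : ℝ} (hp : 2 ≤ p) (hYm : Measurable Y)
    (hYp : Integrable (fun x => |Y x|^p) ℙ) : Integrable (fun x => Y x ^ 2) ℙ := by
  refine ((integrable_const (1:ℝ)).add hYp).mono' (hYm.pow_const 2).aestronglyMeasurable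
    (Eventually.of_forall fun x => ?_)
  simp only [Pi.add_apply, Real.norm_eq_abs, abs_pow]
  rcases le_total |Y x| 1 with h | h
  · have : 0 ≤ |Y x|^p := by positivity
    have := pow_le_one₀ (n := 2) (abs_nonneg _) h
    linarith
  · have := Real.rpow_le_rpow_of_exponent_le h hp
    rw [Real.rpow_two] at this; linarith

lemma trv_diff {m : MeasurableSpace α} (hm : m ≤ m0) {t ζ C : ℝ} (ht : 0 < t) (hζ : 2 ≤ ζ)
    {Y : α → ℝ} (hYm : Measurable[m0] Y) (hYp : Integrable (fun x => |Y x|^ζ) ℙ)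
    (hC : ∫ x, |Y x|^ζ ∂ℙ ≤ C) (h0 : ℙ[Y|m] =ᵐ[ℙ] 0) :
    ∫ x, |(ℙ[fun y => Y y ^ 2|m]) x - trv ℙ m t Y x| ∂ℙ ≤ 4 * C * t^(2-ζ) := by
  have hY := integrable_of_rpow (by linarith) hYm hYp
  have hY2 := integrable_sq_of_rpow hζ hYm hYp
  have hDm := trD_meas (ℙ := ℙ) hm t hYm
  have hD2 : Integrable (fun y => trD ℙ m t Y y ^ 2) ℙ := by
    have bD : ∃ c, ∀ x, |trD ℙ m t Y x| ≤ c := ⟨_, trD_abs ht.le Y⟩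
    simp_rw [pow_two]; exact integrable_of_bdd (hDm.mul hDm) (bdd_mul bD bD)
  have hmi : Integrable (fun x => |trm ℙ m t Y x|) ℙ :=
    (integrable_of_bdd ((trm_meas t).mono hm le_rfl) ⟨t, fun x => clip_abs ht.le _⟩).abs
  have h1 := condExp_sub hY2 hD2 m
  have h2 : (fun x => |(ℙ[fun y => Y y ^ 2|m]) x - trv ℙ m t Y x|) =ᵐ[ℙ]
      fun x => |(ℙ[(fun y => Y y ^ 2) - (fun y => trD ℙ m t Y y ^ 2)|m]) x| := by
    filter_upwards [h1, trv_ae (ℙ := ℙ) (m := m) ht.le Y] with x h3 h4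
    rw [h3, h4]; rfl
  rw [integral_congr_ae h2]
  refine (integral_abs_condExp_le _).trans ?_
  have i1 : Integrable (fun x => |Y x|^ζ * t^(2-ζ)) ℙ := hYp.mul_const _
  calc ∫ x, |((fun y => Y y ^ 2) - (fun y => trD ℙ m t Y y ^ 2)) x| ∂ℙ
      ≤ ∫ x, (|Y x|^ζ * t^(2-ζ) + 3 * t * |trm ℙ m t Y x|) ∂ℙ :=
        integral_mono (hY2.sub hD2).abs (i1.add (hmi.const_mul _))
          fun x => sq_sub_sq_bound ht hζ Y x
    _ = (∫ x, |Y x|^ζ ∂ℙ) * t^(2-ζ) + 3 * t * ∫ x, |trm ℙ m t Y x| ∂ℙ := by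
        rw [integral_add i1 (hmi.const_mul _), integral_mul_const, integral_const_mul]
    _ ≤ C * t^(2-ζ) + 3 * t * (C * t^(1-ζ)) := by
        gcongr
        exact trm_int ht (by linarith) hYm hY hYp hC h0
    _ = _ := by
        have : t^(2-ζ) = t * t^(1-ζ) := by
          rw [show 2-ζ = 1 + (1-ζ) by ring, Real.rpow_add ht, Real.rpow_one]
        rw [this]; ring

lemma trGMD {ℱ : Filtration ℕ m0} {Z : ℕ → α → ℝ} (hZm : ∀ j, Measurable[ℱ (j+1)] (Z j))
    {t : ℕ → ℝ} (ht : ∀ j, 0 ≤ t j) :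
    GMD ℙ ℱ (fun j => trD ℙ (ℱ j) (t j) (Z j)) (fun j => trv ℙ (ℱ j) (t j) (Z j))
      (fun j => 2 * t j) where
  mZ j := trD_meas (ℱ.mono (Nat.le_succ j)) _ (hZm j)
  mv j := measurable_const.max ((measurable_clip _).comp stronglyMeasurable_condExp.measurable)
  bZ j x := trD_abs (ht j) _ x
  v0 j x := le_max_left _ _
  bv j x := by
    refine max_le (sq_nonneg _) ?_
    exact (le_abs_self _).trans (clip_abs (sq_nonneg _) _)
  cZ j Y h1 h2 := trD_test (ℱ.le j) (ht j) ((hZm j).mono (ℱ.le _) le_rfl) h1 h2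
  cv j Y h1 h2 := by
    have hDm : Measurable[m0] (trD ℙ (ℱ j) (t j) (Z j)) :=
      trD_meas (ℱ.le j) _ ((hZm j).mono (ℱ.le _) le_rfl)
    have hD2 : Integrable (fun y => trD ℙ (ℱ j) (t j) (Z j) y ^ 2) ℙ := by
      have bD : ∃ c, ∀ x, |trD ℙ (ℱ j) (t j) (Z j) x| ≤ c := ⟨_, trD_abs (ht j) _⟩
      simp_rw [pow_two]; exact integrable_of_bdd (hDm.mul hDm) (bdd_mul bD bD)
    rw [integral_mul_condExp' (ℱ.le j) hD2 h1 h2]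
    refine integral_congr_ae ?_
    filter_upwards [trv_ae (ℙ := ℙ) (m := ℱ j) (ht j) (Z j)] with x hx
    rw [hx]

lemma b_tendsto {a : ℝ} (ha0 : 0 < a) (ha : a < 1/2) :
    Tendsto (fun n : ℕ => (2 * ((n:ℝ)+1)^a) * Real.sqrt (LL n / n)) atTop (𝓝 0) := by
  set κ : ℝ := 1/2 - a with hκ
  have hκ0 : 0 < κ := by linarith
  have h1 : Tendsto (fun n : ℕ => 2 * 2^a * Real.sqrt (1/κ) * (n:ℝ)^(-(κ/2))) atTop (𝓝 0) := by
    have := ((tendsto_rpow_neg_atTop (show 0 < κ/2 by positivity)).comp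
      (tendsto_natCast_atTop_atTop (R := ℝ))).const_mul (2 * 2^a * Real.sqrt (1/κ))
    simpa using this
  refine squeeze_zero' ?_ ?_ h1
  · exact Eventually.of_forall fun n => by positivity
  · filter_upwards [eventually_ge_atTop 3] with n hn
    have hn3 : (3:ℝ) ≤ n := by exact_mod_cast hn
    have hn0 : (0:ℝ) < n := by linarith
    have e1 : ((n:ℝ)+1)^a ≤ 2^a * (n:ℝ)^a := by
      rw [← Real.mul_rpow (by norm_num) hn0.le]
      exact Real.rpow_le_rpow (by positivity) (by linarith) ha0.le
    have e2 : LL n ≤ (n:ℝ)^κ/κ := by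
      have hl := one_le_log hn3
      refine le_trans ?_ (Real.log_le_rpow_div hn0.le hκ0)
      unfold LL
      have := Real.log_le_sub_one_of_pos (show 0 < Real.log n by linarith)
      linarith
    have e3 : Real.sqrt (LL n / n) ≤ Real.sqrt (1/κ) * (n:ℝ)^((κ-1)/2) := by
      have : (n:ℝ)^((κ-1)/2) = Real.sqrt ((n:ℝ)^(κ-1)) := by
        rw [Real.sqrt_eq_rpow, ← Real.rpow_mul hn0.le]; ring_nf
      rw [this, ← Real.sqrt_mul (by positivity)]
      apply Real.sqrt_le_sqrt
      rw [Real.rpow_sub_one hn0.ne']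
      calc LL n / n ≤ ((n:ℝ)^κ/κ)/n := by gcongr
        _ = _ := by ring
    calc 2 * ((n:ℝ)+1)^a * Real.sqrt (LL n / n)
        ≤ 2 * (2^a * (n:ℝ)^a) * (Real.sqrt (1/κ) * (n:ℝ)^((κ-1)/2)) := by gcongr
      _ = 2 * 2^a * Real.sqrt (1/κ) * ((n:ℝ)^a * (n:ℝ)^((κ-1)/2)) := by ring
      _ = _ := by
        rw [← Real.rpow_add hn0]; congr 2; rw [hκ]; ring
end

section
variable {α : Type*} {m0 : MeasurableSpace α} {ℙ : Measure α} [IsProbabilityMeasure ℙ]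

lemma succ_rpow_mul (j : ℕ) (a b : ℝ) : (((j:ℝ)+1)^a)^b = ((j:ℝ)+1)^(a*b) :=
  (Real.rpow_mul (by positivity) a b).symm

lemma succ_mono {a : ℝ} (ha : 0 ≤ a) : Monotone (fun j : ℕ => ((j:ℝ)+1)^a) := by
  intro i j hij
  have : (i:ℝ) ≤ j := by exact_mod_cast hij
  exact Real.rpow_le_rpow (by positivity) (by linarith) ha

lemma succ_tendsto {a : ℝ} (ha : 0 < a) : Tendsto (fun j : ℕ => ((j:ℝ)+1)^a) atTop atTop :=
  (tendsto_rpow_atTop ha).comp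
    (tendsto_atTop_add_const_right _ _ (tendsto_natCast_atTop_atTop (R := ℝ)))

/-- pathwise: transfer of the LIL from the truncated to the original martingale -/
lemma phi_large {s δ : ℝ} (hs : 0 < s) (hδ : 0 < δ) {r : ℕ → ℝ}
    (hr : Tendsto (fun n : ℕ => r n / ((n:ℝ)+1)^((1:ℝ)/2)) atTop (𝓝 0)) :
    ∀ᶠ n : ℕ in atTop, |r n| ≤ δ * phi s n := by
  have h1 : Tendsto (fun n : ℕ => |r n / ((n:ℝ)+1)^((1:ℝ)/2)|) atTop (𝓝 0) := by
    simpa using hr.abs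
  have h2 := (h1.eventually (gt_mem_nhds (show 0 < δ * Real.sqrt s by positivity)))
  have h3 := (tendsto_LL.comp (tendsto_natCast_atTop_atTop (R := ℝ))).eventually_ge_atTop 1
  filter_upwards [h2, h3, eventually_ge_atTop 1] with n hn hL hn1
  have hn1' : (1:ℝ) ≤ n := by exact_mod_cast hn1
  have hp : (0:ℝ) < ((n:ℝ)+1)^((1:ℝ)/2) := by positivity
  rw [abs_div, abs_of_pos hp, div_lt_iff₀ hp] at hn
  refine hn.le.trans ?_
  rw [mul_assoc]
  gcongr
  rw [← Real.sqrt_eq_rpow, ← Real.sqrt_mul hs.le]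
  unfold phi
  apply Real.sqrt_le_sqrt
  simp only [Function.comp] at hL
  nlinarith [mul_pos hs (show (0:ℝ) < n by linarith)]

theorem mart_lil {ℱ : Filtration ℕ m0} {Z : ℕ → α → ℝ} {ζ C s ε : ℝ} (hζ : 2 < ζ)
    (hZm : ∀ j, Measurable[ℱ (j+1)] (Z j)) (hZp : ∀ j, Integrable (fun x => |Z j x|^ζ) ℙ)
    (hC : ∀ j, ∫ x, |Z j x|^ζ ∂ℙ ≤ C) (h0 : ∀ j, ℙ[Z j|ℱ j] =ᵐ[ℙ] 0) (hs : 0 < s)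
    (hV : ∀ᵐ x ∂ℙ, Tendsto (fun n : ℕ => (∑ j ∈ Finset.range n, (ℙ[fun y => Z j y ^ 2|ℱ j]) x) / n)
      atTop (𝓝 s)) (hε : 0 < ε) (hε2 : ε ≤ 1/2) :
    ∀ᵐ x ∂ℙ, (∀ᶠ n : ℕ in atTop, psum Z n x ≤ (1+ε) * phi s n) ∧
      (∃ᶠ n : ℕ in atTop, (1-ε) * phi s n ≤ psum Z n x) := by
  set a : ℝ := (1/ζ + 1/2)/2 with ha
  have hζ0 : 0 < ζ := by linarith
  have hζi : 1/ζ < 1/2 := one_div_lt_one_div_of_lt (by norm_num) hζ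
  have hζi0 : 0 < 1/ζ := by positivity
  have ha0 : 0 < a := by positivity
  have ha2 : a < 1/2 := by linarith
  have haζ : 1 < a * ζ := by
    have : 1/ζ < a := by linarith
    have := mul_lt_mul_of_pos_right this hζ0
    rwa [one_div, inv_mul_cancel₀ hζ0.ne'] at this
  set t : ℕ → ℝ := fun j => ((j:ℝ)+1)^a with ht
  have ht0 : ∀ j, 0 < t j := fun j => by simp only [ht]; positivity
  have hZm0 : ∀ j, Measurable[m0] (Z j) := fun j => (hZm j).mono (ℱ.le _) le_rfl
  have hZ : ∀ j, Integrable (Z j) ℙ := fun j => integrable_of_rpow (by linarith) (hZm0 j) (hZp j)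
  have hG := trGMD (ℙ := ℙ) hZm (fun j => (ht0 j).le)
  have hb : Monotone (fun j => 2 * t j) := (succ_mono ha0.le).const_mul (by norm_num)
  have hb0 : ∀ j, 0 ≤ 2 * t j := fun j => by have := ht0 j; positivity
  -- the clock
  have hV' : ∀ᵐ x ∂ℙ, Tendsto (fun n : ℕ => psum (fun j => trv ℙ (ℱ j) (t j) (Z j)) n x / n)
      atTop (𝓝 s) := by
    have hvi : ∀ j, Integrable (trv ℙ (ℱ j) (t j) (Z j)) ℙ := fun j =>
      integrable_condExp.congr (trv_ae (ht0 j).le (Z j)).symm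
    have k1 : ∀ᵐ x ∂ℙ, Summable (fun j : ℕ =>
        |(ℙ[fun y => Z j y ^ 2|ℱ j]) x - trv ℙ (ℱ j) (t j) (Z j) x| / ((j:ℝ)+1)) := by
      refine ae_summable (e := fun j => 4 * C * ((j:ℝ)+1)^(a*(2-ζ)-1))
        (fun j => ((integrable_condExp.sub (hvi j)).abs).div_const _)
        (fun j x => by positivity) (fun j => ?_) ?_
      · rw [integral_div, div_le_iff₀ (by positivity)]
        refine (trv_diff (ℱ.le j) (ht0 j) hζ.le (hZm0 j) (hZp j) (hC j) (h0 j)).trans (le_of_eq ?_)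
        simp only [ht]
        rw [succ_rpow_mul, Real.rpow_sub_one (by positivity)]
        have : (j:ℝ)+1 ≠ 0 := by positivity
        field_simp
      · exact (summable_succ_rpow (by nlinarith)).mul_left _
    filter_upwards [hV, k1] with x hx1 hx2
    have k2 := kronecker_nonneg (c := fun j =>
        |(ℙ[fun y => Z j y ^ 2|ℱ j]) x - trv ℙ (ℱ j) (t j) (Z j) x|) (w := fun j => (j:ℝ)+1)
      (fun j => abs_nonneg _) (fun j => by positivity)
      (fun i j hij => by have : (i:ℝ) ≤ j := (by exact_mod_cast hij); simpa using this)
      (tendsto_atTop_add_const_right _ _ (tendsto_natCast_atTop_atTop (R := ℝ))) hx2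
    have k3 : Tendsto (fun n : ℕ => (∑ j ∈ Finset.range n, (ℙ[fun y => Z j y ^ 2|ℱ j]) x) / n
        - psum (fun j => trv ℙ (ℱ j) (t j) (Z j)) n x / n) atTop (𝓝 0) := by
      have k4 := k2.const_mul 2
      rw [mul_zero] at k4
      refine squeeze_zero_norm' ?_ k4
      filter_upwards [eventually_ge_atTop 1] with n hn
      have hn1' : (1:ℝ) ≤ n := by exact_mod_cast hn
      rw [← sub_div, psum, ← Finset.sum_sub_distrib, Real.norm_eq_abs, abs_div,
        abs_of_pos (show (0:ℝ) < n by linarith)]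
      have k5 := Finset.abs_sum_le_sum_abs (fun j => (ℙ[fun y => Z j y ^ 2|ℱ j]) x
        - trv ℙ (ℱ j) (t j) (Z j) x) (Finset.range n)
      have k6 := (abs_nonneg _).trans k5
      rw [div_le_iff₀ (by linarith)]
      refine k5.trans ?_
      rw [← mul_div_assoc, div_mul_eq_mul_div, le_div_iff₀ (by linarith)]
      nlinarith
    have := hx1.sub k3
    simpa using this
  have hU := hG.lil_upper hb hb0 (b_tendsto ha0 ha2) hs hV' (half_pos hε) (by linarith)
  have hL := hG.lil_lower hb hb0 (b_tendsto ha0 ha2) hs hV' (half_pos hε) (by linarith)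
  have hE := tr_eventually (ℙ := ℙ) ht0 hζ0 hZp hC (by
    simp only [ht, succ_rpow_mul]
    exact summable_succ_rpow (by linarith))
  have hM : ∀ᵐ x ∂ℙ, Summable (fun j : ℕ =>
      |trm ℙ (ℱ j) (t j) (Z j) x| / ((j:ℝ)+1)^((1:ℝ)/2)) := by
    have hmi : ∀ j, Integrable (fun x => |trm ℙ (ℱ j) (t j) (Z j) x|) ℙ := fun j =>
      (integrable_of_bdd ((trm_meas (t j)).mono (ℱ.le j) le_rfl)
        ⟨t j, fun x => clip_abs (ht0 j).le _⟩).abs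
    refine ae_summable (e := fun j => C * ((j:ℝ)+1)^(a*(1-ζ)-1/2))
        (fun j => (hmi j).div_const _) (fun j x => by positivity) (fun j => ?_) ?_
    · rw [integral_div, div_le_iff₀ (by positivity)]
      refine (trm_int (ht0 j) (by linarith) (hZm0 j) (hZ j) (hZp j) (hC j) (h0 j)).trans (le_of_eq ?_)
      simp only [ht]
      rw [succ_rpow_mul, Real.rpow_sub (by positivity)]
      have : ((j:ℝ)+1)^((1:ℝ)/2) ≠ 0 := by positivity
      field_simp
    · exact (summable_succ_rpow (by nlinarith)).mul_left _
  filter_upwards [hU, hL, hE, hM] with x h1 h2 h3 h4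
  obtain ⟨c, hc⟩ := sum_ev_eq h3
  have k2 := kronecker_nonneg (fun j => abs_nonneg _) (fun j => by positivity)
    (succ_mono (by norm_num)) (succ_tendsto (by norm_num)) h4
  -- psum Z = psum D + Σ trm - c
  have k3 : ∀ᶠ n : ℕ in atTop, |∑ j ∈ Finset.range n, trm ℙ (ℱ j) (t j) (Z j) x - c|
      ≤ ε/2 * phi s n := by
    apply phi_large hs (half_pos hε)
    have k4 : Tendsto (fun n : ℕ => c / ((n:ℝ)+1)^((1:ℝ)/2)) atTop (𝓝 0) :=
      (succ_tendsto (by norm_num)).const_div_atTop c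
    have k5 : Tendsto (fun n : ℕ => (∑ j ∈ Finset.range n, trm ℙ (ℱ j) (t j) (Z j) x)
        / ((n:ℝ)+1)^((1:ℝ)/2)) atTop (𝓝 0) := by
      refine squeeze_zero_norm (fun n => ?_) k2
      rw [norm_div, Real.norm_eq_abs, Real.norm_of_nonneg (by positivity)]
      gcongr
      exact Finset.abs_sum_le_sum_abs _ _
    have := k5.sub k4
    simp only [sub_zero, ← sub_div] at this
    exact this
  have k6 : ∀ᶠ n : ℕ in atTop, psum Z n x = psum (fun j => trD ℙ (ℱ j) (t j) (Z j)) n x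
      + (∑ j ∈ Finset.range n, trm ℙ (ℱ j) (t j) (Z j) x - c) := by
    filter_upwards [hc] with n hn
    simp only [psum, trD, Finset.sum_sub_distrib]
    linarith
  constructor
  · filter_upwards [h1, k3, k6] with n a1 a2 a3
    rw [a3]
    have := (abs_le.1 a2).2
    nlinarith
  · refine (h2.and_eventually (k3.and k6)).mono ?_
    rintro n ⟨a1, a2, a3⟩
    rw [a3]
    have := (abs_le.1 a2).1
    nlinarith
end

section
variable {α : Type*} {m0 : MeasurableSpace α} {ℙ : Measure α} [IsProbabilityMeasure ℙ]

/-- a jointly measurable real process with uniformly bounded `p`-th moments -/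
structure PathP {α : Type*} {m0 : MeasurableSpace α} (ℙ : Measure α) (F : ℝ → α → ℝ) (p C : ℝ) :
    Prop where
  jm : Measurable fun q : ℝ × α => F q.1 q.2
  ip : ∀ s, 0 ≤ s → Integrable (fun x => |F s x|^p) ℙ
  bp : ∀ s, 0 ≤ s → ∫ x, |F s x|^p ∂ℙ ≤ C

/-- path integral -/
def pint {α : Type*} (F : ℝ → α → ℝ) (a b : ℝ) (x : α) : ℝ := ∫ s in a..b, F s x

lemma abs_le_one_add_rpow {p : ℝ} (hp : 1 ≤ p) (y : ℝ) : |y| ≤ 1 + |y|^p := by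
  rcases le_total |y| 1 with h | h
  · have : 0 ≤ |y|^p := by positivity
    linarith
  · have := Real.rpow_le_rpow_of_exponent_le h hp
    rw [Real.rpow_one] at this; linarith

namespace PathP
variable {F : ℝ → α → ℝ} {p C : ℝ}

lemma ms (h : PathP ℙ F p C) (s : ℝ) : Measurable (F s) :=
  h.jm.comp (f := fun x : α => (s, x)) (by fun_prop)

lemma mx (h : PathP ℙ F p C) (x : α) : Measurable (fun s => F s x) :=
  h.jm.comp (f := fun s : ℝ => (s, x)) (by fun_prop)

lemma i1 (h : PathP ℙ F p C) (hp : 1 ≤ p) {s : ℝ} (hs : 0 ≤ s) : Integrable (F s) ℙ :=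
  integrable_of_rpow hp (h.ms s) (h.ip s hs)

lemma prodInt (h : PathP ℙ F p C) (hp : 1 ≤ p) {a b : ℝ} (ha : 0 ≤ a) :
    Integrable (Function.uncurry F) ((volume.restrict (Ioc a b)).prod ℙ) := by
  have hm : StronglyMeasurable (Function.uncurry F) := h.jm.stronglyMeasurable
  rw [integrable_prod_iff hm.aestronglyMeasurable]
  constructor
  · filter_upwards [ae_restrict_mem measurableSet_Ioc] with s hs
    exact h.i1 hp (ha.trans hs.1.le)
  · refine Integrable.of_bound (C := 1 + C)
      (hm.norm.integral_prod_right').aestronglyMeasurable ?_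
    filter_upwards [ae_restrict_mem measurableSet_Ioc] with s hs
    have hs0 := ha.trans hs.1.le
    rw [Real.norm_of_nonneg (integral_nonneg fun _ => norm_nonneg _)]
    calc ∫ x, ‖F s x‖ ∂ℙ ≤ ∫ x, (1 + |F s x|^p) ∂ℙ :=
          integral_mono (h.i1 hp hs0).norm ((integrable_const _).add (h.ip s hs0))
            fun x => abs_le_one_add_rpow hp _
      _ = 1 + ∫ x, |F s x|^p ∂ℙ := by
          rw [integral_add (integrable_const _) (h.ip s hs0)]; simp
      _ ≤ _ := by linarith [h.bp s hs0]

lemma ae_ii (h : PathP ℙ F p C) (hp : 1 ≤ p) {a b : ℝ} (ha : 0 ≤ a) (hab : a ≤ b) :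
    ∀ᵐ x ∂ℙ, IntervalIntegrable (fun s => F s x) volume a b := by
  filter_upwards [(h.prodInt hp ha (b := b)).prod_left_ae] with x hx
  rw [intervalIntegrable_iff_integrableOn_Ioc_of_le hab]
  exact hx

lemma pint_eq {a b : ℝ} (hab : a ≤ b) (x : α) : pint F a b x = ∫ s in Ioc a b, F s x :=
  intervalIntegral.integral_of_le hab

lemma pint_meas (h : PathP ℙ F p C) {a b : ℝ} (hab : a ≤ b) : Measurable (pint F a b) := by
  have hm : StronglyMeasurable (Function.uncurry F) := h.jm.stronglyMeasurable
  have := (hm.integral_prod_left' (μ := volume.restrict (Ioc a b))).measurable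
  convert this using 2
  exact pint_eq hab _

lemma pint_int (h : PathP ℙ F p C) (hp : 1 ≤ p) {a b : ℝ} (ha : 0 ≤ a) (hab : a ≤ b) :
    Integrable (pint F a b) ℙ := by
  refine (h.prodInt hp ha (b := b)).integral_prod_right.congr (Eventually.of_forall fun x => ?_)
  exact (pint_eq hab x).symm

lemma prodIntY (h : PathP ℙ F p C) (hp : 1 ≤ p) {a b : ℝ} (ha : 0 ≤ a) {Y : α → ℝ}
    (hY : Measurable Y) (hb : ∃ c, ∀ x, |Y x| ≤ c) :
    Integrable (Function.uncurry fun s x => Y x * F s x) ((volume.restrict (Ioc a b)).prod ℙ) := by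
  obtain ⟨c, hc⟩ := hb
  exact (h.prodInt hp ha (b := b)).bdd_mul (c := c) (hY.comp measurable_snd).aestronglyMeasurable
    (Eventually.of_forall fun x => hc _)

lemma fubini (h : PathP ℙ F p C) (hp : 1 ≤ p) {a b : ℝ} (ha : 0 ≤ a) (hab : a ≤ b) {Y : α → ℝ}
    (hY : Measurable Y) (hb : ∃ c, ∀ x, |Y x| ≤ c) :
    ∫ x, Y x * pint F a b x ∂ℙ = ∫ s in a..b, ∫ x, Y x * F s x ∂ℙ := by
  rw [intervalIntegral.integral_of_le hab, integral_integral_swap (h.prodIntY hp ha hY hb)]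
  refine integral_congr_ae (Eventually.of_forall fun x => ?_)
  simp only
  rw [integral_const_mul, pint_eq hab]

end PathP

lemma bdd_condExp {m : MeasurableSpace α} {Y : α → ℝ} {c : ℝ} (hc : ∀ x, |Y x| ≤ c) :
    ∃ Y' : α → ℝ, Measurable[m] Y' ∧ (∀ x, |Y' x| ≤ c) ∧ Y' =ᵐ[ℙ] ℙ[Y|m] := by
  have h1 := ae_bdd_abs_condExp_of_ae_bdd_abs (m := m) (μ := ℙ) (R := c) (f := Y)
    (Eventually.of_forall hc)
  refine ⟨fun x => clip c ((ℙ[Y|m]) x), (measurable_clip c).comp stronglyMeasurable_condExp.measurable, ?_, ?_⟩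
  · intro x; exact clip_abs ((abs_nonneg _).trans (hc x)) _
  · filter_upwards [h1] with x hx
    exact clip_eq hx

lemma ae_eq_of_test {f g : α → ℝ} (hf : Integrable f ℙ) (hg : Integrable g ℙ)
    (h : ∀ Y : α → ℝ, Measurable Y → (∃ c, ∀ x, |Y x| ≤ c) →
      ∫ x, Y x * f x ∂ℙ = ∫ x, Y x * g x ∂ℙ) : f =ᵐ[ℙ] g := by
  refine hf.ae_eq_of_forall_setIntegral_eq _ _ hg fun s hs _ => ?_
  have := h (s.indicator 1) (measurable_one.indicator hs) ⟨1, fun x => by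
    by_cases hx : x ∈ s <;> simp [hx]⟩
  rw [← integral_indicator hs, ← integral_indicator hs]
  convert this using 2 <;> ext x <;> by_cases hx : x ∈ s <;> simp [hx]

lemma condExp_eq_of_test {m : MeasurableSpace α} (hm : m ≤ m0) {f g : α → ℝ}
    (hf : Integrable f ℙ) (hg : Integrable g ℙ)
    (h : ∀ Y : α → ℝ, Measurable[m] Y → (∃ c, ∀ x, |Y x| ≤ c) →
      ∫ x, Y x * f x ∂ℙ = ∫ x, Y x * g x ∂ℙ) : ℙ[f|m] =ᵐ[ℙ] ℙ[g|m] := by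
  refine (ae_eq_condExp_of_forall_setIntegral_eq hm hg
    (fun s _ _ => integrable_condExp.integrableOn) (fun s hs _ => ?_)
    stronglyMeasurable_condExp.aestronglyMeasurable)
  rw [setIntegral_condExp hm hf hs]
  have := h (s.indicator 1) (measurable_one.indicator hs) ⟨1, fun x => by
    by_cases hx : x ∈ s <;> simp [hx]⟩
  rw [← integral_indicator (hm s hs), ← integral_indicator (hm s hs)]
  convert this using 2 <;> ext x <;> by_cases hx : x ∈ s <;> simp [hx]

/-- duality: `E[Y E[f|m]] = E[E[Y|m] f]` -/
lemma test_swap {m : MeasurableSpace α} (hm : m ≤ m0) {f Y Y' : α → ℝ} {c : ℝ}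
    (hf : Integrable f ℙ) (hY : Measurable[m0] Y) (hc : ∀ x, |Y x| ≤ c) (hYm : Measurable[m] Y')
    (hY' : ∀ x, |Y' x| ≤ c) (he : Y' =ᵐ[ℙ] ℙ[Y|m]) :
    ∫ x, Y x * (ℙ[f|m]) x ∂ℙ = ∫ x, Y' x * f x ∂ℙ := by
  have hYi : Integrable Y ℙ := integrable_of_bdd hY ⟨c, hc⟩
  have i1 : Integrable ((ℙ[f|m]) * Y) ℙ :=
    integrable_condExp.mul_bdd (c := c) hY.aestronglyMeasurable (Eventually.of_forall hc)
  have h1 := condExp_mul_of_stronglyMeasurable_left (m := m) (μ := ℙ)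
    (stronglyMeasurable_condExp (f := f) (μ := ℙ) (m := m)) i1 hYi
  have h2 := integral_condExp (μ := ℙ) hm (f := (ℙ[f|m]) * Y)
  rw [integral_mul_condExp' hm hf hYm ⟨c, hY'⟩]
  calc ∫ x, Y x * (ℙ[f|m]) x ∂ℙ = ∫ x, ((ℙ[f|m]) * Y) x ∂ℙ := by
        congr 1; ext x; simp [mul_comm]
    _ = _ := by
        rw [← h2]
        refine integral_congr_ae ?_
        filter_upwards [h1, he] with x h3 h4
        rw [h3, h4]; simp [mul_comm]

namespace PathP
variable {F : ℝ → α → ℝ} {p C : ℝ}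

lemma adapted (h : PathP ℙ F p C) (hp : 1 ≤ p) {a b : ℝ} (ha : 0 ≤ a) (hab : a ≤ b)
    {m : MeasurableSpace α} (hm : m ≤ m0) (hF : ∀ s, a ≤ s → s ≤ b → Measurable[m] (F s)) :
    ℙ[pint F a b|m] =ᵐ[ℙ] pint F a b := by
  refine ae_eq_of_test integrable_condExp (h.pint_int hp ha hab) ?_
  rintro Y hY ⟨c, hc⟩
  obtain ⟨Y', h1, h2, h3⟩ := bdd_condExp (ℙ := ℙ) (m := m) hc
  have h1' : Measurable[m0] Y' := h1.mono hm le_rfl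
  rw [test_swap hm (h.pint_int hp ha hab) hY hc h1 h2 h3, h.fubini hp ha hab hY ⟨c, hc⟩,
    h.fubini hp ha hab h1' ⟨c, h2⟩]
  rw [intervalIntegral.integral_of_le hab, intervalIntegral.integral_of_le hab]
  refine setIntegral_congr_fun measurableSet_Ioc fun s hs => ?_
  have e : ℙ[F s|m] = F s := condExp_of_stronglyMeasurable hm
    (hF s hs.1.le hs.2).stronglyMeasurable (h.i1 hp (ha.trans hs.1.le))
  have := test_swap hm (h.i1 hp (ha.trans hs.1.le)) hY hc h1 h2 h3
  rw [e] at this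
  exact this.symm

lemma jensen (h : PathP ℙ F p C) (hp : 1 ≤ p) {a : ℝ} (ha : 0 ≤ a) :
    Integrable (fun x => |pint F a (a+1) x|^p) ℙ ∧ ∫ x, |pint F a (a+1) x|^p ∂ℙ ≤ C := by
  have hab : a ≤ a + 1 := by linarith
  have hvol : volume (Ioc a (a+1)) = 1 := by simp
  have : IsProbabilityMeasure (volume.restrict (Ioc a (a+1))) := ⟨by simp⟩
  have hm : StronglyMeasurable (Function.uncurry fun s x => |F s x|^p) :=
    (h.jm.abs.pow_const p).stronglyMeasurable
  have hI : Integrable (Function.uncurry fun s x => |F s x|^p)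
      ((volume.restrict (Ioc a (a+1))).prod ℙ) := by
    rw [integrable_prod_iff hm.aestronglyMeasurable]
    constructor
    · filter_upwards [ae_restrict_mem measurableSet_Ioc] with s hs
      exact h.ip s (ha.trans hs.1.le)
    · refine Integrable.of_bound (C := C) (hm.norm.integral_prod_right').aestronglyMeasurable ?_
      filter_upwards [ae_restrict_mem measurableSet_Ioc] with s hs
      rw [Real.norm_of_nonneg (integral_nonneg fun _ => norm_nonneg _)]
      refine le_trans (le_of_eq ?_) (h.bp s (ha.trans hs.1.le))
      congr 1; ext x
      exact Real.norm_of_nonneg (by simp only [Function.uncurry]; positivity)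
  have hJ : ∀ᵐ x ∂ℙ, |pint F a (a+1) x|^p ≤ ∫ s in Ioc a (a+1), |F s x|^p := by
    filter_upwards [hI.prod_left_ae, h.ae_ii hp ha hab] with x h1 h2
    rw [intervalIntegrable_iff_integrableOn_Ioc_of_le hab] at h2
    have h3 : |pint F a (a+1) x| ≤ ∫ s in Ioc a (a+1), |F s x| := by
      rw [pint_eq hab]; exact abs_integral_le_integral_abs
    refine (Real.rpow_le_rpow (abs_nonneg _) h3 (by linarith)).trans ?_
    exact (convexOn_rpow hp).map_integral_le (μ := volume.restrict (Ioc a (a+1)))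
      (f := fun s => |F s x|)
      (Real.continuous_rpow_const (by linarith)).continuousOn
      isClosed_Ici (Eventually.of_forall fun s => mem_Ici.2 (abs_nonneg _)) h2.abs h1
  have hR : Integrable (fun x => ∫ s in Ioc a (a+1), |F s x|^p) ℙ := hI.integral_prod_right
  have hL : Integrable (fun x => |pint F a (a+1) x|^p) ℙ := by
    refine hR.mono' ((h.pint_meas hab).abs.pow_const p).aestronglyMeasurable ?_
    filter_upwards [hJ] with x hx
    rwa [Real.norm_of_nonneg (by positivity)]
  refine ⟨hL, (integral_mono_ae hL hR hJ).trans ?_⟩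
  rw [← integral_integral_swap hI]
  calc ∫ s in Ioc a (a+1), ∫ x, |F s x|^p ∂ℙ ≤ ∫ s in Ioc a (a+1), C := by
        refine setIntegral_mono_on hI.integral_prod_left (integrable_const _) measurableSet_Ioc ?_
        intro s hs
        exact h.bp s (ha.trans hs.1.le)
    _ = C := by simp

end PathP
end

section
variable {α : Type*} {m0 : MeasurableSpace α} {ℙ : Measure α} [IsProbabilityMeasure ℙ]

/-- `p`-th absolute moment bounded by `C` -/
structure Mom {α : Type*} {m0 : MeasurableSpace α} (ℙ : Measure α) (p C : ℝ) (Y : α → ℝ) :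
    Prop where
  m : AEStronglyMeasurable Y ℙ
  i : Integrable (fun x => |Y x|^p) ℙ
  b : ∫ x, |Y x|^p ∂ℙ ≤ C

lemma add_rpow_bound {p : ℝ} (hp : 0 ≤ p) (a b : ℝ) : |a + b|^p ≤ 2^p * (|a|^p + |b|^p) := by
  have h1 : |a + b| ≤ 2 * max |a| |b| := by
    have := abs_add_le a b
    have := le_max_left |a| |b|
    have := le_max_right |a| |b|
    linarith
  calc |a+b|^p ≤ (2 * max |a| |b|)^p := Real.rpow_le_rpow (abs_nonneg _) h1 hp
    _ = 2^p * (max |a| |b|)^p := Real.mul_rpow (by norm_num) (by positivity)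
    _ ≤ _ := by
      gcongr
      have ha : 0 ≤ |a|^p := by positivity
      have hb : 0 ≤ |b|^p := by positivity
      rcases max_choice |a| |b| with h | h <;> rw [h] <;> linarith

namespace Mom
variable {p C C' : ℝ} {Y Z : α → ℝ}

lemma int (h : Mom ℙ p C Y) (hp : 1 ≤ p) : Integrable Y ℙ := by
  refine ((integrable_const (1:ℝ)).add h.i).mono' h.m (Eventually.of_forall fun x => ?_)
  exact abs_le_one_add_rpow hp _

lemma of_le (hm : AEStronglyMeasurable Y ℙ) {g : α → ℝ} (hg : Integrable g ℙ)
    (h : ∀ᵐ x ∂ℙ, |Y x|^p ≤ g x) (hC : ∫ x, g x ∂ℙ ≤ C) : Mom ℙ p C Y := by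
  have hi : Integrable (fun x => |Y x|^p) ℙ := by
    refine hg.mono' (hm.aemeasurable.abs.pow_const p).aestronglyMeasurable ?_
    filter_upwards [h] with x hx
    rwa [Real.norm_of_nonneg (by positivity)]
  exact ⟨hm, hi, (integral_mono_ae hi hg h).trans hC⟩

lemma add (h : Mom ℙ p C Y) (h' : Mom ℙ p C' Z) (hp : 0 ≤ p) :
    Mom ℙ p (2^p * (C + C')) (Y + Z) := by
  refine of_le (h.m.add h'.m) ((h.i.add h'.i).const_mul (2^p))
    (Eventually.of_forall fun x => add_rpow_bound hp _ _) ?_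
  rw [integral_const_mul]
  gcongr
  have := integral_add h.i h'.i
  simp only [Pi.add_apply]
  rw [this]; linarith [h.b, h'.b]

lemma neg (h : Mom ℙ p C Y) : Mom ℙ p C (-Y) :=
  ⟨h.m.neg, by simpa using h.i, by simpa using h.b⟩

lemma sub (h : Mom ℙ p C Y) (h' : Mom ℙ p C' Z) (hp : 0 ≤ p) :
    Mom ℙ p (2^p * (C + C')) (Y - Z) := by
  rw [sub_eq_add_neg]; exact h.add h'.neg hp

lemma bdd_mul (h : Mom ℙ p C Y) (hp : 0 ≤ p) (hZ : AEStronglyMeasurable Z ℙ) {c : ℝ}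
    (hc : ∀ x, |Z x| ≤ c) : Mom ℙ p (c^p * C) (fun x => Z x * Y x) := by
  have hc0 : 0 ≤ c := by
    obtain ⟨x⟩ : Nonempty α := by
      by_contra hne
      rw [not_nonempty_iff] at hne
      have := measure_univ (μ := ℙ)
      rw [Set.univ_eq_empty_iff.2 hne] at this
      simp at this
    exact (abs_nonneg _).trans (hc x)
  refine of_le (hZ.mul h.m) (h.i.const_mul (c^p)) (Eventually.of_forall fun x => ?_) ?_
  · rw [abs_mul, Real.mul_rpow (abs_nonneg _) (abs_nonneg _)]
    gcongr
    exact hc x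
  · rw [integral_const_mul]
    gcongr
    exact h.b

lemma congr (h : Mom ℙ p C Y) (he : Y =ᵐ[ℙ] Z) : Mom ℙ p C Z := by
  have e : (fun x => |Y x|^p) =ᵐ[ℙ] fun x => |Z x|^p := by
    filter_upwards [he] with x hx; rw [hx]
  exact ⟨h.m.congr he, h.i.congr e, by rw [← integral_congr_ae e]; exact h.b⟩

lemma condExp (h : Mom ℙ p C Y) (hp : 1 ≤ p) {m : MeasurableSpace α} (hm : m ≤ m0) :
    Mom ℙ p C (ℙ[Y|m]) := by
  have := Integrable.norm_condExp_rpow_le (m := m) hp (f := Y) (μ := ℙ) h.i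
  refine of_le (stronglyMeasurable_condExp.mono hm).aestronglyMeasurable integrable_condExp this ?_
  rw [integral_condExp hm]
  exact h.b

lemma down (h : Mom ℙ p C Y) {q : ℝ} (hq : 0 ≤ q) (hqp : q ≤ p) : Mom ℙ q (1 + C) Y := by
  refine of_le h.m ((integrable_const (1:ℝ)).add h.i) (Eventually.of_forall fun x => ?_) ?_
  · simp only [Pi.add_apply]
    rcases le_total |Y x| 1 with h | h
    · have : 0 ≤ |Y x|^p := by positivity
      have := Real.rpow_le_one (abs_nonneg _) h hq
      linarith
    · have := Real.rpow_le_rpow_of_exponent_le h hqp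
      linarith
  · have := integral_add (integrable_const (1:ℝ)) h.i
    simp only [Pi.add_apply]
    rw [this]
    simp [h.b]

lemma sq (h : Mom ℙ p C Y) : Mom ℙ (p/2) C (fun x => Y x ^ 2) := by
  have e : (fun x => |Y x ^ 2|^(p/2)) = fun x => |Y x|^p := by
    ext x
    rw [abs_pow, ← Real.rpow_natCast, ← Real.rpow_mul (abs_nonneg _)]
    congr 1; push_cast; ring
  exact ⟨h.m.pow 2, by rw [e]; exact h.i, by rw [e]; exact h.b⟩

end Mom

lemma PathP.mom {F : ℝ → α → ℝ} {p C : ℝ} (h : PathP ℙ F p C) {s : ℝ} (hs : 0 ≤ s) :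
    Mom ℙ p C (F s) := ⟨(h.ms s).aestronglyMeasurable, h.ip s hs, h.bp s hs⟩

lemma PathP.of_mom {F : ℝ → α → ℝ} {p C : ℝ} (hj : Measurable fun q : ℝ × α => F q.1 q.2)
    (h : ∀ s, 0 ≤ s → Mom ℙ p C (F s)) : PathP ℙ F p C :=
  ⟨hj, fun s hs => (h s hs).i, fun s hs => (h s hs).b⟩

lemma PathP.momInt {F : ℝ → α → ℝ} {p C : ℝ} (h : PathP ℙ F p C) (hp : 1 ≤ p) {a : ℝ}
    (ha : 0 ≤ a) : Mom ℙ p C (pint F a (a+1)) :=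
  ⟨(h.pint_meas (by linarith)).aestronglyMeasurable, (h.jensen hp ha).1, (h.jensen hp ha).2⟩

lemma slln_ae {ℱ : Filtration ℕ m0} {W : ℕ → α → ℝ} {p C : ℝ} (hp : 1 < p) (hp2 : p ≤ 2)
    (hW : ∀ j, Mom ℙ p C (W j)) (ha : ∀ j, ℙ[W j|ℱ (j+1)] =ᵐ[ℙ] W j) :
    ∀ᵐ x ∂ℙ, Tendsto (fun n : ℕ => (∑ j ∈ Finset.range n, (W j x - (ℙ[W j|ℱ j]) x)) / n)
      atTop (𝓝 0) := by
  set Y : ℕ → α → ℝ := fun j => ℙ[W j|ℱ (j+1)] - ℙ[W j|ℱ j] with hY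
  have hYm : ∀ j, Mom ℙ p (2^p * (C + C)) (Y j) := fun j =>
    ((hW j).condExp hp.le (ℱ.le _)).sub ((hW j).condExp hp.le (ℱ.le _)) (by linarith)
  have h1 := slln_mart (ℙ := ℙ) (ℱ := ℱ) (Y := Y) hp hp2 (fun j => ?_) (fun j => (hYm j).i)
    (fun j => (hYm j).b) (fun j => ?_)
  · filter_upwards [h1, ae_all_iff.2 ha] with x hx1 hx2
    refine hx1.congr fun n => ?_
    congr 1
    refine Finset.sum_congr rfl fun j _ => ?_
    simp only [hY, Pi.sub_apply]
    rw [hx2 j]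
  · exact (stronglyMeasurable_condExp.measurable).sub
      (stronglyMeasurable_condExp.measurable.mono (ℱ.mono (Nat.le_succ j)) le_rfl)
  · have e1 := condExp_sub (μ := ℙ) (integrable_condExp (f := W j) (m := ℱ (j+1)))
      (integrable_condExp (f := W j) (m := ℱ j)) (ℱ j)
    have e2 := condExp_condExp_of_le (μ := ℙ) (f := W j) (ℱ.mono (Nat.le_succ j)) (ℱ.le (j+1))
    have e3 : ℙ[ℙ[W j|ℱ j]|ℱ j] = ℙ[W j|ℱ j] := condExp_of_stronglyMeasurable (ℱ.le j)
      stronglyMeasurable_condExp integrable_condExp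
    rw [e3] at e1
    filter_upwards [e1, e2] with x h1 h2
    simp only [hY]
    rw [h1, Pi.sub_apply, h2]; simp

lemma bc_div {Y : ℕ → α → ℝ} {p C κ : ℝ} (hp : 0 < p) (hκ : 1 < κ * p)
    (hY : ∀ j, Mom ℙ p C (Y j)) :
    ∀ᵐ x ∂ℙ, Tendsto (fun n : ℕ => Y n x / ((n:ℝ)+1)^κ) atTop (𝓝 0) := by
  have h1 := ae_summable (ℙ := ℙ) (f := fun j x => |Y j x|^p / ((j:ℝ)+1)^(κ*p))
    (e := fun j => C * ((j:ℝ)+1)^(-(κ*p))) (fun j => (hY j).i.div_const _)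
    (fun j x => by positivity) (fun j => ?_) ((summable_succ_rpow (by linarith)).mul_left _)
  · filter_upwards [h1] with x hx
    have h2 := hx.tendsto_atTop_zero
    have h3 := h2.rpow_const (p := 1/p) (Or.inr (by positivity))
    rw [Real.zero_rpow (by positivity)] at h3
    refine squeeze_zero_norm (fun n => le_of_eq ?_) h3
    rw [← succ_rpow_mul, ← Real.div_rpow (by positivity) (by positivity),
      ← Real.rpow_mul (by positivity), mul_one_div_cancel hp.ne', Real.rpow_one, norm_div,
      Real.norm_eq_abs, Real.norm_of_nonneg (by positivity)]
  · rw [integral_div, Real.rpow_neg (by positivity), ← div_eq_mul_inv]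
    gcongr
    exact (hY j).b
end

section
variable {α : Type*} {m0 : MeasurableSpace α} {ℙ : Measure α} [IsProbabilityMeasure ℙ]

/-- abstract `(f(Φ), χ_f(Φ))` -/
structure Pair {α : Type*} {m0 : MeasurableSpace α} (ℙ : Measure α) (G : ℝ → MeasurableSpace α)
    (F H : ℝ → α → ℝ) (ζ C : ℝ) : Prop where
  mono : Monotone G
  le : ∀ s, G s ≤ m0
  pF : PathP ℙ F ζ C
  pH : PathP ℙ H ζ C
  aF : ∀ s, 0 ≤ s → Measurable[G s] (F s)
  aH : ∀ s, 0 ≤ s → Measurable[G s] (H s)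
  key : ∀ s t, 0 ≤ s → s ≤ t → ∀ Y : α → ℝ, Measurable[G s] Y → (∃ c, ∀ x, |Y x| ≤ c) →
    ∫ x, Y x * H t x ∂ℙ + ∫ u in s..t, ∫ x, Y x * F u x ∂ℙ = ∫ x, Y x * H s x ∂ℙ

/-- martingale increments over `[s,t]` -/
def inc {α : Type*} (F H : ℝ → α → ℝ) (s t : ℝ) (x : α) : ℝ := H t x - H s x + pint F s t x

lemma int_bdd_mul {Y f : α → ℝ} (hf : Integrable f ℙ) (hY : Measurable Y)
    (hb : ∃ c, ∀ x, |Y x| ≤ c) : Integrable (fun x => Y x * f x) ℙ := by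
  obtain ⟨c, hc⟩ := hb
  exact hf.bdd_mul (c := c) hY.aestronglyMeasurable (Eventually.of_forall hc)

namespace Pair
variable {G : ℝ → MeasurableSpace α} {F H : ℝ → α → ℝ} {ζ C : ℝ}

/-- discrete-time filtration -/
def fil (h : Pair ℙ G F H ζ C) : Filtration ℕ m0 where
  seq n := G n
  mono' i j hij := h.mono (by exact_mod_cast hij)
  le' n := h.le n

lemma inc_int (h : Pair ℙ G F H ζ C) (hζ : 1 ≤ ζ) {s t : ℝ} (hs : 0 ≤ s) (hst : s ≤ t) :
    Integrable (inc F H s t) ℙ :=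
  ((h.pH.i1 hζ (hs.trans hst)).sub (h.pH.i1 hζ hs)).add (h.pF.pint_int hζ hs hst)

lemma inc_meas (h : Pair ℙ G F H ζ C) {s t : ℝ} (hst : s ≤ t) :
    Measurable (inc F H s t) :=
  ((h.pH.ms t).sub (h.pH.ms s)).add (h.pF.pint_meas hst)

lemma inc_test (h : Pair ℙ G F H ζ C) (hζ : 1 ≤ ζ) {s t : ℝ} (hs : 0 ≤ s) (hst : s ≤ t)
    {Y : α → ℝ} (hY : Measurable[G s] Y) (hb : ∃ c, ∀ x, |Y x| ≤ c) :
    ∫ x, Y x * inc F H s t x ∂ℙ = 0 := by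
  have hY0 : Measurable[m0] Y := hY.mono (h.le s) le_rfl
  have i1 := int_bdd_mul (h.pH.i1 hζ (hs.trans hst)) hY0 hb
  have i2 := int_bdd_mul (h.pH.i1 hζ hs) hY0 hb
  have i3 := int_bdd_mul (h.pF.pint_int hζ hs hst) hY0 hb
  have k := h.key s t hs hst Y hY hb
  rw [← h.pF.fubini hζ hs hst hY0 hb] at k
  have e : (fun x => Y x * inc F H s t x) = fun x => (Y x * H t x - Y x * H s x) + Y x * pint F s t x := by
    ext x; simp only [inc]; ring
  have i12 : Integrable (fun x => Y x * H t x - Y x * H s x) ℙ := i1.sub i2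
  rw [e, integral_add i12 i3, integral_sub i1 i2]
  linarith

lemma inc_condExp (h : Pair ℙ G F H ζ C) (hζ : 1 ≤ ζ) {s t : ℝ} (hs : 0 ≤ s) (hst : s ≤ t) :
    ℙ[inc F H s t|G s] =ᵐ[ℙ] 0 := by
  have := condExp_eq_of_test (h.le s) (h.inc_int hζ hs hst) (integrable_zero _ _ _)
    (fun Y hY hb => by rw [h.inc_test hζ hs hst hY hb]; simp)
  simpa using this

lemma inc_adapted (h : Pair ℙ G F H ζ C) (hζ : 1 ≤ ζ) {s t : ℝ} (hs : 0 ≤ s) (hst : s ≤ t) :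
    ℙ[inc F H s t|G t] =ᵐ[ℙ] inc F H s t := by
  have i1 := (h.pH.i1 hζ (hs.trans hst))
  have i2 := (h.pH.i1 hζ hs)
  have i3 := h.pF.pint_int hζ hs hst
  have e : inc F H s t = (H t - H s) + pint F s t := rfl
  have e1 := condExp_add (i1.sub i2) i3 (G t)
  have e2 : ℙ[H t - H s|G t] = H t - H s := condExp_of_stronglyMeasurable (h.le t)
    ((h.aH t (hs.trans hst)).sub ((h.aH s hs).mono (h.mono hst) le_rfl)).stronglyMeasurable
    (i1.sub i2)
  have e3 := h.pF.adapted hζ hs hst (h.le t)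
    (fun r hr hr2 => (h.aF r (hs.trans hr)).mono (h.mono hr2) le_rfl)
  rw [e]
  filter_upwards [e1, e3] with x a1 a2
  rw [a1, Pi.add_apply, a2, e2]; rfl

/-- moment constant of increments -/
lemma inc_mom (h : Pair ℙ G F H ζ C) (hζ : 1 ≤ ζ) {s : ℝ} (hs : 0 ≤ s) :
    Mom ℙ ζ (2^ζ * (2^ζ * (C + C) + C)) (inc F H s (s+1)) :=
  ((h.pH.mom (by linarith)).sub (h.pH.mom hs) (by linarith)).add (h.pF.momInt hζ hs) (by linarith)

lemma sum_inc (h : Pair ℙ G F H ζ C) (hζ : 1 ≤ ζ) :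
    ∀ᵐ x ∂ℙ, ∀ n : ℕ, ∑ j ∈ Finset.range n, inc F H j (j+1) x = H n x - H 0 x + pint F 0 n x := by
  have h1 : ∀ᵐ x ∂ℙ, ∀ j : ℕ, IntervalIntegrable (fun s => F s x) volume j (j+1 : ℕ) :=
    ae_all_iff.2 fun j => h.pF.ae_ii hζ (by positivity) (by push_cast; linarith)
  filter_upwards [h1] with x hx n
  simp only [inc, Finset.sum_add_distrib]
  congr 1
  · have := Finset.sum_range_sub (fun j : ℕ => H j x) n
    push_cast at this
    exact this
  · have := intervalIntegral.sum_integral_adjacent_intervals (a := fun j : ℕ => (j:ℝ))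
      (n := n) (f := fun s => F s x) (μ := volume) (fun k _ => hx k)
    push_cast at this
    exact this

lemma down (h : Pair ℙ G F H ζ C) {q : ℝ} (hq : 0 ≤ q) (hqp : q ≤ ζ) : Pair ℙ G F H q (1 + C) :=
  { h with
    pF := PathP.of_mom h.pF.jm fun _ hs => (h.pF.mom hs).down hq hqp
    pH := PathP.of_mom h.pH.jm fun _ hs => (h.pH.mom hs).down hq hqp }

/-- law of large numbers -/
lemma lln (h : Pair ℙ G F H ζ C) (hζ : 2 ≤ ζ) :
    ∀ᵐ x ∂ℙ, Tendsto (fun n : ℕ => pint F 0 n x / n) atTop (𝓝 0) := by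
  have h' := h.down (q := 2) (by norm_num) hζ
  have hn : ∀ n : ℕ, (0:ℝ) ≤ n := fun n => n.cast_nonneg
  have h1 := slln_ae (ℙ := ℙ) (ℱ := h.fil) (W := fun j => inc F H j (j+1)) (p := 2) (by norm_num)
    le_rfl (fun j => h'.inc_mom (by norm_num) (hn j)) (fun j => by
      have := h.inc_adapted (t := (j:ℝ)+1) (by linarith) (hn j) (by linarith)
      simpa [fil] using this)
  have h2 : ∀ᵐ x ∂ℙ, ∀ j : ℕ, (ℙ[inc F H j (j+1)|h.fil j]) x = 0 := ae_all_iff.2 fun j =>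
    h.inc_condExp (by linarith) (hn j) (by linarith)
  have h3 := bc_div (ℙ := ℙ) (Y := fun n => H n) (κ := 1) (p := 2) (by norm_num) (by norm_num)
    (fun n => h'.pH.mom (hn n))
  filter_upwards [h1, h2, h3, h.sum_inc (by linarith)] with x a1 a2 a3 a4
  simp only [a2, sub_zero, a4, Real.rpow_one] at a1 a3
  have b1 : Tendsto (fun n : ℕ => H 0 x / (n:ℝ)) atTop (𝓝 0) :=
    tendsto_const_div_atTop_nhds_zero_nat _
  have b2 : Tendsto (fun n : ℕ => H n x / (n:ℝ)) atTop (𝓝 0) := by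
    have := a3.norm.const_mul 2
    simp only [norm_zero, mul_zero] at this
    refine squeeze_zero_norm' ?_ this
    filter_upwards [eventually_ge_atTop 1] with n hn
    have hn1' : (1:ℝ) ≤ n := by exact_mod_cast hn
    rw [norm_div, norm_div, Real.norm_of_nonneg (by linarith : (0:ℝ) ≤ n),
      Real.norm_of_nonneg (by linarith : (0:ℝ) ≤ n+1), ← mul_div_assoc,
      div_le_div_iff₀ (by linarith) (by linarith)]
    have := norm_nonneg (H n x)
    nlinarith
  have := (a1.sub b2).add b1
  simp only [sub_zero, add_zero] at this
  refine this.congr fun n => ?_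
  ring

end Pair
end

section
variable {α : Type*} {m0 : MeasurableSpace α} {ℙ : Measure α} [IsProbabilityMeasure ℙ]

/-- deterministic: `∫_a^b f(s) ∫_s^b f = (∫_a^b f)^2 / 2` -/
lemma sq_integral {f : ℝ → ℝ} (hf : Measurable f) {c : ℝ} (hc : ∀ s, |f s| ≤ c) {a b : ℝ} :
    2 * ∫ s in Ioc a b, f s * ∫ r in Ioc a b, (if s < r then f r else 0) =
      (∫ s in Ioc a b, f s)^2 := by
  set ν := volume.restrict (Ioc a b) with hν
  have : IsFiniteMeasure ν := by rw [hν]; infer_instance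
  have hfi : Integrable f ν := Integrable.of_bound hf.aestronglyMeasurable c (Eventually.of_forall hc)
  have hk : Measurable (fun q : ℝ × ℝ => f q.1 * if q.1 < q.2 then f q.2 else 0) :=
    (hf.comp measurable_fst).mul (Measurable.ite (measurableSet_lt measurable_fst measurable_snd)
      (hf.comp measurable_snd) measurable_const)
  have hc0 : 0 ≤ c := (abs_nonneg _).trans (hc 0)
  have hkb : ∀ q : ℝ × ℝ, ‖f q.1 * if q.1 < q.2 then f q.2 else 0‖ ≤ c * c := by
    intro q
    rw [norm_mul]
    refine mul_le_mul (hc _) ?_ (norm_nonneg _) hc0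
    split_ifs
    · exact hc _
    · simpa using hc0
  have hki : Integrable (Function.uncurry fun s r => f s * if s < r then f r else 0) (ν.prod ν) :=
    Integrable.of_bound hk.aestronglyMeasurable (c*c) (Eventually.of_forall hkb)
  have e1 : ∀ s, f s * ∫ r, (if s < r then f r else 0) ∂ν =
      ∫ r, f s * (if s < r then f r else 0) ∂ν := fun s => (integral_const_mul _ _).symm
  have sw := integral_integral_swap hki
  have ite_i : ∀ s, Integrable (fun r => if s < r then f r else 0) ν := fun s => by
    refine Integrable.of_bound (Measurable.ite measurableSet_Ioi hf measurable_const).aestronglyMeasurable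
      c (Eventually.of_forall fun r => ?_)
    split_ifs
    · exact hc _
    · simpa using hc0
  have ite_i' : ∀ s, Integrable (fun r => if r < s then f r else 0) ν := fun s => by
    refine Integrable.of_bound (Measurable.ite measurableSet_Iio hf measurable_const).aestronglyMeasurable
      c (Eventually.of_forall fun r => ?_)
    split_ifs
    · exact hc _
    · simpa using hc0
  -- second form
  have sw2 : ∫ s, f s * ∫ r, (if s < r then f r else 0) ∂ν ∂ν =
      ∫ s, f s * ∫ r, (if r < s then f r else 0) ∂ν ∂ν := by
    simp_rw [e1]
    rw [sw]
    refine integral_congr_ae (Eventually.of_forall fun s => ?_)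
    simp only
    rw [← integral_const_mul]
    refine integral_congr_ae (Eventually.of_forall fun r => ?_)
    simp only
    split_ifs <;> ring
  have hsum : ∀ s, (∫ r, (if s < r then f r else 0) ∂ν) + ∫ r, (if r < s then f r else 0) ∂ν
      = ∫ r, f r ∂ν := by
    intro s
    rw [← integral_add (ite_i s) (ite_i' s)]
    refine integral_congr_ae ?_
    have : ∀ᵐ r ∂ν, r ≠ s := by
      rw [hν]
      exact ae_restrict_of_ae (Measure.ae_ne volume s)
    filter_upwards [this] with r hr
    rcases lt_trichotomy s r with h | h | h
    · simp [h, h.not_gt]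
    · exact absurd h.symm hr
    · simp [h, h.not_gt]
  have j1 : Integrable (fun s => f s * ∫ r, (if s < r then f r else 0) ∂ν) ν := by
    simp_rw [e1]; exact hki.integral_prod_left
  have j2 : Integrable (fun s => f s * ∫ r, (if r < s then f r else 0) ∂ν) ν := by
    have : (fun s => f s * ∫ r, (if r < s then f r else 0) ∂ν) =
        fun s => f s * (∫ r, f r ∂ν) - f s * ∫ r, (if s < r then f r else 0) ∂ν := by
      ext s; rw [← hsum s]; ring
    rw [this]; exact (hfi.mul_const _).sub j1
  calc 2 * ∫ s, f s * ∫ r, (if s < r then f r else 0) ∂ν ∂ν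
      = ∫ s, f s * ∫ r, (if s < r then f r else 0) ∂ν ∂ν +
        ∫ s, f s * ∫ r, (if r < s then f r else 0) ∂ν ∂ν := by rw [← sw2]; ring
    _ = ∫ s, f s * ∫ r, f r ∂ν ∂ν := by
        rw [← integral_add j1 j2]
        congr 1; ext s; rw [← mul_add, hsum]
    _ = _ := by rw [integral_mul_const]; ring

namespace Pair
variable {G : ℝ → MeasurableSpace α} {F H : ℝ → α → ℝ} {ζ C : ℝ}

/-- tail path integral -/
def tailI {α : Type*} (F : ℝ → α → ℝ) (a b s : ℝ) (x : α) : ℝ :=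
  ∫ r in Ioc a b, (if s < r then F r x else 0)

lemma tailI_meas (h : Pair ℙ G F H ζ C) (a b : ℝ) :
    Measurable fun q : ℝ × α => tailI F a b q.1 q.2 := by
  have hm : Measurable (fun q : (ℝ × α) × ℝ => if q.1.1 < q.2 then F q.2 q.1.2 else 0) :=
    Measurable.ite (measurableSet_lt (by fun_prop) (by fun_prop))
      (h.pF.jm.comp (f := fun q : (ℝ × α) × ℝ => (q.2, q.1.2)) (by fun_prop)) measurable_const
  exact (hm.stronglyMeasurable.integral_prod_right' (ν := volume.restrict (Ioc a b))).measurable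

lemma tailI_eq {a b s : ℝ} (h1 : a ≤ s) (h2 : s ≤ b) (x : α) : tailI F a b s x = pint F s b x := by
  unfold tailI
  rw [PathP.pint_eq h2]
  have e : (fun r => if s < r then F r x else 0) = (Ioi s).indicator (fun r => F r x) := by
    ext r; simp [indicator]
  rw [e, integral_indicator measurableSet_Ioi, Measure.restrict_restrict measurableSet_Ioi]
  congr 2
  ext r; simp only [mem_inter_iff, mem_Ioi, mem_Ioc]; constructor
  · rintro ⟨h3, h4, h5⟩; exact ⟨h3, h5⟩
  · rintro ⟨h3, h4⟩; exact ⟨h3, by linarith, h4⟩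

lemma tailI_abs {c : ℝ} (hF : ∀ s x, |F s x| ≤ c) {a b : ℝ} (hab : a ≤ b) (s : ℝ) (x : α) :
    |tailI F a b s x| ≤ c * (b - a) := by
  have hc0 : 0 ≤ c := (abs_nonneg _).trans (hF 0 x)
  have := norm_setIntegral_le_of_norm_le_const (μ := volume) (s := Ioc a b) (C := c)
    (f := fun r => if s < r then F r x else 0) (by simp) (fun r _ => by
      split_ifs
      · exact hF _ _
      · simpa using hc0)
  simpa [tailI, measureReal_def, hab] using this

/-- the auxiliary process for the variance identity -/
def auxR {α : Type*} (F H : ℝ → α → ℝ) (a b : ℝ) (s : ℝ) (x : α) : ℝ :=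
  F s x * (tailI F a b s x + H b x - H s x)

lemma auxR_path (h : Pair ℙ G F H ζ C) (hζ : 1 ≤ ζ) {c : ℝ} (hF : ∀ s x, |F s x| ≤ c) {a b : ℝ}
    (ha : 0 ≤ a) (hab : a ≤ b) :
    ∃ C', PathP ℙ (auxR F H a b) 1 C' := by
  have hT : ∀ s, 0 ≤ s → Mom ℙ 1 (c * (b-a)) (tailI F a b s) := fun s _ => by
    refine Mom.of_le (g := fun _ => c * (b-a)) ?_ (integrable_const _)
      (Eventually.of_forall fun x => ?_) (by simp)
    · exact ((h.tailI_meas a b).comp (f := fun x : α => (s, x)) (by fun_prop)).aestronglyMeasurable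
    · rw [Real.rpow_one]; exact tailI_abs hF hab s x
  have h' := h.down (q := 1) (by norm_num) hζ
  refine ⟨_, PathP.of_mom ?_ fun s hs => (((hT s hs).add (h'.pH.mom (ha.trans hab)) (by norm_num)).sub
    (h'.pH.mom hs) (by norm_num)).bdd_mul (by norm_num) (h.pF.ms s).aestronglyMeasurable (hF s)⟩
  have hHb : Measurable (fun q : ℝ × α => H b q.2) := (h.pH.ms b).comp measurable_snd
  exact h.pF.jm.mul (((h.tailI_meas a b).add hHb).sub h.pH.jm)

lemma auxR_test (h : Pair ℙ G F H ζ C) (hζ : 1 ≤ ζ) {c : ℝ} (hF : ∀ s x, |F s x| ≤ c) {a b : ℝ}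
    (ha : 0 ≤ a) (hab : a ≤ b) {Y : α → ℝ} (hY : Measurable[G a] Y) (hb : ∃ c, ∀ x, |Y x| ≤ c) :
    ∫ x, Y x * pint (auxR F H a b) a b x ∂ℙ = 0 := by
  obtain ⟨C', hC'⟩ := h.auxR_path hζ hF ha hab
  rw [hC'.fubini le_rfl ha hab (hY.mono (h.le a) le_rfl) hb, intervalIntegral.integral_of_le hab]
  rw [setIntegral_congr_fun (g := fun _ => (0:ℝ)) measurableSet_Ioc]
  · simp
  intro s hs
  have hs0 : 0 ≤ s := ha.trans hs.1.le
  have := h.inc_test hζ hs0 hs.2 (Y := fun x => Y x * F s x)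
    ((hY.mono (h.mono hs.1.le) le_rfl).mul (h.aF s hs0)) (bdd_mul hb ⟨c, hF s⟩)
  simp only
  rw [← this]
  congr 1; ext x
  simp only [auxR, inc]
  rw [tailI_eq hs.1.le hs.2]; ring

/-- the bracket increments -/
def brk {α : Type*} (F H : ℝ → α → ℝ) (a b : ℝ) (x : α) : ℝ :=
  H b x ^ 2 - H a x ^ 2 + 2 * pint (fun s x => F s x * H s x) a b x

lemma pathQ (h : Pair ℙ G F H ζ C) (hζ : 1 ≤ ζ) {c : ℝ} (hF : ∀ s x, |F s x| ≤ c) :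
    PathP ℙ (fun s x => F s x * H s x) ζ (c^ζ * C) :=
  PathP.of_mom (h.pF.jm.mul h.pH.jm) fun s hs =>
    (h.pH.mom hs).bdd_mul (by linarith) (h.pF.ms s).aestronglyMeasurable (hF s)

lemma pint_abs {c : ℝ} (hF : ∀ s x, |F s x| ≤ c) {a b : ℝ} (hab : a ≤ b) (x : α) :
    |pint F a b x| ≤ c * (b - a) := by
  have := intervalIntegral.norm_integral_le_of_norm_le_const (a := a) (b := b) (C := c)
    (f := fun s => F s x) (fun s _ => hF s x)
  rwa [abs_of_nonneg (sub_nonneg.2 hab)] at this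

lemma sq_ae (h : Pair ℙ G F H ζ C) (hζ : 1 ≤ ζ) {c : ℝ} (hF : ∀ s x, |F s x| ≤ c) {a b : ℝ}
    (ha : 0 ≤ a) (hab : a ≤ b) :
    ∀ᵐ x ∂ℙ, inc F H a b x ^ 2 = brk F H a b x - 2 * (H a x * inc F H a b x)
      + 2 * pint (auxR F H a b) a b x := by
  filter_upwards [(h.pathQ hζ hF).ae_ii hζ ha hab] with x hx
  rw [intervalIntegrable_iff_integrableOn_Ioc_of_le hab] at hx
  have hFx := h.pF.mx x
  have hFi : IntegrableOn (fun s => F s x) (Ioc a b) :=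
    Integrable.of_bound hFx.aestronglyMeasurable c (Eventually.of_forall fun s => hF s x)
  have hTi : IntegrableOn (fun s => F s x * tailI F a b s x) (Ioc a b) := by
    refine hFi.mul_bdd (c := c * (b-a)) ?_ (Eventually.of_forall fun s => tailI_abs hF hab s x)
    exact ((h.tailI_meas a b).comp (f := fun s : ℝ => (s, x)) (by fun_prop)).aestronglyMeasurable
  have e : pint (auxR F H a b) a b x = (∫ s in Ioc a b, F s x * tailI F a b s x)
      + H b x * (pint F a b x) - pint (fun s x => F s x * H s x) a b x := by
    rw [PathP.pint_eq hab, PathP.pint_eq hab, PathP.pint_eq hab]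
    have e1 : ∀ s, auxR F H a b s x = (F s x * tailI F a b s x + F s x * H b x) - F s x * H s x := by
      intro s; simp only [auxR]; ring
    simp_rw [e1]
    have hFi2 := hFi.mul_const (H b x)
    have i12 : Integrable (fun s => F s x * tailI F a b s x + F s x * H b x)
      (volume.restrict (Ioc a b)) := hTi.add hFi2
    rw [integral_sub i12 hx, integral_add hTi hFi2, integral_mul_const]
    ring
  have e2 := sq_integral (a := a) (b := b) hFx (fun s => hF s x)
  have e3 : 2 * ∫ s in Ioc a b, F s x * tailI F a b s x = (pint F a b x)^2 := by
    rw [PathP.pint_eq hab]; exact e2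
  rw [e]
  simp only [inc, brk]
  linear_combination (-1) * e3

lemma brk_int (h : Pair ℙ G F H ζ C) (hζ : 2 ≤ ζ) {c : ℝ} (hF : ∀ s x, |F s x| ≤ c) {a b : ℝ}
    (ha : 0 ≤ a) (hab : a ≤ b) : Integrable (brk F H a b) ℙ := by
  have hs : ∀ s, 0 ≤ s → Integrable (fun x => H s x ^ 2) ℙ := fun s hs =>
    (h.pH.mom hs).sq.int (by linarith)
  exact ((hs b (ha.trans hab)).sub (hs a ha)).add
    (((h.pathQ (by linarith) hF).pint_int (by linarith) ha hab).const_mul 2)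

lemma var_condExp (h : Pair ℙ G F H ζ C) (hζ : 2 ≤ ζ) {c : ℝ} (hF : ∀ s x, |F s x| ≤ c) {a b : ℝ}
    (ha : 0 ≤ a) (hab : a ≤ b) :
    ℙ[fun x => inc F H a b x ^ 2|G a] =ᵐ[ℙ] ℙ[brk F H a b|G a] := by
  have hζ1 : 1 ≤ ζ := by linarith
  have hH2 : ∀ s, 0 ≤ s → Integrable (fun x => H s x ^ 2) ℙ := fun s hs =>
    (h.pH.mom hs).sq.int (by linarith)
  have hHp : MemLp (H a) 2 ℙ := (memLp_two_iff_integrable_sq (h.pH.ms a).aestronglyMeasurable).2 (hH2 a ha)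
  have hHb : MemLp (H b) 2 ℙ := (memLp_two_iff_integrable_sq (h.pH.ms b).aestronglyMeasurable).2
    (hH2 b (ha.trans hab))
  have hJ : MemLp (pint F a b) 2 ℙ := MemLp.of_bound (h.pF.pint_meas hab).aestronglyMeasurable
    (c * (b-a)) (Eventually.of_forall fun x => pint_abs hF hab x)
  have hinc : MemLp (inc F H a b) 2 ℙ := (hHb.sub hHp).add hJ
  have hAinc : Integrable (fun x => H a x * inc F H a b x) ℙ := hHp.integrable_mul hinc
  refine condExp_eq_of_test (h.le a) hinc.integrable_sq (h.brk_int hζ hF ha hab) ?_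
  intro Y hY hb
  have hY0 : Measurable[m0] Y := hY.mono (h.le a) le_rfl
  obtain ⟨C', hC'⟩ := h.auxR_path hζ1 hF ha hab
  have t1 := h.auxR_test hζ1 hF ha hab hY hb
  have t2 : ∫ x, Y x * (H a x * inc F H a b x) ∂ℙ = 0 := by
    have hYH : StronglyMeasurable[G a] (fun x => Y x * H a x) := (hY.mul (h.aH a ha)).stronglyMeasurable
    have e : (fun x => Y x * (H a x * inc F H a b x)) = (fun x => Y x * H a x) * inc F H a b := by
      ext x; simp [mul_assoc]
    have hi : Integrable ((fun x => Y x * H a x) * inc F H a b) ℙ := by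
      rw [← e]; exact int_bdd_mul hAinc hY0 hb
    have := condExp_mul_of_stronglyMeasurable_left hYH hi (h.inc_int hζ1 ha hab)
    rw [e, ← integral_condExp (h.le a)]
    rw [integral_congr_ae (g := fun _ => (0:ℝ))]
    · simp
    filter_upwards [this, h.inc_condExp hζ1 ha hab] with x a1 a2
    rw [a1, Pi.mul_apply, a2]; simp
  have i1 := int_bdd_mul (h.brk_int hζ hF ha hab) hY0 hb
  have i2 := (int_bdd_mul hAinc hY0 hb).const_mul 2
  have i3 := (int_bdd_mul (hC'.pint_int le_rfl ha hab) hY0 hb).const_mul 2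
  have i12 : Integrable (fun x => Y x * brk F H a b x - 2 * (Y x * (H a x * inc F H a b x))) ℙ :=
    i1.sub i2
  calc ∫ x, Y x * inc F H a b x ^ 2 ∂ℙ
      = ∫ x, (Y x * brk F H a b x - 2 * (Y x * (H a x * inc F H a b x)))
        + 2 * (Y x * pint (auxR F H a b) a b x) ∂ℙ := by
        refine integral_congr_ae ?_
        filter_upwards [h.sq_ae hζ1 hF ha hab] with x hx
        rw [hx]; ring
    _ = _ := by
        rw [integral_add i12 i3, integral_sub i1 i2, integral_const_mul, integral_const_mul, t1, t2]
        ring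
end Pair
end

section
variable {α : Type*} {m0 : MeasurableSpace α} {ℙ : Measure α} [IsProbabilityMeasure ℙ]

namespace Pair
variable {G : ℝ → MeasurableSpace α} {F H : ℝ → α → ℝ} {ζ C : ℝ}

lemma brk_adapted (h : Pair ℙ G F H ζ C) (hζ : 2 ≤ ζ) {c : ℝ} (hF : ∀ s x, |F s x| ≤ c) {a b : ℝ}
    (ha : 0 ≤ a) (hab : a ≤ b) : ℙ[brk F H a b|G b] =ᵐ[ℙ] brk F H a b := by
  have hH2 : ∀ s, 0 ≤ s → Integrable (fun x => H s x ^ 2) ℙ := fun s hs =>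
    (h.pH.mom hs).sq.int (by linarith)
  have hζ1 : 1 ≤ ζ := by linarith
  have hQ := h.pathQ hζ1 hF
  have i12 := (hH2 b (ha.trans hab)).sub (hH2 a ha)
  have i3 := (hQ.pint_int hζ1 ha hab)
  have e : brk F H a b = ((fun x => H b x ^ 2) - (fun x => H a x ^ 2))
      + (2:ℝ) • pint (fun s x => F s x * H s x) a b := rfl
  have e1 := condExp_add i12 (i3.smul (2:ℝ)) (G b)
  have e4 := condExp_smul (μ := ℙ) (2:ℝ) (pint (fun s x => F s x * H s x) a b) (G b)
  have e2 : ℙ[(fun x => H b x ^ 2) - (fun x => H a x ^ 2)|G b] =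
      (fun x => H b x ^ 2) - (fun x => H a x ^ 2) := condExp_of_stronglyMeasurable (h.le b)
    (((h.aH b (ha.trans hab)).pow_const 2).sub
      (((h.aH a ha).mono (h.mono hab) le_rfl).pow_const 2)).stronglyMeasurable i12
  have e3 := hQ.adapted hζ1 ha hab (h.le b)
    (fun r hr hr2 => ((h.aF r (ha.trans hr)).mul (h.aH r (ha.trans hr))).mono (h.mono hr2) le_rfl)
  rw [e]
  filter_upwards [e1, e3, e4] with x a1 a2 a4
  rw [a1, Pi.add_apply, a4, e2, Pi.smul_apply, a2]; rfl

lemma brk_mom (h : Pair ℙ G F H ζ C) (hζ : 2 ≤ ζ) {c : ℝ} (hF : ∀ s x, |F s x| ≤ c) :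
    ∃ C', ∀ a, 0 ≤ a → Mom ℙ (ζ/2) C' (brk F H a (a+1)) := by
  have hζ1 : 1 ≤ ζ := by linarith
  have hQ := h.pathQ hζ1 hF
  refine ⟨_, fun a ha => (((h.pH.mom (s := a+1) (by linarith)).sq.sub (h.pH.mom ha).sq
    (by linarith)).add (((hQ.momInt hζ1 ha).down (q := ζ/2) (by linarith) (by linarith)).bdd_mul
    (by linarith) (Z := fun _ => 2) aestronglyMeasurable_const (c := 2) (fun _ => by simp)) (by linarith))⟩

lemma sum_brk (h : Pair ℙ G F H ζ C) (hζ : 2 ≤ ζ) {c : ℝ} (hF : ∀ s x, |F s x| ≤ c) :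
    ∀ᵐ x ∂ℙ, ∀ n : ℕ, ∑ j ∈ Finset.range n, brk F H j (j+1) x = H n x ^ 2 - H 0 x ^ 2
      + 2 * pint (fun s x => F s x * H s x) 0 n x := by
  have h1 : ∀ᵐ x ∂ℙ, ∀ j : ℕ,
      IntervalIntegrable (fun s => F s x * H s x) volume j (j+1 : ℕ) :=
    ae_all_iff.2 fun j => (h.pathQ (by linarith) hF).ae_ii (by linarith) (by positivity)
      (by push_cast; linarith)
  filter_upwards [h1] with x hx n
  simp only [brk, Finset.sum_add_distrib]
  congr 1
  · have := Finset.sum_range_sub (fun j : ℕ => H j x ^ 2) n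
    push_cast at this
    exact this
  · have := intervalIntegral.sum_integral_adjacent_intervals (a := fun j : ℕ => (j:ℝ))
      (n := n) (f := fun s => F s x * H s x) (μ := volume) (fun k _ => hx k)
    push_cast at this
    rw [← Finset.mul_sum]
    congr 1

lemma clock (h : Pair ℙ G F H ζ C) (hζ : 2 < ζ) (hζ4 : ζ ≤ 4) {c : ℝ} (hF : ∀ s x, |F s x| ≤ c)
    {q : ℝ} (hq : ∀ᵐ x ∂ℙ, Tendsto (fun n : ℕ => pint (fun s x => F s x * H s x) 0 n x / n)
      atTop (𝓝 q)) :
    ∀ᵐ x ∂ℙ, Tendsto (fun n : ℕ => (∑ j ∈ Finset.range n,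
      (ℙ[fun y => inc F H j (j+1) y ^ 2|h.fil j]) x) / n) atTop (𝓝 (2*q)) := by
  have hn : ∀ n : ℕ, (0:ℝ) ≤ n := fun n => n.cast_nonneg
  obtain ⟨C', hC'⟩ := h.brk_mom hζ.le hF
  have h1 := slln_ae (ℙ := ℙ) (ℱ := h.fil) (W := fun j => brk F H j (j+1)) (p := ζ/2) (by linarith)
    (by linarith) (fun j => hC' j (hn j)) (fun j => by
      have := h.brk_adapted (b := (j:ℝ)+1) hζ.le hF (hn j) (by linarith)
      simpa [fil] using this)
  have h2 : ∀ᵐ x ∂ℙ, ∀ j : ℕ, (ℙ[fun y => inc F H j (j+1) y ^ 2|h.fil j]) x =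
      (ℙ[brk F H j (j+1)|h.fil j]) x := ae_all_iff.2 fun j =>
    h.var_condExp hζ.le hF (hn j) (by linarith)
  have h3 := bc_div (ℙ := ℙ) (Y := fun n => H n) (κ := 1/2) (p := ζ) (by linarith) (by linarith)
    (fun n => h.pH.mom (hn n))
  filter_upwards [h1, h2, h3, h.sum_brk hζ.le hF, hq] with x a1 a2 a3 a4 a5
  simp only [Finset.sum_sub_distrib, a4] at a1
  simp only [a2]
  have b1 : Tendsto (fun n : ℕ => H 0 x ^ 2 / (n:ℝ)) atTop (𝓝 0) :=
    tendsto_const_div_atTop_nhds_zero_nat _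
  have b2 : Tendsto (fun n : ℕ => H n x ^ 2 / (n:ℝ)) atTop (𝓝 0) := by
    have := (a3.pow 2).const_mul 2
    simp only [ne_eq, OfNat.ofNat_ne_zero, not_false_eq_true, zero_pow, mul_zero] at this
    refine squeeze_zero' (Eventually.of_forall fun n => by positivity) ?_ this
    filter_upwards [eventually_ge_atTop 1] with n hn
    have hn1' : (1:ℝ) ≤ n := by exact_mod_cast hn
    rw [← Real.sqrt_eq_rpow, div_pow, Real.sq_sqrt (by linarith), ← mul_div_assoc,
      div_le_div_iff₀ (by linarith) (by linarith)]
    have := sq_nonneg (H n x)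
    nlinarith
  have := ((b2.sub b1).add (a5.const_mul 2)).sub a1
  simp only [sub_zero, zero_add] at this
  refine this.congr fun n => ?_
  ring

theorem lil (h : Pair ℙ G F H ζ C) (hζ : 2 < ζ) (hζ4 : ζ ≤ 4) {c : ℝ} (hF : ∀ s x, |F s x| ≤ c)
    {q : ℝ} (hq : ∀ᵐ x ∂ℙ, Tendsto (fun n : ℕ => pint (fun s x => F s x * H s x) 0 n x / n)
      atTop (𝓝 q)) (hq0 : 0 < 2 * q) {ε : ℝ} (hε : 0 < ε) (hε2 : ε ≤ 1/2) :
    ∀ᵐ x ∂ℙ, (∀ᶠ n : ℕ in atTop, pint F 0 n x ≤ (1+ε) * phi (2*q) n) ∧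
      (∃ᶠ n : ℕ in atTop, (1-ε) * phi (2*q) n ≤ pint F 0 n x) := by
  have hn : ∀ n : ℕ, (0:ℝ) ≤ n := fun n => n.cast_nonneg
  have hζ1 : 1 ≤ ζ := by linarith
  have hae : ∀ j : ℕ, ℙ[inc F H j (j+1)|h.fil (j+1)] =ᵐ[ℙ] inc F H j (j+1) := fun j => by
    have := h.inc_adapted (t := (j:ℝ)+1) (by linarith) (hn j) (by linarith)
    simpa [fil] using this
  have hM := fun j : ℕ => (h.inc_mom hζ1 (hn j)).congr (hae j).symm
  have hL := mart_lil (ℙ := ℙ) (ℱ := h.fil) (Z := fun j : ℕ => ℙ[inc F H j (j+1)|h.fil (j+1)])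
    (ζ := ζ) (s := 2*q) (ε := ε/2) hζ (fun j => stronglyMeasurable_condExp.measurable)
    (fun j => (hM j).i) (fun j => (hM j).b)
    (fun j => (condExp_congr_ae (hae j)).trans (h.inc_condExp hζ1 (hn j) (by linarith))) hq0
    (by
      have e : ∀ᵐ x ∂ℙ, ∀ j : ℕ, (ℙ[fun y => (ℙ[inc F H j (j+1)|h.fil (j+1)]) y ^ 2|h.fil j]) x =
          (ℙ[fun y => inc F H j (j+1) y ^ 2|h.fil j]) x := ae_all_iff.2 fun j => by
        refine condExp_congr_ae ?_
        filter_upwards [hae j] with x hx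
        rw [hx]
      filter_upwards [h.clock hζ hζ4 hF hq, e] with x a1 a2
      simpa only [a2] using a1) (half_pos hε) (by linarith)
  have h3 := bc_div (ℙ := ℙ) (Y := fun n => H n) (κ := 1/2) (p := ζ) (by linarith) (by linarith)
    (fun n => h.pH.mom (hn n))
  filter_upwards [hL, ae_all_iff.2 hae, h3, h.sum_inc hζ1] with x a1 a2 a3 a4
  have e : ∀ n : ℕ, pint F 0 n x = psum (fun j : ℕ => ℙ[inc F H j (j+1)|h.fil (j+1)]) n x
      + (H 0 x - H n x) := by
    intro n
    simp only [psum, a2, a4]; ring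
  have k4 : Tendsto (fun n : ℕ => H 0 x / ((n:ℝ)+1)^((1:ℝ)/2)) atTop (𝓝 0) :=
    (succ_tendsto (by norm_num)).const_div_atTop _
  have k5 := k4.sub a3
  simp only [sub_zero, ← sub_div] at k5
  have k6 := phi_large hq0 (half_pos hε) k5
  constructor
  · filter_upwards [a1.1, k6] with n b1 b2
    rw [e]
    have := (abs_le.1 b2).2
    nlinarith
  · refine (a1.2.and_eventually k6).mono ?_
    rintro n ⟨b1, b2⟩
    rw [e]
    have := (abs_le.1 b2).1
    nlinarith

end Pair
end

section
variable {X : Type*} [MetricSpace X] [CompleteSpace X] [SecondCountableTopology X]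
  [MeasurableSpace X] [BorelSpace X]
variable {P : ℝ → X → Measure X} {γ : ℝ} {x₀ : X} {μ μstar : Measure X}
  [IsProbabilityMeasure μ] [IsProbabilityMeasure μstar]

lemma lip_bound {f : X → ℝ} {K : ℝ≥0} (hf : LipschitzWith K f) (x y : X) :
    |f x - f y| ≤ K * dist x y := by
  have := hf.dist_le_mul x y
  rwa [Real.dist_eq] at this

lemma lip_integrable {ν : Measure X} [IsProbabilityMeasure ν] {f : X → ℝ} {K : ℝ≥0}
    (hf : LipschitzWith K f) (h : Integrable (fun x => dist x₀ x) ν) : Integrable f ν := by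
  refine ((integrable_const |f x₀|).add (h.const_mul (K:ℝ))).mono'
    hf.continuous.measurable.aestronglyMeasurable (Eventually.of_forall fun y => ?_)
  have h1 := lip_bound hf x₀ y
  have h2 : |f y| ≤ |f x₀| + |f x₀ - f y| := by
    have := abs_sub_abs_le_abs_sub (f y) (f x₀)
    rw [abs_sub_comm] at this; linarith
  simp only [Real.norm_eq_abs, Pi.add_apply]
  linarith

namespace IsMarkovSemigroup

/-- the kernel at time `t` -/
def kerT (hP : IsMarkovSemigroup P) (t : ℝ) : ProbabilityTheory.Kernel X X where
  toFun := P t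
  measurable' := Measure.measurable_of_measurable_coe _ fun s hs =>
    (hP.jointMeas s hs).comp (f := fun x : X => (t, x)) (by fun_prop)

/-- the space-time kernel -/
def kerJ (hP : IsMarkovSemigroup P) : ProbabilityTheory.Kernel (ℝ × X) X where
  toFun p := P p.1 p.2
  measurable' := Measure.measurable_of_measurable_coe _ fun s hs => hP.jointMeas s hs

lemma measT (hP : IsMarkovSemigroup P) (t : ℝ) : Measurable (P t) := (hP.kerT t).measurable

lemma measJ (hP : IsMarkovSemigroup P) {f : X → ℝ} (hf : Measurable f) :
    Measurable fun p : ℝ × X => funAct P p.1 f p.2 :=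
  (hf.stronglyMeasurable.integral_kernel (κ := hP.kerJ)).measurable

lemma measA (hP : IsMarkovSemigroup P) {f : X → ℝ} (hf : Measurable f) (t : ℝ) :
    Measurable (funAct P t f) :=
  (hP.measJ hf).comp (f := fun x : X => (t, x)) (by fun_prop)

lemma act_int (hP : IsMarkovSemigroup P) {t : ℝ} {ν : Measure X}
    {f : X → ℝ} (hf : Integrable f (measAct P t ν)) :
    Integrable (funAct P t f) ν ∧ ∫ x, f x ∂(measAct P t ν) = ∫ x, funAct P t f x ∂ν := by
  have e : measAct P t ν = (ProbabilityTheory.Kernel.comp (hP.kerT t) (ProbabilityTheory.Kernel.const Unit ν)) () := by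
    rw [ProbabilityTheory.Kernel.comp_apply]; rfl
  rw [e] at hf ⊢
  have h1 := hf.integral_comp
  have h2 := ProbabilityTheory.Kernel.integral_comp hf
  exact ⟨h1, h2⟩

lemma ffm (hP : IsMarkovSemigroup P) (hA3 : CondA3 P γ) {t : ℝ} (ht : 0 ≤ t) (x : X) :
    FiniteFirstMoment (P t x) := by
  have hd : FiniteFirstMoment (Measure.dirac x) := fun y =>
    integrable_dirac (by simp)
  rcases ht.eq_or_lt with rfl | h
  · rw [IsMarkovSemigroup.init hP]; exact hd
  · have := hA3.1 (Measure.dirac x) inferInstance hd t h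
    rwa [measAct, Measure.dirac_bind (hP.measT t)] at this

lemma contr (hP : IsMarkovSemigroup P) (hA3 : CondA3 P γ) {t : ℝ} (ht : 0 ≤ t)
    {f : X → ℝ} {K : ℝ≥0} (hf : LipschitzWith K f) (x y : X) :
    |funAct P t f x - funAct P t f y| ≤ K * (Real.exp (-γ * t) * dist x y) := by
  have p1 := hP.prob t ht x
  have p2 := hP.prob t ht y
  rcases eq_or_ne K 0 with rfl | hK
  · have hc : ∀ z, f z = f x := fun z => by
      have := lip_bound hf z x
      simp only [NNReal.coe_zero, zero_mul] at this
      linarith [abs_le.1 this]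
    have hf' : f = fun _ => f x := funext hc
    simp only [funAct, hc]
    simp
  · have hK0 : (0:ℝ) < K := by positivity
    set f' : X → ℝ := fun z => (K:ℝ)⁻¹ * f z with hf'
    have hl : LipschitzWith 1 f' := LipschitzWith.of_dist_le_mul fun a b => by
      rw [Real.dist_eq, hf', NNReal.coe_one, one_mul]
      have := lip_bound hf a b
      simp only
      rw [← mul_sub, abs_mul, abs_of_pos (inv_pos.2 hK0), inv_mul_le_iff₀ hK0]
      exact this
    have hb : BddAbove {r | ∃ f : X → ℝ, LipschitzWith 1 f ∧
        r = |(∫ z, f z ∂(P t x)) - ∫ z, f z ∂(P t y)|} := by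
      refine ⟨(∫ z, dist x z ∂(P t x)) + ∫ z, dist x z ∂(P t y), ?_⟩
      rintro r ⟨h, hh, rfl⟩
      have key : ∀ w : X, ∀ _ : IsProbabilityMeasure (P t w), |(∫ z, h z ∂(P t w)) - h x| ≤ ∫ z, dist x z ∂(P t w) := by
        intro w hw
        have i1 := lip_integrable hh (hP.ffm hA3 ht w x)
        have e : (∫ z, h z ∂(P t w)) - h x = ∫ z, (h z - h x) ∂(P t w) := by
          rw [integral_sub i1 (integrable_const _)]; simp
        rw [e]
        refine (abs_integral_le_integral_abs).trans (integral_mono (i1.sub (integrable_const _)).abs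
          (hP.ffm hA3 ht w x) fun z => ?_)
        have := lip_bound hh z x
        rw [dist_comm] at this
        simpa using this
      have k1 := key x p1
      have k2 := key y p2
      rw [abs_le] at *
      constructor <;> linarith [k1.1, k1.2, k2.1, k2.2]
    have h1 := le_csSup hb ⟨f', hl, rfl⟩
    have h2 := hA3.2.2 t ht x y
    unfold wassDist at h2
    have h3 := h1.trans h2
    rw [hf', integral_const_mul, integral_const_mul, ← mul_sub, abs_mul,
      abs_of_pos (inv_pos.2 hK0), inv_mul_le_iff₀ hK0] at h3
    exact h3

lemma act_bdd (hP : IsMarkovSemigroup P) {t : ℝ} (ht : 0 ≤ t) {f : X → ℝ} {c : ℝ}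
    (hc : ∀ x, |f x| ≤ c) (x : X) : |funAct P t f x| ≤ c := by
  have p1 := hP.prob t ht x
  have := norm_integral_le_of_norm_le_const (μ := P t x) (f := f) (C := c) (Eventually.of_forall hc)
  simpa [funAct] using this

lemma prob_act (hP : IsMarkovSemigroup P) {t : ℝ} (ht : 0 ≤ t) (ν : Measure X)
    [IsProbabilityMeasure ν] : IsProbabilityMeasure (measAct P t ν) := by
  constructor
  rw [measAct, Measure.bind_apply MeasurableSet.univ (hP.measT t).aemeasurable]
  have : ∀ x, P t x univ = 1 := fun x => (hP.prob t ht x).measure_univ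
  simp [this]

lemma limit_mean (hP : IsMarkovSemigroup P) (hA3 : CondA3 P γ)
    (hinv : ∀ t, 0 ≤ t → measAct P t μstar = μstar) {f : X → ℝ} {K : ℝ≥0} {c : ℝ}
    (hf : LipschitzWith K f) (hc : ∀ x, |f x| ≤ c) :
    Tendsto (fun k : ℕ => ∫ x, f x ∂(measAct P k μ)) atTop (𝓝 (∫ x, f x ∂μstar)) := by
  have hm := hf.continuous.measurable
  have hi : ∀ (k : ℕ) (ν : Measure X) [IsProbabilityMeasure ν],
      Integrable (funAct P k f) ν := fun k ν _ =>
    integrable_of_bdd (hP.measA hm _) ⟨c, hP.act_bdd k.cast_nonneg hc⟩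
  have ee : ∀ (k : ℕ) (ν : Measure X) [IsProbabilityMeasure ν],
      ∫ x, f x ∂(measAct P k ν) = ∫ x, funAct P k f x ∂ν := fun k ν _ => by
    have := hP.prob_act k.cast_nonneg (t := (k:ℝ)) ν
    exact (hP.act_int (integrable_of_bdd hm ⟨c, hc⟩)).2
  have h0 : Tendsto (fun k : ℕ => ∫ p : X × X, (funAct P k f p.1 - funAct P k f p.2) ∂(μ.prod μstar))
      atTop (𝓝 (∫ _ : X × X, (0:ℝ) ∂(μ.prod μstar))) := by
    refine tendsto_integral_of_dominated_convergence (fun _ => c + c) (fun k => ?_)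
      (integrable_const _) (fun k => Eventually.of_forall fun p => ?_)
      (Eventually.of_forall fun p => ?_)
    · exact (((hP.measA hm _).comp measurable_fst).sub
        ((hP.measA hm _).comp measurable_snd)).aestronglyMeasurable
    · have a1 := hP.act_bdd (t := (k:ℝ)) k.cast_nonneg hc p.1
      have a2 := hP.act_bdd (t := (k:ℝ)) k.cast_nonneg hc p.2
      exact (norm_sub_le _ _).trans (add_le_add a1 a2)
    · refine squeeze_zero_norm (a := fun k : ℕ => (K:ℝ) * (Real.exp (-γ * k) * dist p.1 p.2))
        (fun k => hP.contr hA3 k.cast_nonneg hf _ _) ?_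
      have : Tendsto (fun k : ℕ => Real.exp (-γ * k)) atTop (𝓝 0) := by
        refine Real.tendsto_exp_atBot.comp ?_
        exact tendsto_natCast_atTop_atTop.const_mul_atTop_of_neg (by linarith [hA3.2.1])
      simpa using (this.mul_const (dist p.1 p.2)).const_mul (K:ℝ)
  have e2 : ∀ k : ℕ, ∫ p : X × X, (funAct P k f p.1 - funAct P k f p.2) ∂(μ.prod μstar)
      = ∫ x, f x ∂(measAct P k μ) - ∫ x, f x ∂μstar := by
    intro k
    rw [integral_sub ((hi k μ).comp_fst μstar) ((hi k μstar).comp_snd μ), ee k μ]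
    congr 1
    · simp [integral_fun_fst (μ := μ) (ν := μstar) (f := funAct P k f)]
    · rw [integral_fun_snd (μ := μ) (ν := μstar) (f := funAct P k f)]
      simp only [probReal_univ, one_smul]
      rw [← ee k μstar, hinv _ k.cast_nonneg]
  simp only [e2, integral_zero] at h0
  have := h0.add_const (∫ x, f x ∂μstar)
  simpa using this

end IsMarkovSemigroup

end

section
variable {X : Type*} [MetricSpace X] [CompleteSpace X] [SecondCountableTopology X]
  [MeasurableSpace X] [BorelSpace X]
variable {P : ℝ → X → Measure X} {γ ζ : ℝ} {x₀ : X} {μ μstar : Measure X}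
  [IsProbabilityMeasure μ] [IsProbabilityMeasure μstar]

lemma A4_mom (_hP : IsMarkovSemigroup P) (hA4 : CondA4 P μ x₀ ζ) :
    ∃ M : ℝ, 0 ≤ M ∧ ∀ t, 0 ≤ t → Integrable (fun x => dist x₀ x ^ ζ) (measAct P t μ) ∧
      ∫ x, dist x₀ x ^ ζ ∂(measAct P t μ) ≤ M := by
  obtain ⟨hz, M, hM⟩ := hA4
  refine ⟨max M 0, le_max_right _ _, fun t ht => ?_⟩
  have hm : Measurable fun x : X => dist x₀ x ^ ζ := by fun_prop
  have h0 : ∀ x : X, 0 ≤ dist x₀ x ^ ζ := fun x => by positivity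
  constructor
  · refine ⟨hm.aestronglyMeasurable, ?_⟩
    rw [hasFiniteIntegral_iff_ofReal (Eventually.of_forall h0)]
    exact (hM t ht).trans_lt ENNReal.ofReal_lt_top
  · rw [integral_eq_lintegral_of_nonneg_ae (Eventually.of_forall h0) hm.aestronglyMeasurable]
    refine ENNReal.toReal_le_of_le_ofReal (le_max_right _ _) ((hM t ht).trans ?_)
    exact ENNReal.ofReal_le_ofReal (le_max_left _ _)

lemma min_lip (n : ℝ) : LipschitzWith 1 (fun x : X => min (dist x₀ x) n) :=
  (LipschitzWith.dist_right x₀).min_const n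

lemma star_mom (hP : IsMarkovSemigroup P) (hA3 : CondA3 P γ) (hA4 : CondA4 P μ x₀ ζ)
    (hinv : ∀ t, 0 ≤ t → measAct P t μstar = μstar) :
    Integrable (fun x => dist x₀ x) μstar := by
  obtain ⟨M, hM0, hM⟩ := A4_mom hP hA4
  have hz : 1 ≤ ζ := by linarith [hA4.1]
  have hb : ∀ n : ℕ, ∫ x, min (dist x₀ x) n ∂μstar ≤ 1 + M := by
    intro n
    have hbd : ∀ x : X, |min (dist x₀ x) (n:ℝ)| ≤ n := fun x => by
      rw [abs_of_nonneg (by positivity)]; exact min_le_right _ _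
    refine le_of_tendsto' (hP.limit_mean (μ := μ) hA3 hinv (min_lip (x₀ := x₀) n) hbd) fun k => ?_
    have pk := hP.prob_act (t := (k:ℝ)) k.cast_nonneg μ
    obtain ⟨i1, i2⟩ := hM k k.cast_nonneg
    calc ∫ x, min (dist x₀ x) n ∂(measAct P k μ)
        ≤ ∫ x, (1 + dist x₀ x ^ ζ) ∂(measAct P k μ) := by
          refine integral_mono (integrable_of_bdd (min_lip _).continuous.measurable ⟨n, hbd⟩)
            ((integrable_const _).add i1) fun x => ?_
          have := abs_le_one_add_rpow hz (dist x₀ x)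
          rw [abs_of_nonneg dist_nonneg] at this
          exact (min_le_left _ _).trans this
      _ = 1 + ∫ x, dist x₀ x ^ ζ ∂(measAct P k μ) := by
          rw [integral_add (integrable_const _) i1]; simp
      _ ≤ _ := by linarith
  have hl : ∫⁻ x, ENNReal.ofReal (dist x₀ x) ∂μstar ≤ ENNReal.ofReal (1 + M) := by
    have ht := lintegral_tendsto_of_tendsto_of_monotone (μ := μstar)
      (f := fun (n : ℕ) (x : X) => ENNReal.ofReal (min (dist x₀ x) n))
      (F := fun x => ENNReal.ofReal (dist x₀ x)) (fun n => by fun_prop)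
      (Eventually.of_forall fun x a b hab => by
        simp only
        refine ENNReal.ofReal_le_ofReal (min_le_min_left _ (by exact_mod_cast hab)))
      (Eventually.of_forall fun x => by
        refine tendsto_const_nhds.congr' ?_
        filter_upwards [eventually_ge_atTop ⌈dist x₀ x⌉₊] with n hn
        rw [min_eq_left ((Nat.le_ceil _).trans (by exact_mod_cast hn))])
    refine le_of_tendsto' ht fun n => ?_
    rw [← ofReal_integral_eq_lintegral_ofReal]
    · exact ENNReal.ofReal_le_ofReal (hb n)
    · refine integrable_of_bdd (min_lip _).continuous.measurable ⟨n, fun x => ?_⟩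
      rw [abs_of_nonneg (by positivity)]; exact min_le_right _ _
    · exact Eventually.of_forall fun x => by positivity
  refine ⟨by fun_prop, ?_⟩
  rw [hasFiniteIntegral_iff_ofReal (Eventually.of_forall fun x => dist_nonneg)]
  exact hl.trans_lt ENNReal.ofReal_lt_top

namespace IsMarkovSemigroup

lemma decay (hP : IsMarkovSemigroup P) (hA3 : CondA3 P γ)
    (hinv : ∀ t, 0 ≤ t → measAct P t μstar = μstar) (hV : Integrable (fun x => dist x₀ x) μstar)
    {f : X → ℝ} {K : ℝ≥0} (hf : LipschitzWith K f) (h0 : ∫ x, f x ∂μstar = 0) {t : ℝ} (ht : 0 ≤ t)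
    (x : X) : |funAct P t f x| ≤
      K * (Real.exp (-γ * t) * (dist x₀ x + ∫ y, dist x₀ y ∂μstar)) := by
  have hfi := lip_integrable hf hV
  have hfi' := hfi
  rw [← hinv t ht] at hfi'
  obtain ⟨i1, e1⟩ := hP.act_int hfi'
  rw [hinv t ht, h0] at e1
  have e : funAct P t f x = ∫ y, (funAct P t f x - funAct P t f y) ∂μstar := by
    rw [integral_sub (integrable_const _) i1, ← e1]; simp
  have i3 : Integrable (fun y => dist x₀ x + dist x₀ y) μstar := (integrable_const _).add hV
  rw [e]
  calc |∫ y, (funAct P t f x - funAct P t f y) ∂μstar|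
      ≤ ∫ y, |funAct P t f x - funAct P t f y| ∂μstar := abs_integral_le_integral_abs
    _ ≤ ∫ y, K * (Real.exp (-γ * t) * (dist x₀ x + dist x₀ y)) ∂μstar := by
        refine integral_mono ((integrable_const _).sub i1).abs ((i3.const_mul _).const_mul _)
          fun y => ?_
        refine (hP.contr hA3 ht hf x y).trans ?_
        gcongr
        rw [dist_comm x₀ x]
        exact dist_triangle _ _ _
    _ = _ := by
        rw [integral_const_mul, integral_const_mul, integral_add (integrable_const _) hV]; simp

lemma meas_t (hP : IsMarkovSemigroup P) {f : X → ℝ} (hf : Measurable f) (x : X) :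
    Measurable fun t => funAct P t f x :=
  (hP.measJ hf).comp (f := fun t : ℝ => (t, x)) (by fun_prop)

lemma exp_int (hA3 : CondA3 P γ) (c d : ℝ) :
    IntegrableOn (fun t : ℝ => c * (Real.exp (-γ * t) * d)) (Ioi 0) ∧
    ∫ t in Ioi (0:ℝ), c * (Real.exp (-γ * t) * d) = c / γ * d := by
  have hγ := hA3.2.1
  have i : IntegrableOn (fun t : ℝ => Real.exp (-γ * t)) (Ioi 0) :=
    integrableOn_exp_mul_Ioi (by linarith) 0
  refine ⟨(i.mul_const d).const_mul c, ?_⟩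
  rw [integral_const_mul, integral_mul_const, integral_exp_mul_Ioi (by linarith)]
  simp only [mul_zero, Real.exp_zero]
  field_simp

lemma corr_int (hP : IsMarkovSemigroup P) (hA3 : CondA3 P γ)
    (hinv : ∀ t, 0 ≤ t → measAct P t μstar = μstar) (hV : Integrable (fun x => dist x₀ x) μstar)
    {f : X → ℝ} {K : ℝ≥0} (hf : LipschitzWith K f) (h0 : ∫ x, f x ∂μstar = 0) (x : X) :
    IntegrableOn (fun t => funAct P t f x) (Ioi 0) := by
  refine (exp_int hA3 K (dist x₀ x + ∫ y, dist x₀ y ∂μstar)).1.mono'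
    (hP.meas_t hf.continuous.measurable x).aestronglyMeasurable ?_
  filter_upwards [ae_restrict_mem measurableSet_Ioi] with t ht
  exact hP.decay hA3 hinv hV hf h0 (le_of_lt ht) x

lemma corr_bound (hP : IsMarkovSemigroup P) (hA3 : CondA3 P γ)
    (hinv : ∀ t, 0 ≤ t → measAct P t μstar = μstar) (hV : Integrable (fun x => dist x₀ x) μstar)
    {f : X → ℝ} {K : ℝ≥0} (hf : LipschitzWith K f) (h0 : ∫ x, f x ∂μstar = 0) (x : X) :
    |corrector P f x| ≤ K / γ * (dist x₀ x + ∫ y, dist x₀ y ∂μstar) := by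
  rw [← (exp_int hA3 K (dist x₀ x + ∫ y, dist x₀ y ∂μstar)).2, corrector, ← Real.norm_eq_abs]
  refine norm_integral_le_of_norm_le (exp_int hA3 K _).1 ?_
  filter_upwards [ae_restrict_mem measurableSet_Ioi] with t ht
  exact hP.decay hA3 hinv hV hf h0 (le_of_lt ht) x

lemma corr_lip (hP : IsMarkovSemigroup P) (hA3 : CondA3 P γ)
    (hinv : ∀ t, 0 ≤ t → measAct P t μstar = μstar) (hV : Integrable (fun x => dist x₀ x) μstar)
    {f : X → ℝ} {K : ℝ≥0} (hf : LipschitzWith K f) (h0 : ∫ x, f x ∂μstar = 0) :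
    LipschitzWith (Real.toNNReal (K / γ)) (corrector P f) := by
  refine LipschitzWith.of_dist_le_mul fun x y => ?_
  rw [Real.coe_toNNReal _ (div_nonneg K.coe_nonneg hA3.2.1.le), Real.dist_eq,
    ← (exp_int hA3 K (dist x y)).2, corrector, corrector,
    ← integral_sub (hP.corr_int hA3 hinv hV hf h0 x) (hP.corr_int hA3 hinv hV hf h0 y), ← Real.norm_eq_abs]
  refine norm_integral_le_of_norm_le (exp_int hA3 K _).1 ?_
  filter_upwards [ae_restrict_mem measurableSet_Ioi] with t ht
  exact hP.contr hA3 (le_of_lt ht) hf x y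

end IsMarkovSemigroup

end

section
variable {X : Type*} [MetricSpace X] [CompleteSpace X] [SecondCountableTopology X]
  [MeasurableSpace X] [BorelSpace X]
variable {Ω : Type*} [mΩ : MeasurableSpace Ω]
variable {P : ℝ → X → Measure X} {γ ζ : ℝ} {x₀ : X} {μ μstar : Measure X}
  [IsProbabilityMeasure μ] [IsProbabilityMeasure μstar]
  {ℙ : Measure Ω} [IsProbabilityMeasure ℙ] {Φ : ℝ → Ω → X}

lemma natFiltration_mono : Monotone (natFiltration Φ) := fun s t hst => by
  unfold natFiltration
  exact biSup_mono fun u hu => ⟨hu.1, hu.2.trans hst⟩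

namespace IsMarkovProcess

lemma mT (h : IsMarkovProcess P Φ ℙ μ) (t : ℝ) : Measurable (Φ t) :=
  h.jointMeas.comp (f := fun x : Ω => (t, x)) (by fun_prop)

lemma nat_le (h : IsMarkovProcess P Φ ℙ μ) (t : ℝ) : natFiltration Φ t ≤ mΩ := by
  unfold natFiltration
  exact iSup₂_le fun u _ => (h.mT u).comap_le

lemma adap {t : ℝ} (ht : 0 ≤ t) : Measurable[natFiltration Φ t] (Φ t) := by
  rw [measurable_iff_comap_le]
  exact le_iSup₂_of_le (f := fun u (_ : u ∈ Icc 0 t) => MeasurableSpace.comap (Φ u) inferInstance)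
    t ⟨ht, le_rfl⟩ le_rfl

lemma growth (hP : IsMarkovSemigroup P) (hA4 : CondA4 P μ x₀ ζ) (h : IsMarkovProcess P Φ ℙ μ)
    {f : X → ℝ} (hf : Measurable f) {a b : ℝ} (ha : 0 ≤ a) (hb : 0 ≤ b)
    (hfb : ∀ x, |f x| ≤ a * (dist x₀ x + b)) :
    ∃ C, 0 ≤ C ∧ PathP ℙ (fun s ω => f (Φ s ω)) ζ C := by
  obtain ⟨M, hM0, hM⟩ := A4_mom hP hA4
  have hz : 0 ≤ ζ := by linarith [hA4.1]
  refine ⟨a^ζ * (2^ζ * (M + b^ζ)), by positivity, PathP.of_mom (hf.comp h.jointMeas) fun t ht => ?_⟩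
  obtain ⟨i1, i2⟩ := hM t ht
  rw [← h.law t ht] at i1 i2
  rw [integral_map (h.mT t).aemeasurable i1.1] at i2
  have i3 : Integrable (fun ω => dist x₀ (Φ t ω) ^ ζ) ℙ := i1.comp_measurable (h.mT t)
  refine Mom.of_le (hf.comp (h.mT t)).aestronglyMeasurable
    (g := fun ω => a^ζ * (2^ζ * (dist x₀ (Φ t ω) ^ ζ + b^ζ)))
    (((i3.add (integrable_const (b^ζ))).const_mul (2^ζ)).const_mul (a^ζ))
    (Eventually.of_forall fun ω => ?_) ?_
  · have h1 := add_rpow_bound hz (dist x₀ (Φ t ω)) b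
    rw [abs_of_nonneg (dist_nonneg (x := x₀)), abs_of_nonneg hb, abs_of_nonneg (by positivity)] at h1
    calc |f (Φ t ω)|^ζ ≤ (a * (dist x₀ (Φ t ω) + b))^ζ :=
          Real.rpow_le_rpow (abs_nonneg _) (hfb _) hz
      _ = a^ζ * (dist x₀ (Φ t ω) + b)^ζ := Real.mul_rpow ha (by positivity)
      _ ≤ _ := by gcongr
  · rw [integral_const_mul, integral_const_mul, integral_add i3 (integrable_const _)]
    simp only [integral_const, probReal_univ, one_smul]
    gcongr

lemma lip_growth {f : X → ℝ} {K : ℝ≥0} (hf : LipschitzWith K f) (x : X) :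
    |f x| ≤ ((K:ℝ) + 1) * (dist x₀ x + |f x₀|) := by
  have h1 := lip_bound hf x x₀
  rw [dist_comm] at h1
  have h2 := abs_sub_abs_le_abs_sub (f x) (f x₀)
  have h3 : 0 ≤ (K:ℝ) * |f x₀| := by positivity
  have h4 : 0 ≤ dist x₀ x := dist_nonneg
  nlinarith

lemma lip_path (hP : IsMarkovSemigroup P) (hA4 : CondA4 P μ x₀ ζ) (h : IsMarkovProcess P Φ ℙ μ)
    {f : X → ℝ} {K : ℝ≥0} (hf : LipschitzWith K f) :
    ∃ C, 0 ≤ C ∧ PathP ℙ (fun s ω => f (Φ s ω)) ζ C :=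
  growth hP hA4 h hf.continuous.measurable (by positivity) (abs_nonneg (f x₀)) (lip_growth hf)

lemma lip_i (hP : IsMarkovSemigroup P) (hA4 : CondA4 P μ x₀ ζ) (h : IsMarkovProcess P Φ ℙ μ)
    {f : X → ℝ} {K : ℝ≥0} (hf : LipschitzWith K f) {t : ℝ} (ht : 0 ≤ t) :
    Integrable (fun ω => f (Φ t ω)) ℙ := by
  obtain ⟨C, _, hC⟩ := lip_path hP hA4 h hf
  exact hC.i1 (by linarith [hA4.1]) ht

lemma markov_bdd (h : IsMarkovProcess P Φ ℙ μ)
    {f : X → ℝ} (hf : Measurable f) (hb : ∃ c, ∀ x, |f x| ≤ c) {t r : ℝ} (ht : 0 ≤ t) (hr : 0 ≤ r)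
    {Y : Ω → ℝ} (hY : Measurable[natFiltration Φ t] Y) (hYb : ∃ c, ∀ ω, |Y ω| ≤ c) :
    ∫ ω, Y ω * f (Φ (t + r) ω) ∂ℙ = ∫ ω, Y ω * funAct P r f (Φ t ω) ∂ℙ := by
  have hi : Integrable (fun ω => f (Φ (t + r) ω)) ℙ :=
    integrable_of_bdd (hf.comp (h.mT _)) (hb.imp fun c hc ω => hc _)
  rw [integral_mul_condExp' (h.nat_le t) hi hY hYb]
  refine integral_congr_ae ?_
  filter_upwards [h.markov f hf hb t r ht hr] with ω hω
  rw [hω]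

lemma clip_le (n y : ℝ) (hn : 0 ≤ n) : |clip n y| ≤ |y| := by
  unfold clip
  rcases le_total 0 y with h | h
  · rw [abs_of_nonneg h, abs_of_nonneg (le_max_of_le_right (le_min hn h))]
    exact max_le (by linarith) (min_le_right _ _)
  · rw [abs_of_nonpos h, min_eq_right (h.trans hn), abs_of_nonpos (max_le (by linarith) h)]
    linarith [le_max_right (-n) y]

lemma clip_tendsto (y : ℝ) : Tendsto (fun n : ℕ => clip n y) atTop (𝓝 y) := by
  refine tendsto_const_nhds.congr' ?_
  filter_upwards [eventually_ge_atTop ⌈|y|⌉₊] with n hn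
  exact (clip_eq ((Nat.le_ceil _).trans (by exact_mod_cast hn))).symm

lemma markov_lip (hP : IsMarkovSemigroup P) (hA3 : CondA3 P γ) (hA4 : CondA4 P μ x₀ ζ)
    (h : IsMarkovProcess P Φ ℙ μ)
    {f : X → ℝ} {K : ℝ≥0} (hf : LipschitzWith K f) {t r : ℝ} (ht : 0 ≤ t) (hr : 0 ≤ r)
    {Y : Ω → ℝ} (hY : Measurable[natFiltration Φ t] Y) (hYb : ∃ c, ∀ ω, |Y ω| ≤ c) :
    ∫ ω, Y ω * f (Φ (t + r) ω) ∂ℙ = ∫ ω, Y ω * funAct P r f (Φ t ω) ∂ℙ := by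
  have hm := hf.continuous.measurable
  have hYm : Measurable[mΩ] Y := hY.mono (h.nat_le t) le_rfl
  have hfn : ∀ n : ℕ, Measurable fun x => clip n (f x) := fun n => (measurable_clip _).comp hm
  have habs : LipschitzWith K (fun x => |f x|) := LipschitzWith.of_dist_le_mul fun x y => by
    rw [Real.dist_eq]
    exact (abs_abs_sub_abs_le _ _).trans (lip_bound hf x y)
  have hact : LipschitzWith K (funAct P r fun x => |f x|) := LipschitzWith.of_dist_le_mul fun x y => by
    rw [Real.dist_eq]
    refine (hP.contr hA3 hr habs x y).trans ?_
    have : Real.exp (-γ * r) ≤ 1 := Real.exp_le_one_iff.2 (by nlinarith [hA3.2.1])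
    have h2 : Real.exp (-γ * r) * dist x y ≤ dist x y := mul_le_of_le_one_left dist_nonneg this
    gcongr
  have e : ∀ n : ℕ, ∫ ω, Y ω * clip n (f (Φ (t + r) ω)) ∂ℙ =
      ∫ ω, Y ω * funAct P r (fun x => clip n (f x)) (Φ t ω) ∂ℙ := fun n =>
    markov_bdd h (hfn n) ⟨n, fun x => clip_abs n.cast_nonneg _⟩ ht hr hY hYb
  obtain ⟨c, hc⟩ := hYb
  have l1 : Tendsto (fun n : ℕ => ∫ ω, Y ω * clip n (f (Φ (t + r) ω)) ∂ℙ) atTop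
      (𝓝 (∫ ω, Y ω * f (Φ (t + r) ω) ∂ℙ)) := by
    refine tendsto_integral_of_dominated_convergence (fun ω => c * |f (Φ (t+r) ω)|) (fun n => ?_)
      ((lip_i hP hA4 h habs (by linarith)).const_mul c)
      (fun n => Eventually.of_forall fun ω => ?_) (Eventually.of_forall fun ω => ?_)
    · exact (hYm.mul ((hfn n).comp (h.mT _))).aestronglyMeasurable
    · rw [norm_mul]
      exact mul_le_mul (hc ω) (clip_le _ _ n.cast_nonneg) (abs_nonneg _)
        ((abs_nonneg _).trans (hc ω))
    · exact (clip_tendsto _).const_mul _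
  have l2 : Tendsto (fun n : ℕ => ∫ ω, Y ω * funAct P r (fun x => clip n (f x)) (Φ t ω) ∂ℙ) atTop
      (𝓝 (∫ ω, Y ω * funAct P r f (Φ t ω) ∂ℙ)) := by
    refine tendsto_integral_of_dominated_convergence
      (fun ω => c * funAct P r (fun x => |f x|) (Φ t ω)) (fun n => ?_)
      ((lip_i hP hA4 h hact ht).const_mul c)
      (fun n => Eventually.of_forall fun ω => ?_) (Eventually.of_forall fun ω => ?_)
    · exact (hYm.mul ((hP.measA (hfn n) r).comp (h.mT _))).aestronglyMeasurable
    · rw [norm_mul]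
      refine mul_le_mul (hc ω) ?_ (abs_nonneg _) ((abs_nonneg _).trans (hc ω))
      have := hP.prob r hr (Φ t ω)
      refine norm_integral_le_of_norm_le (lip_integrable habs (hP.ffm hA3 hr _ x₀))
        (Eventually.of_forall fun x => clip_le _ _ n.cast_nonneg)
    · have := hP.prob r hr (Φ t ω)
      refine Tendsto.const_mul _ ?_
      refine tendsto_integral_of_dominated_convergence (fun x => |f x|)
        (fun n => (hfn n).aestronglyMeasurable) (lip_integrable habs (hP.ffm hA3 hr _ x₀))
        (fun n => Eventually.of_forall fun x => clip_le _ _ n.cast_nonneg)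
        (Eventually.of_forall fun x => clip_tendsto _)
  simp only [e] at l1
  exact tendsto_nhds_unique l1 l2

lemma shift_int {a : ℝ → ℝ} {t : ℝ} : ∫ r in Ioi 0, a (t + r) = ∫ u in Ioi t, a u := by
  have := (measurePreserving_add_left volume t).setIntegral_preimage_emb
    (measurableEmbedding_addLeft t) a (Ioi t)
  simpa using this

lemma shift_on {a : ℝ → ℝ} {t : ℝ} :
    IntegrableOn (fun r => a (t + r)) (Ioi 0) ↔ IntegrableOn a (Ioi t) := by
  have := (measurePreserving_add_left volume t).integrableOn_comp_preimage
    (measurableEmbedding_addLeft t) (f := a) (s := Ioi t)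
  simpa [Function.comp_def] using this

lemma corr_key (hP : IsMarkovSemigroup P) (hA3 : CondA3 P γ) (hA4 : CondA4 P μ x₀ ζ)
    (hinv : ∀ t, 0 ≤ t → measAct P t μstar = μstar) (hV : Integrable (fun x => dist x₀ x) μstar)
    (h : IsMarkovProcess P Φ ℙ μ) {f : X → ℝ} {K : ℝ≥0} (hf : LipschitzWith K f)
    (h0 : ∫ x, f x ∂μstar = 0) {t : ℝ} (ht : 0 ≤ t)
    {Y : Ω → ℝ} (hY : Measurable[natFiltration Φ t] Y) (hYb : ∃ c, ∀ ω, |Y ω| ≤ c) :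
    IntegrableOn (fun u => ∫ ω, Y ω * f (Φ u ω) ∂ℙ) (Ioi t) ∧
    ∫ ω, Y ω * corrector P f (Φ t ω) ∂ℙ = ∫ u in Ioi t, ∫ ω, Y ω * f (Φ u ω) ∂ℙ := by
  have hm := hf.continuous.measurable
  have hYm : Measurable[mΩ] Y := hY.mono (h.nat_le t) le_rfl
  set m := ∫ y, dist x₀ y ∂μstar with hmdef
  have hpi : Integrable (fun p : ℝ × Ω => Y p.2 * funAct P p.1 f (Φ t p.2))
      ((volume.restrict (Ioi 0)).prod ℙ) := by
    have hd : Integrable (fun ω => dist x₀ (Φ t ω) + m) ℙ :=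
      (lip_i hP hA4 h (LipschitzWith.dist_right x₀) ht).add (integrable_const m)
    obtain ⟨c, hc⟩ := hYb
    have h1 := ((IsMarkovSemigroup.exp_int hA3 (K:ℝ) 1).1.mul_prod (hd.const_mul c))
    refine h1.mono' ?_ ?_
    · refine ((hYm.comp measurable_snd).mul ((hP.measJ hm).comp
        (measurable_fst.prodMk ((h.mT t).comp measurable_snd)))).aestronglyMeasurable
    · have : ∀ᵐ p : ℝ × Ω ∂((volume.restrict (Ioi 0)).prod ℙ), p.1 ∈ Ioi (0:ℝ) :=
        Measure.quasiMeasurePreserving_fst.ae (ae_restrict_mem measurableSet_Ioi)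
      filter_upwards [this] with p hp
      have d1 := hP.decay hA3 hinv hV hf h0 (le_of_lt hp) (Φ t p.2)
      rw [norm_mul]
      calc ‖Y p.2‖ * ‖funAct P p.1 f (Φ t p.2)‖
          ≤ c * (K * (Real.exp (-γ * p.1) * (dist x₀ (Φ t p.2) + m))) :=
            mul_le_mul (hc _) d1 (abs_nonneg _) ((abs_nonneg _).trans (hc p.2))
        _ = _ := by ring
  have e1 : ∀ r ∈ Ioi (0:ℝ), ∫ ω, Y ω * funAct P r f (Φ t ω) ∂ℙ = ∫ ω, Y ω * f (Φ (t + r) ω) ∂ℙ :=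
    fun r hr => (markov_lip hP hA3 hA4 h hf ht (le_of_lt hr) hY hYb).symm
  constructor
  · rw [← shift_on]
    exact IntegrableOn.congr_fun hpi.integral_prod_left e1 measurableSet_Ioi
  · rw [← shift_int (a := fun u => ∫ ω, Y ω * f (Φ u ω) ∂ℙ), ← setIntegral_congr_fun measurableSet_Ioi e1,
      integral_integral_swap (f := fun r ω => Y ω * funAct P r f (Φ t ω)) hpi]
    refine integral_congr_ae (Eventually.of_forall fun ω => ?_)
    simp only
    rw [integral_const_mul]
    rfl

lemma pair (hP : IsMarkovSemigroup P) (hA3 : CondA3 P γ) (hA4 : CondA4 P μ x₀ ζ)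
    (hinv : ∀ t, 0 ≤ t → measAct P t μstar = μstar) (hV : Integrable (fun x => dist x₀ x) μstar)
    (h : IsMarkovProcess P Φ ℙ μ) {f : X → ℝ} {K : ℝ≥0} (hf : LipschitzWith K f)
    (h0 : ∫ x, f x ∂μstar = 0) :
    ∃ C, Pair ℙ (natFiltration Φ) (fun s ω => f (Φ s ω)) (fun s ω => corrector P f (Φ s ω)) ζ C := by
  have hc := hP.corr_lip hA3 hinv hV hf h0
  obtain ⟨C1, h1, p1⟩ := lip_path hP hA4 h hf
  obtain ⟨C2, h2, p2⟩ := lip_path hP hA4 h hc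
  refine ⟨C1 + C2, natFiltration_mono, h.nat_le, ⟨p1.jm, p1.ip, fun s hs => ?_⟩,
    ⟨p2.jm, p2.ip, fun s hs => ?_⟩, fun s hs => hf.continuous.measurable.comp (adap hs),
    fun s hs => hc.continuous.measurable.comp (adap hs), fun s t hs hst Y hY hYb => ?_⟩
  · linarith [p1.bp s hs]
  · linarith [p2.bp s hs]
  · obtain ⟨i1, e1⟩ := corr_key hP hA3 hA4 hinv hV h hf h0 hs hY hYb
    obtain ⟨i2, e2⟩ := corr_key hP hA3 hA4 hinv hV h hf h0 (hs.trans hst)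
      (hY.mono (natFiltration_mono hst) le_rfl) hYb
    rw [e1, e2, ← intervalIntegral.integral_interval_add_Ioi i1 i2, add_comm]

end IsMarkovProcess

end

lemma clip_lip (n : ℝ) : LipschitzWith 1 (clip n) := by
  unfold clip
  exact (LipschitzWith.id.const_min n).const_max (-n)

lemma approx_lim {a : ℕ → ℝ} {q c : ℝ} {u v : ℕ → ℕ → ℝ} {U E : ℕ → ℝ}
    (hu : ∀ R, Tendsto (u R) atTop (𝓝 (U R))) (hv : ∀ R, Tendsto (v R) atTop (𝓝 (E R)))
    (h1 : ∀ R n, |a n - u R n| ≤ c * v R n) (h2 : ∀ R, |q - U R| ≤ c * E R)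
    (hE : Tendsto E atTop (𝓝 0)) : Tendsto a atTop (𝓝 q) := by
  rw [Metric.tendsto_nhds]
  intro ε hε
  have l1 : Tendsto (fun R => c * E R + c * E R) atTop (𝓝 0) := by
    simpa using (hE.const_mul c).add (hE.const_mul c)
  obtain ⟨R, hR⟩ := (l1.eventually_lt_const hε).exists
  have l2 : Tendsto (fun n => |u R n - U R| + c * v R n + c * E R) atTop
      (𝓝 (c * E R + c * E R)) := by
    have := (((hu R).sub_const (U R)).abs.add ((hv R).const_mul c)).add_const (c * E R)
    simpa using this
  filter_upwards [l2.eventually_lt_const hR] with n hn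
  refine lt_of_le_of_lt ?_ hn
  rw [Real.dist_eq]
  have e : a n - q = (a n - u R n) + (u R n - U R) - (q - U R) := by ring
  rw [e]
  have t1 := abs_sub (a n - u R n + (u R n - U R)) (q - U R)
  have t2 := abs_add_le (a n - u R n) (u R n - U R)
  linarith [h1 R n, h2 R]

section
variable {X : Type*} [MetricSpace X] [CompleteSpace X] [SecondCountableTopology X]
  [MeasurableSpace X] [BorelSpace X]
variable {Ω : Type*} [mΩ : MeasurableSpace Ω]
variable {P : ℝ → X → Measure X} {γ ζ : ℝ} {x₀ : X} {μ μstar : Measure X}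
  [IsProbabilityMeasure μ] [IsProbabilityMeasure μstar]
  {ℙ : Measure Ω} [IsProbabilityMeasure ℙ] {Φ : ℝ → Ω → X}

namespace IsMarkovProcess

lemma lip_ii (hP : IsMarkovSemigroup P) (hA4 : CondA4 P μ x₀ ζ) (h : IsMarkovProcess P Φ ℙ μ)
    {f : X → ℝ} {K : ℝ≥0} (hf : LipschitzWith K f) :
    ∀ᵐ ω ∂ℙ, ∀ n : ℕ, IntervalIntegrable (fun s => f (Φ s ω)) volume 0 n := by
  obtain ⟨C, _, hC⟩ := lip_path hP hA4 h hf
  exact ae_all_iff.2 fun n => hC.ae_ii (by linarith [hA4.1]) le_rfl n.cast_nonneg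

lemma lln_lip (hP : IsMarkovSemigroup P) (hA3 : CondA3 P γ) (hA4 : CondA4 P μ x₀ ζ)
    (hinv : ∀ t, 0 ≤ t → measAct P t μstar = μstar) (hV : Integrable (fun x => dist x₀ x) μstar)
    (h : IsMarkovProcess P Φ ℙ μ) {f : X → ℝ} {K : ℝ≥0} (hf : LipschitzWith K f) :
    ∀ᵐ ω ∂ℙ, Tendsto (fun n : ℕ => pint (fun s ω => f (Φ s ω)) 0 n ω / n) atTop
      (𝓝 (∫ x, f x ∂μstar)) := by
  set m := ∫ x, f x ∂μstar with hm
  have hf' : LipschitzWith K (fun x => f x - m) := LipschitzWith.of_dist_le_mul fun x y => by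
    rw [dist_sub_right]; exact hf.dist_le_mul x y
  have h0 : ∫ x, (f x - m) ∂μstar = 0 := by
    rw [integral_sub (lip_integrable hf hV) (integrable_const _)]; simp [hm]
  obtain ⟨C, hC⟩ := pair hP hA3 hA4 hinv hV h hf' h0
  filter_upwards [hC.lln (by linarith [hA4.1]), lip_ii hP hA4 h hf] with ω h1 h2
  have := h1.add_const m
  rw [zero_add] at this
  refine this.congr' ?_
  filter_upwards [eventually_gt_atTop 0] with n hn
  have hn' : (0:ℝ) < n := by exact_mod_cast hn
  unfold pint
  rw [intervalIntegral.integral_sub (h2 n) (by simp)]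
  simp only [intervalIntegral.integral_const, smul_eq_mul, sub_zero]
  field_simp
  ring

lemma lln_prod (hP : IsMarkovSemigroup P) (hA3 : CondA3 P γ) (hA4 : CondA4 P μ x₀ ζ)
    (hinv : ∀ t, 0 ≤ t → measAct P t μstar = μstar) (hV : Integrable (fun x => dist x₀ x) μstar)
    (h : IsMarkovProcess P Φ ℙ μ) {g χ : X → ℝ} {K L : ℝ≥0} {c : ℝ} (hg : LipschitzWith K g)
    (hc : ∀ x, |g x| ≤ c) (hχ : LipschitzWith L χ) :
    ∀ᵐ ω ∂ℙ, Tendsto (fun n : ℕ => pint (fun s ω => g (Φ s ω) * χ (Φ s ω)) 0 n ω / n) atTop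
      (𝓝 (∫ x, g x * χ x ∂μstar)) := by
  have hc0 : 0 ≤ c := (abs_nonneg _).trans (hc x₀)
  have hgm := hg.continuous.measurable
  have hχm := hχ.continuous.measurable
  have hcl : ∀ R : ℕ, LipschitzWith L (fun x => clip R (χ x)) := fun R => by
    simpa [Function.comp_def] using (clip_lip R).comp hχ
  have he : ∀ R : ℕ, LipschitzWith (L + L) (fun x => |χ x - clip R (χ x)|) := fun R =>
    LipschitzWith.of_dist_le_mul fun x y => by
      rw [Real.dist_eq]
      refine (abs_abs_sub_abs_le _ _).trans ?_
      have := (hχ.sub (hcl R)).dist_le_mul x y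
      rwa [Real.dist_eq] at this
  have hfl : ∀ R : ℕ, LipschitzWith (c.toNNReal * L + R * K) (fun x => g x * clip R (χ x)) := fun R =>
    LipschitzWith.of_dist_le_mul fun x y => by
      rw [Real.dist_eq]
      push_cast
      rw [Real.coe_toNNReal _ hc0]
      have e : g x * clip R (χ x) - g y * clip R (χ y)
        = g x * (clip R (χ x) - clip R (χ y)) + clip R (χ y) * (g x - g y) := by ring
      rw [e]
      refine (abs_add_le _ _).trans ?_
      rw [abs_mul, abs_mul, add_mul, mul_assoc, mul_assoc]
      exact add_le_add (mul_le_mul (hc _) (lip_bound (hcl R) x y) (abs_nonneg _) hc0)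
        (mul_le_mul (clip_abs R.cast_nonneg _) (lip_bound hg x y) (abs_nonneg _) R.cast_nonneg)
  have hpt : ∀ (R : ℕ) x, |g x * χ x - g x * clip R (χ x)| ≤ c * |χ x - clip R (χ x)| := fun R x => by
    rw [← mul_sub, abs_mul]
    exact mul_le_mul_of_nonneg_right (hc x) (abs_nonneg _)
  have hχi := lip_integrable hχ hV
  have hgχ : Integrable (fun x => g x * χ x) μstar := int_bdd_mul hχi hgm ⟨c, hc⟩
  have hE : Tendsto (fun R : ℕ => ∫ x, |χ x - clip R (χ x)| ∂μstar) atTop (𝓝 0) := by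
    have : Tendsto (fun R : ℕ => ∫ x, |χ x - clip R (χ x)| ∂μstar) atTop (𝓝 (∫ _, (0:ℝ) ∂μstar)) := by
      refine tendsto_integral_of_dominated_convergence (fun x => |χ x| + |χ x|)
        (fun R => (he R).continuous.measurable.aestronglyMeasurable) (hχi.abs.add hχi.abs)
        (fun R => Eventually.of_forall fun x => ?_) (Eventually.of_forall fun x => ?_)
      · rw [Real.norm_eq_abs, abs_abs]
        exact (abs_sub _ _).trans (add_le_add le_rfl (clip_le _ _ R.cast_nonneg))
      · simpa using ((clip_tendsto (χ x)).const_sub (χ x)).abs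
    simpa using this
  have a1 : ∀ᵐ ω ∂ℙ, ∀ R : ℕ, _ := ae_all_iff.2 fun R => lln_lip hP hA3 hA4 hinv hV h (hfl R)
  have a2 : ∀ᵐ ω ∂ℙ, ∀ R : ℕ, _ := ae_all_iff.2 fun R => lln_lip hP hA3 hA4 hinv hV h (he R)
  have a3 : ∀ᵐ ω ∂ℙ, ∀ R : ℕ, _ := ae_all_iff.2 fun R => lip_ii hP hA4 h (hfl R)
  have a4 : ∀ᵐ ω ∂ℙ, ∀ R : ℕ, _ := ae_all_iff.2 fun R => lip_ii hP hA4 h (he R)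
  have a5 := lip_ii hP hA4 h hχ
  filter_upwards [a1, a2, a3, a4, a5] with ω b1 b2 b3 b4 b5
  have hΦm : Measurable fun s => Φ s ω := h.jointMeas.comp (f := fun s : ℝ => (s, ω)) (by fun_prop)
  have b6 : ∀ n : ℕ, IntervalIntegrable (fun s => g (Φ s ω) * χ (Φ s ω)) volume 0 n := fun n => by
    have := b5 n
    rw [intervalIntegrable_iff] at this ⊢
    exact Integrable.bdd_mul (c := c) this (hgm.comp hΦm).aestronglyMeasurable
      (Eventually.of_forall fun s => hc _)
  refine approx_lim (c := c) b1 b2 (fun R n => ?_) (fun R => ?_) hE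
  · rw [← sub_div, abs_div, abs_of_nonneg (Nat.cast_nonneg n : (0:ℝ) ≤ n), ← mul_div_assoc]
    refine div_le_div_of_nonneg_right ?_ n.cast_nonneg
    unfold pint
    rw [← intervalIntegral.integral_sub (b6 n) (b3 R n), ← intervalIntegral.integral_const_mul]
    refine (intervalIntegral.abs_integral_le_integral_abs n.cast_nonneg).trans ?_
    exact intervalIntegral.integral_mono_on n.cast_nonneg ((b6 n).sub (b3 R n)).abs
      ((b4 R n).const_mul c) fun s _ => hpt R _
  · rw [← integral_sub hgχ (lip_integrable (hfl R) hV), ← integral_const_mul]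
    refine abs_integral_le_integral_abs.trans ?_
    exact integral_mono (hgχ.sub (lip_integrable (hfl R) hV)).abs
      ((lip_integrable (he R) hV).const_mul c) (hpt R)

end IsMarkovProcess
end

lemma phi_tendsto {s : ℝ} (hs : 0 < s) : Tendsto (phi s) atTop atTop := by
  refine Real.tendsto_sqrt_atTop.comp ?_
  have h1 : Tendsto (fun t : ℝ => 2 * s * t) atTop atTop :=
    tendsto_id.const_mul_atTop (by linarith)
  exact h1.atTop_mul_atTop₀ tendsto_LL

lemma up_real {I : ℝ → ℝ} {s C ε : ℝ} (hs : 0 < s) (hε : 0 < ε)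
    (hI : ∀ t, 0 ≤ t → |I t - I ⌊t⌋₊| ≤ C)
    (hup : ∀ᶠ n : ℕ in atTop, I n ≤ (1 + ε) * phi s n) :
    ∀ᶠ t : ℝ in atTop, I t / phi s t ≤ 1 + ε + ε := by
  filter_upwards [tendsto_nat_floor_atTop.eventually hup, eventually_ge_atTop (4:ℝ),
    (phi_tendsto hs).eventually_ge_atTop (C / ε), (phi_tendsto hs).eventually_gt_atTop 0]
    with t h1 h2 h3 h4
  rw [div_le_iff₀ h4]
  have h5 : (3:ℝ) ≤ ⌊t⌋₊ := by
    have := Nat.lt_floor_add_one t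
    linarith
  have h6 := phi_mono hs.le h5 (Nat.floor_le (by linarith : 0 ≤ t))
  have h7 := (abs_le.1 (hI t (by linarith))).2
  rw [div_le_iff₀ hε] at h3
  have h8 : (1 + ε) * phi s ⌊t⌋₊ ≤ (1 + ε) * phi s t := by gcongr
  linarith

lemma lil_det {I : ℝ → ℝ} {s C : ℝ} (hs : 0 < s)
    (hI : ∀ t, 0 ≤ t → |I t - I ⌊t⌋₊| ≤ C)
    (hup : ∀ k : ℕ, ∀ᶠ n : ℕ in atTop, I n ≤ (1 + 1 / ((k:ℝ) + 2)) * phi s n)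
    (hfr : ∀ k : ℕ, ∃ᶠ n : ℕ in atTop, (1 - 1 / ((k:ℝ) + 2)) * phi s n ≤ I n)
    (hup' : ∀ k : ℕ, ∀ᶠ n : ℕ in atTop, -I n ≤ (1 + 1 / ((k:ℝ) + 2)) * phi s n)
    (hfr' : ∀ k : ℕ, ∃ᶠ n : ℕ in atTop, (1 - 1 / ((k:ℝ) + 2)) * phi s n ≤ -I n) :
    liminf (fun t => I t / phi s t) atTop = -1 ∧ limsup (fun t => I t / phi s t) atTop = 1 := by
  have hε : ∀ k : ℕ, 0 < 1 / ((k:ℝ) + 2) := fun k => by positivity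
  have hlim : Tendsto (fun k : ℕ => 1 / ((k:ℝ) + 2)) atTop (𝓝 0) :=
    Tendsto.div_atTop tendsto_const_nhds (tendsto_atTop_add_const_right _ _ tendsto_natCast_atTop_atTop)
  have u1 : ∀ k : ℕ, ∀ᶠ t : ℝ in atTop, I t / phi s t ≤ 1 + 1 / ((k:ℝ) + 2) + 1 / ((k:ℝ) + 2) :=
    fun k => up_real hs (hε k) hI (hup k)
  have u2 : ∀ k : ℕ, ∀ᶠ t : ℝ in atTop, -(1 + 1 / ((k:ℝ) + 2) + 1 / ((k:ℝ) + 2)) ≤ I t / phi s t := by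
    intro k
    filter_upwards [up_real (I := fun t => - I t) (C := C) hs (hε k) (fun t ht => by
      have := hI t ht
      rw [← abs_neg] at this
      convert this using 2; ring) (hup' k)] with t ht
    rw [neg_div] at ht
    linarith
  have pos : ∀ᶠ n : ℕ in atTop, 0 < phi s n :=
    tendsto_natCast_atTop_atTop.eventually ((phi_tendsto hs).eventually_gt_atTop 0)
  have f1 : ∀ k : ℕ, ∃ᶠ t : ℝ in atTop, 1 - 1 / ((k:ℝ) + 2) ≤ I t / phi s t := fun k => by
    refine tendsto_natCast_atTop_atTop.frequently (((hfr k).and_eventually pos).mono ?_)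
    rintro n ⟨h1, h2⟩
    rwa [le_div_iff₀ h2]
  have f2 : ∀ k : ℕ, ∃ᶠ t : ℝ in atTop, I t / phi s t ≤ -(1 - 1 / ((k:ℝ) + 2)) := fun k => by
    refine tendsto_natCast_atTop_atTop.frequently (((hfr' k).and_eventually pos).mono ?_)
    rintro n ⟨h1, h2⟩
    rw [div_le_iff₀ h2]; linarith
  have b1 : IsBoundedUnder (· ≤ ·) atTop (fun t => I t / phi s t) := ⟨_, u1 0⟩
  have b2 : IsBoundedUnder (· ≥ ·) atTop (fun t => I t / phi s t) := ⟨_, u2 0⟩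
  have l1 : Tendsto (fun k : ℕ => 1 + 1 / ((k:ℝ) + 2) + 1 / ((k:ℝ) + 2)) atTop (𝓝 1) := by
    simpa using (hlim.const_add 1).add hlim
  have l2 : Tendsto (fun k : ℕ => 1 - 1 / ((k:ℝ) + 2)) atTop (𝓝 1) := by
    simpa using hlim.const_sub 1
  refine ⟨le_antisymm ?_ ?_, le_antisymm ?_ ?_⟩
  · exact ge_of_tendsto' l2.neg fun k => liminf_le_of_frequently_le (f2 k) b2
  · exact le_of_tendsto' l1.neg fun k => le_liminf_of_le b1.isCoboundedUnder_ge (u2 k)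
  · exact ge_of_tendsto' l1 fun k => limsup_le_of_le b2.isCoboundedUnder_le (u1 k)
  · exact le_of_tendsto' l2 fun k => le_limsup_of_frequently_le (f1 k) b1

section
variable {X : Type*} [MetricSpace X] [CompleteSpace X] [SecondCountableTopology X]
  [MeasurableSpace X] [BorelSpace X]
variable {Ω : Type*} [mΩ : MeasurableSpace Ω]
variable {P : ℝ → X → Measure X} {γ ζ : ℝ} {x₀ : X} {μ μstar : Measure X}
  [IsProbabilityMeasure μ] [IsProbabilityMeasure μstar]
  {ℙ : Measure Ω} [IsProbabilityMeasure ℙ] {Φ : ℝ → Ω → X}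

lemma corrector_neg (g : X → ℝ) (x : X) : corrector P (fun y => - g y) x = - corrector P g x := by
  unfold corrector funAct
  simp only [integral_neg]

namespace IsMarkovProcess

lemma half (hP : IsMarkovSemigroup P) (hA3 : CondA3 P γ) (hA4 : CondA4 P μ x₀ ζ)
    (hinv : ∀ t, 0 ≤ t → measAct P t μstar = μstar) (hV : Integrable (fun x => dist x₀ x) μstar)
    (h : IsMarkovProcess P Φ ℙ μ) {g : X → ℝ} {K : ℝ≥0} {c : ℝ} (hg : LipschitzWith K g)
    (hc : ∀ x, |g x| ≤ c) (h0 : ∫ x, g x ∂μstar = 0)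
    (hq : 0 < 2 * ∫ x, g x * corrector P g x ∂μstar) :
    ∀ᵐ ω ∂ℙ, ∀ k : ℕ,
      (∀ᶠ n : ℕ in atTop, addFun g Φ n ω ≤ (1 + 1 / ((k:ℝ) + 2)) *
        phi (2 * ∫ x, g x * corrector P g x ∂μstar) n) ∧
      (∃ᶠ n : ℕ in atTop, (1 - 1 / ((k:ℝ) + 2)) *
        phi (2 * ∫ x, g x * corrector P g x ∂μstar) n ≤ addFun g Φ n ω) := by
  obtain ⟨C, hC⟩ := pair hP hA3 hA4 hinv hV h hg h0
  have hz := hA4.1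
  have hC' := hC.down (q := min ζ 4) (le_min (by linarith) (by norm_num)) (min_le_left _ _)
  refine ae_all_iff.2 fun k => ?_
  have hk : (0:ℝ) < (k:ℝ) + 2 := by positivity
  have hk0 : (0:ℝ) ≤ (k:ℝ) := k.cast_nonneg
  exact hC'.lil (lt_min hz (by norm_num)) (min_le_right _ _) (c := c) (fun s ω => hc _)
    (lln_prod hP hA3 hA4 hinv hV h hg hc (hP.corr_lip hA3 hinv hV hg h0)) hq (by positivity)
    (by rw [div_le_div_iff₀ hk (by norm_num)]; linarith)

end IsMarkovProcess
end

/-- Theorem, LIL. Under (A1)–(A4), `σ_g² := 2∫ g χ_g dμ_*` is finite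
(i.e. `g·χ_g` is `μ_*`-integrable) and, whenever `σ_g² > 0`, the additive functional
`I_t(g)` satisfies the law of the iterated logarithm under `ℙ_μ`. -/
theorem lil_for_additive_functionals
    (P : ℝ → X → Measure X) (hP : IsMarkovSemigroup P)
    (γ ζ : ℝ) (x₀ : X) (μ μstar : Measure X)
    [IsProbabilityMeasure μ] [IsProbabilityMeasure μstar]
    (hA1 : CondA1 P) (hA2 : CondA2 P) (hA3 : CondA3 P γ) (hA4 : CondA4 P μ x₀ ζ)
    (hinv : ∀ t, 0 ≤ t → measAct P t μstar = μstar)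
    (g : X → ℝ) (K : ℝ≥0) (hLip : LipschitzWith K g) (hBd : ∃ C, ∀ x, |g x| ≤ C)
    (hmean : ∫ x, g x ∂μstar = 0)
    (ℙμ : Measure Ω) [IsProbabilityMeasure ℙμ]
    (Φ : ℝ → Ω → X) (hΦ : IsMarkovProcess P Φ ℙμ μ) :
    Integrable (fun x => g x * corrector P g x) μstar ∧
    (0 < 2 * ∫ x, g x * corrector P g x ∂μstar →
      ∀ᵐ ω ∂ℙμ,
        Filter.liminf (fun t : ℝ =>
            addFun g Φ t ω /
              Real.sqrt (2 * (2 * ∫ x, g x * corrector P g x ∂μstar) * t *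
                Real.log (Real.log t))) Filter.atTop = -1 ∧
        Filter.limsup (fun t : ℝ =>
            addFun g Φ t ω /
              Real.sqrt (2 * (2 * ∫ x, g x * corrector P g x ∂μstar) * t *
                Real.log (Real.log t))) Filter.atTop = 1) := by
  have hV := star_mom hP hA3 hA4 hinv
  obtain ⟨c, hc⟩ := hBd
  have hgm := hLip.continuous.measurable
  refine ⟨int_bdd_mul (lip_integrable (hP.corr_lip hA3 hinv hV hLip hmean) hV) hgm ⟨c, hc⟩,
    fun hq => ?_⟩
  have hLip' : LipschitzWith K (fun x => - g x) := hLip.neg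
  have hc' : ∀ x, |(fun x => - g x) x| ≤ c := fun x => by simpa using hc x
  have hmean' : ∫ x, (fun x => - g x) x ∂μstar = 0 := by simp [integral_neg, hmean]
  have eq : ∫ x, (fun x => - g x) x * corrector P (fun x => - g x) x ∂μstar
      = ∫ x, g x * corrector P g x ∂μstar := by
    simp only [corrector_neg, neg_mul_neg]
  have m1 := hΦ.half hP hA3 hA4 hinv hV hLip hc hmean hq
  have m2 := hΦ.half hP hA3 hA4 hinv hV hLip' hc' hmean' (by rw [eq]; exact hq)
  rw [eq] at m2
  have en : ∀ t ω, addFun (fun x => - g x) Φ t ω = - addFun g Φ t ω := fun t ω => by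
    unfold addFun
    rw [intervalIntegral.integral_neg]
  simp only [en] at m2
  filter_upwards [m1, m2] with ω h1 h2
  refine lil_det (I := fun t => addFun g Φ t ω) (C := c) hq (fun t ht => ?_)
    (fun k => (h1 k).1) (fun k => (h1 k).2) (fun k => (h2 k).1) (fun k => (h2 k).2)
  have hm : Measurable fun s => g (Φ s ω) :=
    hgm.comp (hΦ.jointMeas.comp (f := fun s : ℝ => (s, ω)) (by fun_prop))
  have hii : ∀ a b : ℝ, IntervalIntegrable (fun s => g (Φ s ω)) volume a b := fun a b => by
    rw [intervalIntegrable_iff]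
    have : IsFiniteMeasure (volume.restrict (uIoc a b)) := by unfold uIoc; infer_instance
    exact Integrable.of_bound hm.aestronglyMeasurable c (Eventually.of_forall fun s => hc _)
  unfold addFun
  rw [intervalIntegral.integral_interval_sub_left (hii _ _) (hii _ _)]
  have h3 := intervalIntegral.norm_integral_le_of_norm_le_const (a := (⌊t⌋₊ : ℝ)) (b := t) (C := c)
    (f := fun s => g (Φ s ω)) (fun s _ => hc _)
  refine h3.trans ?_
  have h4 := Nat.floor_le ht
  have h5 := Nat.lt_floor_add_one t
  have hc0 : 0 ≤ c := (abs_nonneg _).trans (hc x₀)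
  rw [abs_of_nonneg (by linarith)]
  exact mul_le_of_le_one_right hc0 (by linarith)

end
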